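/- Let N ≥ 2 be an integer, q ∈ (1, ∞), σ ∈ (0, π/2), ρ₊ > 0, ρ₋ > 0, and c > 0. There exists a constant C = C(N, q, σ, ρ₊, ρ₋, c) > 0 with the following property. Let λ ∈ ℂ with λ ≠ 0 and |arg λ| < π − σ, let ρ_a ∈ {ρ₊, ρ₋}, set A(ξ') = √(ρ_a λ + ‖ξ'‖²) (principal square root), and let k : ℝ^{N−1} → ℂ be smooth on ℝ^{N−1} ∖ {0} with ‖D^n k(ξ')‖ ≤ c (|λ|^{1/2} + ‖ξ'‖)^{−n} for all ξ' ≠ 0 and all 0 ≤ n ≤ N + 1. Then for every Schwartz function f ∈ 𝓢(ℝ^N; ℂ), the function K f defined for x = (x', x_N) with x_N > 0 by K f(x) = (2π)^{−(N−1)} ∫_{ℝ^{N−1}} e^{i x'·ξ'} k(ξ') e^{−A(ξ') x_N} f̂(ξ', 0) dξ', where f̂(ξ', 0) = ∫_{ℝ^{N−1}} e^{−i z'·ξ'} f(z', 0) dz', satisfies, for each sign ς ∈ {+1, −1}, |λ|^{1/2} ‖K f‖_{L^q(ℝ^N_+)} + ‖∇ K f‖_{L^q(ℝ^N_+)} ≤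 C ( |λ|^{1/2} ‖f‖_{L^q(ℝ^N_ς)} + ‖∇f‖_{L^q(ℝ^N_ς)} ), with C independent of λ, k, and f. -/

import Mathlib

open Real MeasureTheory
open scoped RealInnerProductSpace

/-- The `L^p` norm (real exponent `p`) of `f` with respect to the measure `μ`. -/
noncomputable def LqNorm {α : Type*} [MeasurableSpace α] {E : Type*} [NormedAddCommGroup E]
    (μ : Measure α) (p : ℝ) (f : α → E) : ℝ :=
  (∫ x, ‖f x‖ ^ p ∂μ) ^ (1 / p)

set_option linter.unusedSectionVars false

open scoped ENNReal

/-- Minkowski's integral inequality, with an explicit bound `b` for the `L^q` norms of the slices. -/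
theorem lintegral_rpow_lintegral_le {α β : Type*} [MeasurableSpace α] [MeasurableSpace β]
    {μ : Measure α} {ν : Measure β} [SFinite μ] [SFinite ν] {q : ℝ} (hq : 1 < q)
    {W : α → β → ℝ≥0∞} (hW : Measurable (Function.uncurry W)) {b : β → ℝ≥0∞} (hb : Measurable b)
    (hb0 : ∀ᵐ y ∂ν, b y ≠ 0) (hbt : ∀ᵐ y ∂ν, b y ≠ ∞) {M : ℝ≥0∞}
    (h : ∀ᵐ y ∂ν, ∫⁻ x, W x y ^ q ∂μ ≤ b y ^ q * M) :
    ∫⁻ x, (∫⁻ y, W x y ∂ν) ^ q ∂μ ≤ (∫⁻ y, b y ∂ν) ^ q * M := by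
  have hqpos : 0 < q := by linarith
  set p : ℝ := q / (q - 1) with hp
  have hpq : q.HolderConjugate p := Real.HolderConjugate.conjExponent hq
  have hp1 : q / p = q - 1 := by
    rw [hp]; field_simp
  have key : ∀ x, (∫⁻ y, W x y ∂ν) ^ q ≤
      (∫⁻ y, W x y ^ q * b y ^ (-(q - 1)) ∂ν) * (∫⁻ y, b y ∂ν) ^ (q - 1) := by
    intro x
    have hWx : Measurable (W x) := hW.comp measurable_prodMk_left
    have e1 : ∫⁻ y, W x y ∂ν = ∫⁻ y, ((fun y => W x y * b y ^ (-(1 / p))) *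
        (fun y => b y ^ (1 / p))) y ∂ν := by
      apply lintegral_congr_ae
      filter_upwards [hb0, hbt] with y h0 ht
      simp only [Pi.mul_apply]
      rw [mul_assoc, ← ENNReal.rpow_add _ _ h0 ht]
      simp
    rw [e1]
    have := ENNReal.lintegral_mul_le_Lp_mul_Lq ν hpq
      (f := fun y => W x y * b y ^ (-(1 / p))) (g := fun y => b y ^ (1 / p))
      (hWx.mul (hb.pow_const _)).aemeasurable (hb.pow_const _).aemeasurable
    refine (ENNReal.rpow_le_rpow this hqpos.le).trans ?_
    rw [ENNReal.mul_rpow_of_nonneg _ _ hqpos.le, ← ENNReal.rpow_mul, ← ENNReal.rpow_mul]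
    rw [one_div_mul_cancel hqpos.ne', ENNReal.rpow_one, one_div_mul_eq_div, hp1]
    have hp0 : p ≠ 0 := hpq.symm.ne_zero
    apply le_of_eq
    congr 1
    · congr 1 with y
      rw [ENNReal.mul_rpow_of_nonneg _ _ hqpos.le, ← ENNReal.rpow_mul]
      congr 2
      rw [← hp1]; ring
    · congr 2 with y
      rw [← ENNReal.rpow_mul, one_div_mul_cancel hp0, ENNReal.rpow_one]
  calc ∫⁻ x, (∫⁻ y, W x y ∂ν) ^ q ∂μ
      ≤ ∫⁻ x, (∫⁻ y, W x y ^ q * b y ^ (-(q - 1)) ∂ν) * (∫⁻ y, b y ∂ν) ^ (q - 1) ∂μ :=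
        lintegral_mono key
    _ = (∫⁻ x, ∫⁻ y, W x y ^ q * b y ^ (-(q - 1)) ∂ν ∂μ) * (∫⁻ y, b y ∂ν) ^ (q - 1) := by
        apply lintegral_mul_const
        apply Measurable.lintegral_prod_right'
          (f := fun z : α × β => W z.1 z.2 ^ q * b z.2 ^ (-(q - 1)))
        exact (hW.pow_const _).mul ((hb.comp measurable_snd).pow_const _)
    _ = (∫⁻ y, (∫⁻ x, W x y ^ q ∂μ) * b y ^ (-(q - 1)) ∂ν) * (∫⁻ y, b y ∂ν) ^ (q - 1) := by
        congr 1
        rw [lintegral_lintegral_swap]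
        · congr 1 with y
          apply lintegral_mul_const
          exact (hW.comp measurable_prodMk_right).pow_const _
        · exact ((hW.pow_const _).mul ((hb.comp measurable_snd).pow_const _)).aemeasurable
    _ ≤ (∫⁻ y, b y * M ∂ν) * (∫⁻ y, b y ∂ν) ^ (q - 1) := by
        gcongr ?_ * _
        apply lintegral_mono_ae
        filter_upwards [hb0, hbt, h] with y h0 ht hy
        calc _ ≤ b y ^ q * M * b y ^ (-(q - 1)) := by gcongr
          _ = b y ^ q * b y ^ (-(q - 1)) * M := by ring
          _ = _ := by
            rw [← ENNReal.rpow_add _ _ h0 ht]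
            simp
    _ = (∫⁻ y, b y ∂ν) ^ q * M := by
        rw [lintegral_mul_const _ hb]
        have : (∫⁻ y, b y ∂ν) ^ q = (∫⁻ y, b y ∂ν) ^ (1 : ℝ) * (∫⁻ y, b y ∂ν) ^ (q - 1) := by
          rw [← ENNReal.rpow_add_of_nonneg _ _ zero_le_one (by linarith)]
          congr 1; ring
        rw [this, ENNReal.rpow_one]; ring

/-- Young's inequality `L¹ * L^q ⊆ L^q`. -/
theorem lintegral_rpow_conv_le {E : Type*} [AddCommGroup E] [MeasurableSpace E]
    [MeasurableAdd₂ E] [MeasurableNeg E] {μ : Measure E} [SFinite μ] [μ.IsAddLeftInvariant]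
    [μ.IsNegInvariant] {q : ℝ} (hq : 1 < q)
    {G h : E → ℝ≥0∞} (hG : Measurable G) (hh : Measurable h) (hGt : ∫⁻ z, G z ∂μ ≠ ∞) :
    ∫⁻ x, (∫⁻ z, G (x - z) * h z ∂μ) ^ q ∂μ ≤
      (∫⁻ z, G z ∂μ) ^ q * ∫⁻ z, h z ^ q ∂μ := by
  have hqpos : 0 < q := by linarith
  have hsub : Measurable fun p : E × E => p.1 - p.2 := by
    simp_rw [sub_eq_add_neg]
    exact measurable_fst.add measurable_snd.neg
  have e1 : ∀ x, ∫⁻ z, G (x - z) * h z ∂μ = ∫⁻ z, G z * h (x - z) ∂μ := by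
    intro x
    rw [← lintegral_sub_left_eq_self _ x]
    simp
  simp_rw [e1]
  set S := {z | G z ≠ 0} with hS
  have hSm : MeasurableSet S := (hG (measurableSet_singleton 0)).compl
  have e2 : ∀ x, ∫⁻ z, G z * h (x - z) ∂μ = ∫⁻ z in S, G z * h (x - z) ∂μ := by
    intro x
    rw [setLIntegral_eq_of_support_subset]
    intro z hz
    simp only [Function.mem_support, ne_eq, mul_eq_zero, not_or] at hz
    exact hz.1
  simp_rw [e2]
  refine (lintegral_rpow_lintegral_le (W := fun x z => G z * h (x - z)) (b := G)
    (M := ∫⁻ z, h z ^ q ∂μ) hq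
    ?_ hG ?_ ?_ ?_).trans ?_
  · exact (hG.comp measurable_snd).mul (hh.comp hsub)
  · exact ae_restrict_mem hSm
  · exact ae_restrict_of_ae ((ae_lt_top hG hGt).mono fun _ h => h.ne)
  · refine Filter.Eventually.of_forall fun z => ?_
    simp_rw [ENNReal.mul_rpow_of_nonneg _ _ hqpos.le]
    rw [lintegral_const_mul _ (by
      exact (hh.comp (hsub.comp (measurable_id.prodMk measurable_const))).pow_const _)]
    simp_rw [sub_eq_add_neg]
    apply le_of_eq
    congr 1
    exact lintegral_add_right_eq_self (μ := μ) (fun x => h x ^ q) (-z)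
  · gcongr
    exact Measure.restrict_le_self

theorem exists_one_le_cos_rpow {q : ℝ} (hq : 1 < q) (hq2 : q ≤ 2) :
    ∃ a b : ℝ, 0 ≤ a ∧ 0 ≤ b ∧ ∀ θ : ℝ, |θ| ≤ π / 2 →
      1 ≤ a * cos θ ^ q - b * cos (θ * q) := by
  have hπ := Real.pi_pos
  set t : ℝ := (q + 1) * π / 4 with ht
  have ht1 : π / 2 < t := by rw [ht]; nlinarith
  have ht2 : t < π := by rw [ht]; nlinarith
  have hct : cos t < 0 := Real.cos_neg_of_pi_div_two_lt_of_lt ht1 (by linarith)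
  have hq0 : 0 < q := by linarith
  have htq : t / q < π / 2 := by
    rw [div_lt_iff₀ hq0, ht]; nlinarith
  have htq0 : 0 < t / q := by positivity
  have hc0 : 0 < cos (t / q) := Real.cos_pos_of_mem_Ioo ⟨by linarith, htq⟩
  have hb : 0 ≤ 1 / (- cos t) := by
    have : 0 < - cos t := by linarith
    positivity
  refine ⟨(1 + 1 / (- cos t)) / cos (t / q) ^ q, 1 / (- cos t), by positivity, hb, ?_⟩
  intro θ hθ
  have e1 : cos θ = cos |θ| := (Real.cos_abs θ).symm
  have e2 : cos (θ * q) = cos (|θ| * q) := by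
    rw [← Real.cos_abs (θ * q), abs_mul, abs_of_pos hq0]
  rw [e1, e2]
  have hθ0 := abs_nonneg θ
  generalize |θ| = u at *
  have hcu : 0 ≤ cos u := Real.cos_nonneg_of_mem_Icc ⟨by linarith, hθ⟩
  rcases le_total (t / q) u with h | h
  · have h1 : t ≤ u * q := by rwa [div_le_iff₀ hq0] at h
    have h2 : cos (u * q) ≤ cos t :=
      Real.cos_le_cos_of_nonneg_of_le_pi (by linarith) (by nlinarith) h1
    have h3 : 1 / (- cos t) * (- cos t) = 1 := by
      rw [one_div_mul_cancel]; linarith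
    have h4 : 0 ≤ (1 + 1 / (- cos t)) / cos (t / q) ^ q * cos u ^ q := by positivity
    nlinarith
  · have h1 : cos (t / q) ≤ cos u :=
      Real.cos_le_cos_of_nonneg_of_le_pi hθ0 (by linarith) h
    have h2 : cos (t / q) ^ q ≤ cos u ^ q := Real.rpow_le_rpow hc0.le h1 hq0.le
    have h3 : 0 < cos (t / q) ^ q := by positivity
    have h4 : 1 + 1 / (- cos t) ≤ (1 + 1 / (- cos t)) / cos (t / q) ^ q * cos u ^ q := by
      rw [div_mul_eq_mul_div, le_div_iff₀ h3]
      gcongr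
    have h5 := Real.cos_le_one (u * q)
    nlinarith

theorem exists_norm_rpow_le_re {q : ℝ} (hq : 1 < q) (hq2 : q ≤ 2) :
    ∃ a b : ℝ, 0 ≤ a ∧ 0 ≤ b ∧ ∀ w : ℂ, 0 ≤ w.re →
      ‖w‖ ^ q ≤ a * w.re ^ q - b * (w ^ (q : ℂ)).re := by
  obtain ⟨a, b, ha, hb, h⟩ := exists_one_le_cos_rpow hq hq2
  refine ⟨a, b, ha, hb, fun w hw => ?_⟩
  have h1 := h w.arg (Complex.abs_arg_le_pi_div_two_iff.2 hw)
  rw [Complex.cpow_ofReal_re]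
  have h2 : w.re = ‖w‖ * cos w.arg := (Complex.norm_mul_cos_arg w).symm
  have hc : 0 ≤ cos w.arg :=
    Real.cos_nonneg_of_mem_Icc (abs_le.1 (Complex.abs_arg_le_pi_div_two_iff.2 hw))
  have h3 : w.re ^ q = ‖w‖ ^ q * cos w.arg ^ q := by
    rw [h2, Real.mul_rpow (norm_nonneg _) hc]
  rw [h3]
  have h4 : 0 ≤ ‖w‖ ^ q := by positivity
  nlinarith

/-- The Cauchy-type integral of `h`, holomorphic in the right half plane. -/
noncomputable def cauchyInt (h : ℝ → ℂ) (w : ℂ) : ℂ := ∫ z, h z / (w + Complex.I * z)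

theorem re_le_norm_add_I_mul (w : ℂ) (z : ℝ) : w.re ≤ ‖w + Complex.I * z‖ := by
  have := Complex.re_le_norm (w + Complex.I * z)
  simpa using this

theorem integrable_div_add_I_mul {h : ℝ → ℂ} (hi : Integrable h) {w : ℂ} (hw : 0 < w.re) :
    Integrable fun z : ℝ => h z / (w + Complex.I * z) := by
  simp_rw [div_eq_mul_inv]
  refine hi.mul_bdd (c := w.re⁻¹) ?_ (Filter.Eventually.of_forall fun z => ?_)
  · exact (by fun_prop : Measurable fun z : ℝ => (w + Complex.I * z)⁻¹).aestronglyMeasurable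
  · rw [norm_inv]
    gcongr
    exact re_le_norm_add_I_mul w z

theorem norm_cauchyInt_le (h : ℝ → ℂ) {w : ℂ} (hi : Integrable h) (hw : 0 < w.re) :
    ‖cauchyInt h w‖ ≤ (∫ z, ‖h z‖) / w.re := by
  rw [cauchyInt, ← integral_div]
  refine norm_integral_le_of_norm_le (hi.norm.div_const _) (Filter.Eventually.of_forall fun z => ?_)
  rw [norm_div]
  gcongr
  exact re_le_norm_add_I_mul w z

theorem norm_cauchyInt_mul_im_le (h : ℝ → ℂ) {w : ℂ} (hi : Integrable h)
    (hi' : Integrable fun z : ℝ => (z : ℂ) * h z) (hw : 0 < w.re) :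
    ‖cauchyInt h w‖ * |w.im| ≤ (∫ z, ‖h z‖) + (∫ z : ℝ, ‖(z : ℂ) * h z‖) / w.re := by
  have key : cauchyInt h w * w.im = ∫ z, h z / (w + Complex.I * z) * w.im := by
    rw [cauchyInt, integral_mul_const]
  have : ‖cauchyInt h w * w.im‖ ≤ (∫ z, ‖h z‖) + (∫ z : ℝ, ‖(z : ℂ) * h z‖) / w.re := by
    rw [key, ← integral_div, ← integral_add hi.norm (hi'.norm.div_const _)]
    refine norm_integral_le_of_norm_le (hi.norm.add (hi'.norm.div_const _))
      (Filter.Eventually.of_forall fun z => ?_)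
    have h1 : |w.im| ≤ ‖w + Complex.I * z‖ + |z| := by
      have := Complex.abs_im_le_norm (w + Complex.I * z)
      simp only [Complex.add_im, Complex.mul_im, Complex.I_re, Complex.I_im, Complex.ofReal_re,
        Complex.ofReal_im] at this
      have h2 := abs_sub_abs_le_abs_sub w.im (-z)
      rw [abs_neg] at h2
      have h3 : |w.im - -z| = |w.im + (0 * 0 + 1 * z)| := by congr 1; ring
      linarith
    have h0 := re_le_norm_add_I_mul w z
    have hpos : 0 < ‖w + Complex.I * z‖ := by linarith
    rw [norm_mul, norm_div, norm_mul, Complex.norm_real, Complex.norm_real, Real.norm_eq_abs,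
      Real.norm_eq_abs]
    calc ‖h z‖ / ‖w + Complex.I * z‖ * |w.im|
        ≤ ‖h z‖ / ‖w + Complex.I * z‖ * (‖w + Complex.I * z‖ + |z|) := by gcongr
      _ = ‖h z‖ + |z| * ‖h z‖ / ‖w + Complex.I * z‖ := by field_simp
      _ ≤ _ := by gcongr
  simpa [norm_mul] using this

theorem differentiableOn_cauchyInt {h : ℝ → ℂ} (hi : Integrable h) :
    DifferentiableOn ℂ (cauchyInt h) {w | 0 < w.re} := by
  intro w hw
  have hw : 0 < w.re := hw
  apply DifferentiableAt.differentiableWithinAt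
  have hball : ∀ x ∈ Metric.ball w (w.re / 2), w.re / 2 < x.re := by
    intro x hx
    rw [Metric.mem_ball, dist_eq_norm] at hx
    have h1 := Complex.abs_re_le_norm (x - w)
    rw [Complex.sub_re] at h1
    have := (abs_lt.1 (h1.trans_lt hx)).1
    linarith
  have := hasDerivAt_integral_of_dominated_loc_of_deriv_le (μ := volume)
    (F := fun (w : ℂ) (z : ℝ) => h z / (w + Complex.I * z))
    (F' := fun (w : ℂ) (z : ℝ) => - h z / (w + Complex.I * z) ^ 2)
    (x₀ := w) (s := Metric.ball w (w.re / 2)) (bound := fun z => ‖h z‖ / (w.re / 2) ^ 2)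
    (Metric.ball_mem_nhds _ (by positivity)) ?_ (integrable_div_add_I_mul hi hw) ?_ ?_ ?_ ?_
  · exact this.2.differentiableAt
  · filter_upwards [Metric.ball_mem_nhds w (half_pos hw)] with x hx
    exact (integrable_div_add_I_mul hi ((half_pos hw).trans (hball x hx))).aestronglyMeasurable
  · simp_rw [div_eq_mul_inv]
    refine hi.aestronglyMeasurable.neg.mul ?_
    exact (by fun_prop : Measurable fun z : ℝ => ((w + Complex.I * z) ^ 2)⁻¹).aestronglyMeasurable
  · refine Filter.Eventually.of_forall fun z x hx => ?_
    rw [norm_div, norm_neg, norm_pow]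
    gcongr
    exact (hball x hx).le.trans (re_le_norm_add_I_mul x z)
  · exact hi.norm.div_const _
  · refine Filter.Eventually.of_forall fun z x hx => ?_
    have hne : x + Complex.I * z ≠ 0 := by
      intro h0
      have := re_le_norm_add_I_mul x z
      rw [h0, norm_zero] at this
      linarith [hball x hx]
    have := (((hasDerivAt_id x).add_const (Complex.I * z)).inv hne).const_mul (h z)
    refine (this.congr_deriv ?_).congr_of_eventuallyEq (Filter.Eventually.of_forall fun y => ?_)
    · simp only [id]; ring
    · simp only [Pi.inv_apply, id, div_eq_mul_inv]

theorem cauchyInt_re_pos {h : ℝ → ℝ} (h0 : ∀ z, 0 ≤ h z) (hi : Integrable h)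
    (hne : ¬ h =ᵐ[volume] 0) {w : ℂ} (hw : 0 < w.re) :
    0 < (cauchyInt (fun z => (h z : ℂ)) w).re := by
  have hInt := integrable_div_add_I_mul (h := fun z => (h z : ℂ)) hi.ofReal hw
  rw [cauchyInt, ← Complex.reCLM_apply, ← ContinuousLinearMap.integral_comp_comm _ hInt]
  have e : ∀ z : ℝ, Complex.reCLM ((h z : ℂ) / (w + Complex.I * z)) =
      h z * (w.re / Complex.normSq (w + Complex.I * z)) := by
    intro z
    rw [Complex.reCLM_apply, Complex.div_re]
    simp
    ring
  have hpos : ∀ z : ℝ, 0 < w.re / Complex.normSq (w + Complex.I * z) := by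
    intro z
    apply div_pos hw
    rw [Complex.normSq_pos]
    intro h0
    have := re_le_norm_add_I_mul w z
    rw [h0, norm_zero] at this
    linarith
  have hInt' := Complex.reCLM.integrable_comp hInt
  simp_rw [e] at hInt' ⊢
  rw [integral_pos_iff_support_of_nonneg (fun z => mul_nonneg (h0 z) (hpos z).le) hInt']
  have hs : (Function.support fun z => h z * (w.re / Complex.normSq (w + Complex.I * z))) =
      Function.support h := by
    ext z
    simp
    intro _
    exact ⟨hw.ne', by
      intro h0
      have := hpos z
      rw [h0] at this; simp at this⟩
  rw [hs, pos_iff_ne_zero]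
  intro hz
  apply hne
  exact hz

theorem norm_cauchyInt_rpow_le {h : ℝ → ℂ} {q M R : ℝ} {w : ℂ} (hq : 0 ≤ q)
    (hM : ‖cauchyInt h w‖ ≤ M / R) : ‖cauchyInt h w ^ (q : ℂ)‖ ≤ (M / R) ^ q := by
  refine (Complex.norm_cpow_le _ _).trans ?_
  simp only [Complex.ofReal_re, Complex.ofReal_im, mul_zero, Real.exp_zero, div_one]
  exact Real.rpow_le_rpow (norm_nonneg _) hM hq

theorem differentiableOn_cauchyInt_rpow {q : ℝ} {h : ℝ → ℝ} (h0 : ∀ z, 0 ≤ h z)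
    (hi : Integrable h) (hne : ¬ h =ᵐ[volume] 0) :
    DifferentiableOn ℂ (fun w => cauchyInt (fun z => (h z : ℂ)) w ^ (q : ℂ)) {w | 0 < w.re} := by
  intro w hw
  refine DifferentiableWithinAt.cpow_const (differentiableOn_cauchyInt hi.ofReal w hw) ?_
  exact Or.inl (cauchyInt_re_pos h0 hi hne hw)

theorem norm_intervalIntegral_cauchyInt_rpow_le {q : ℝ} (hq : 1 < q) {h : ℝ → ℝ}
    (h0 : ∀ z, 0 ≤ h z)
    (hi : Integrable h) (hi' : Integrable fun z : ℝ => (z : ℂ) * (h z : ℂ))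
    (hne : ¬ h =ᵐ[volume] 0) {τ : ℝ} (hτ : 0 < τ) :
    ∃ M : ℝ, ∀ R : ℝ, τ < R →
      ‖∫ y in (-R)..R, cauchyInt (fun z => (h z : ℂ)) (τ + y * Complex.I) ^ (q : ℂ)‖ ≤
        4 * (M ^ q * R ^ (1 - q)) := by
  have hiC : Integrable fun z => (h z : ℂ) := hi.ofReal
  set H : ℝ → ℂ := fun z => (h z : ℂ) with hH
  set M1 := ∫ z, ‖H z‖ with hM1
  set M2 := ∫ z : ℝ, ‖(z : ℂ) * H z‖ with hM2
  have hM1' : 0 ≤ M1 := integral_nonneg fun _ => norm_nonneg _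
  have hM2' : 0 ≤ M2 := integral_nonneg fun _ => norm_nonneg _
  refine ⟨M1 + M2 / τ, fun R hR => ?_⟩
  set M := M1 + M2 / τ with hM
  have hR0 : 0 < R := hτ.trans hR
  have hMn : 0 ≤ M := by positivity
  have hq0 : 0 ≤ q := by linarith
  have hrect := Complex.integral_boundary_rect_eq_zero_of_differentiableOn
    (fun w => cauchyInt H w ^ (q : ℂ)) ((τ : ℂ) + (-R : ℝ) * Complex.I) ((R : ℂ) + R * Complex.I)
    ((differentiableOn_cauchyInt_rpow h0 hi hne).mono ?_)
  swap
  · intro w hw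
    rw [Complex.mem_reProdIm] at hw
    have := hw.1
    simp only [Complex.add_re, Complex.ofReal_re, Complex.mul_re, Complex.I_re, Complex.ofReal_im,
      Complex.I_im, mul_zero, zero_mul, sub_zero, add_zero] at this
    rw [Set.uIcc_of_le hR.le] at this
    exact hτ.trans_le this.1
  simp only [Complex.add_re, Complex.ofReal_re, Complex.mul_re, Complex.I_re, Complex.ofReal_im,
      Complex.I_im, mul_zero, zero_mul, sub_zero, add_zero, Complex.add_im, Complex.mul_im,
      mul_one, zero_add] at hrect
  have hhor : ∀ (s : ℝ), |s| = R → ∀ x ∈ Set.uIoc τ R,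
      ‖cauchyInt H (x + s * Complex.I) ^ (q : ℂ)‖ ≤ (M / R) ^ q := by
    intro s hs x hx
    rw [Set.uIoc_of_le hR.le] at hx
    apply norm_cauchyInt_rpow_le hq0
    have hx0 : 0 < x := hτ.trans hx.1
    have := norm_cauchyInt_mul_im_le H (w := x + s * Complex.I) hiC hi' (by simpa using hx0)
    simp only [Complex.add_re, Complex.ofReal_re, Complex.mul_re, Complex.I_re, Complex.ofReal_im,
      Complex.I_im, mul_zero, zero_mul, sub_zero, add_zero, Complex.add_im, Complex.mul_im,
      mul_one, zero_add, hs] at this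
    rw [le_div_iff₀ hR0]
    refine this.trans ?_
    rw [hM]
    gcongr
    exact hx.1.le
  have hver : ∀ y ∈ Set.uIoc (-R) R,
      ‖cauchyInt H (R + y * Complex.I) ^ (q : ℂ)‖ ≤ (M / R) ^ q := by
    intro y _
    apply norm_cauchyInt_rpow_le hq0
    have := norm_cauchyInt_le H (w := R + y * Complex.I) hiC (by simpa using hR0)
    simp only [Complex.add_re, Complex.ofReal_re, Complex.mul_re, Complex.I_re, Complex.ofReal_im,
      Complex.I_im, mul_zero, zero_mul, sub_zero, add_zero] at this
    refine this.trans ?_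
    gcongr
    rw [hM]
    have : 0 ≤ M2 / τ := by positivity
    linarith
  have b1 := intervalIntegral.norm_integral_le_of_norm_le_const (hhor (-R) (by simp [hR0.le]))
  have b2 := intervalIntegral.norm_integral_le_of_norm_le_const (hhor R (by simp [hR0.le]))
  have b3 := intervalIntegral.norm_integral_le_of_norm_le_const hver
  set I1 := ∫ x in τ..R, cauchyInt H (x + (-R : ℝ) * Complex.I) ^ (q : ℂ)
  set I2 := ∫ x in τ..R, cauchyInt H (x + R * Complex.I) ^ (q : ℂ)
  set I3 := ∫ y in (-R)..R, cauchyInt H (R + y * Complex.I) ^ (q : ℂ)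
  set I4 := ∫ y in (-R)..R, cauchyInt H (τ + y * Complex.I) ^ (q : ℂ)
  have e : Complex.I • I4 = I1 - I2 + Complex.I • I3 := by
    linear_combination (-1 : ℂ) * hrect
  have hn : ‖I4‖ = ‖Complex.I • I4‖ := by rw [norm_smul, Complex.norm_I, one_mul]
  have hn3 : ‖Complex.I • I3‖ = ‖I3‖ := by rw [norm_smul, Complex.norm_I, one_mul]
  have hval : M ^ q * R ^ (1 - q) = (M / R) ^ q * R := by
    rw [Real.div_rpow hMn hR0.le, Real.rpow_sub hR0, Real.rpow_one]
    field_simp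
  rw [hn, e, hval]
  have hA : 0 ≤ (M / R) ^ q := by positivity
  have a1 : |R - τ| ≤ R := by rw [abs_of_pos] <;> linarith
  have a2 : |R - -R| = 2 * R := by rw [abs_of_pos] <;> linarith
  rw [a2] at b3
  have t1 := norm_add_le (I1 - I2) (Complex.I • I3)
  have t2 := norm_sub_le I1 I2
  nlinarith [mul_le_mul_of_nonneg_left a1 hA]

theorem tendsto_intervalIntegral_cauchyInt_rpow {q : ℝ} (hq : 1 < q) {h : ℝ → ℝ}
    (h0 : ∀ z, 0 ≤ h z)
    (hi : Integrable h) (hi' : Integrable fun z : ℝ => (z : ℂ) * (h z : ℂ))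
    (hne : ¬ h =ᵐ[volume] 0) {τ : ℝ} (hτ : 0 < τ) :
    Filter.Tendsto
      (fun R : ℝ => ‖∫ y in (-R)..R, cauchyInt (fun z => (h z : ℂ)) (τ + y * Complex.I) ^ (q : ℂ)‖)
      Filter.atTop (nhds 0) := by
  obtain ⟨M, hM⟩ := norm_intervalIntegral_cauchyInt_rpow_le hq h0 hi hi' hne hτ
  refine squeeze_zero' (Filter.Eventually.of_forall fun _ => norm_nonneg _)
    ((Filter.eventually_gt_atTop τ).mono hM) ?_
  have : Filter.Tendsto (fun R : ℝ => R ^ (1 - q)) Filter.atTop (nhds 0) := by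
    have := tendsto_rpow_neg_atTop (y := q - 1) (by linarith)
    simpa using this
  simpa using (this.const_mul (M ^ q)).const_mul 4

theorem continuous_cauchyInt_vertical {h : ℝ → ℂ} (hi : Integrable h) {τ : ℝ} (hτ : 0 < τ) :
    Continuous fun y : ℝ => cauchyInt h (τ + y * Complex.I) := by
  refine (differentiableOn_cauchyInt hi).continuousOn.comp_continuous (by fun_prop) fun y => ?_
  simpa using hτ

theorem lintegral_cauchyInt_le_re {q : ℝ} (hq : 1 < q) (hq2 : q ≤ 2) :
    ∃ a : ℝ, ∀ (h : ℝ → ℝ) (_ : ∀ z, 0 ≤ h z)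
    (_ : Integrable h) (_ : Integrable fun z : ℝ => (z : ℂ) * (h z : ℂ)) (τ : ℝ) (_ : 0 < τ),
    ∫⁻ y : ℝ, ‖cauchyInt (fun z => (h z : ℂ)) (τ + y * Complex.I)‖ₑ ^ q ≤
      ENNReal.ofReal a *
        ∫⁻ y : ℝ, ENNReal.ofReal (cauchyInt (fun z => (h z : ℂ)) (τ + y * Complex.I)).re ^ q := by
  obtain ⟨a, b, ha, hb, hab⟩ := exists_norm_rpow_le_re hq hq2
  refine ⟨a, fun h h0 hi hi' τ hτ => ?_⟩
  have hq0 : 0 < q := by linarith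
  by_cases hne : h =ᵐ[volume] 0
  · have : ∀ w, cauchyInt (fun z => (h z : ℂ)) w = 0 := by
      intro w
      rw [cauchyInt]
      apply integral_eq_zero_of_ae
      filter_upwards [hne] with z hz
      simp [hz]
    simp [this, hq0]
  set F : ℝ → ℂ := fun y => cauchyInt (fun z => (h z : ℂ)) (τ + y * Complex.I) with hF
  have hFc : Continuous F := continuous_cauchyInt_vertical hi.ofReal hτ
  have hFre : ∀ y, 0 < (F y).re := fun y => cauchyInt_re_pos h0 hi hne (by simpa using hτ)
  have hFq : Continuous fun y => F y ^ (q : ℂ) :=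
    hFc.cpow continuous_const fun y => Or.inl (hFre y)
  have hlim := tendsto_intervalIntegral_cauchyInt_rpow hq h0 hi hi' hne hτ
  have hmeas : Measurable fun y => ‖F y‖ₑ ^ q := (hFc.measurable.enorm).pow_const _
  have hcov := (aecover_Icc (μ := (volume : Measure ℝ)) Filter.tendsto_neg_atTop_atBot
    (Filter.tendsto_id (α := ℝ))).lintegral_tendsto_of_countably_generated hmeas.aemeasurable
  have hlim2 := (((ENNReal.continuous_ofReal.tendsto _).comp (hlim.const_mul b)).const_add
    (ENNReal.ofReal a * ∫⁻ y : ℝ, ENNReal.ofReal (F y).re ^ q))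
  rw [mul_zero, ENNReal.ofReal_zero, add_zero] at hlim2
  refine le_of_tendsto_of_tendsto hcov hlim2 ?_
  filter_upwards [Filter.eventually_gt_atTop 0] with R hR
  have c1 : Continuous fun y => ‖F y‖ ^ q := hFc.norm.rpow_const fun _ => Or.inr hq0.le
  have c2 : Continuous fun y => (F y).re ^ q :=
    (Complex.continuous_re.comp hFc).rpow_const fun _ => Or.inr hq0.le
  have e1 : ∫⁻ y in Set.Icc (-R) R, ‖F y‖ₑ ^ q =
      ENNReal.ofReal (∫ y in Set.Icc (-R) R, ‖F y‖ ^ q) := by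
    rw [ofReal_integral_eq_lintegral_ofReal (c1.integrableOn_Icc)
      (Filter.Eventually.of_forall fun y => by positivity)]
    congr 1 with y
    rw [← ofReal_norm_eq_enorm, ENNReal.ofReal_rpow_of_nonneg (norm_nonneg _) hq0.le]
  have e2 : ENNReal.ofReal (∫ y in Set.Icc (-R) R, (F y).re ^ q) ≤
      ∫⁻ y : ℝ, ENNReal.ofReal (F y).re ^ q := by
    rw [ofReal_integral_eq_lintegral_ofReal (c2.integrableOn_Icc)
      (Filter.Eventually.of_forall fun y => by
        have := (hFre y).le
        show 0 ≤ (F y).re ^ q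
        positivity)]
    refine (setLIntegral_le_lintegral _ _).trans (lintegral_mono fun y => ?_)
    rw [ENNReal.ofReal_rpow_of_nonneg (hFre y).le hq0.le]
  have key : ∫ y in Set.Icc (-R) R, ‖F y‖ ^ q ≤
      a * (∫ y in Set.Icc (-R) R, (F y).re ^ q) + b * ‖∫ y in (-R)..R, F y ^ (q : ℂ)‖ := by
    calc ∫ y in Set.Icc (-R) R, ‖F y‖ ^ q
        ≤ ∫ y in Set.Icc (-R) R, (a * (F y).re ^ q - b * (F y ^ (q : ℂ)).re) :=
          integral_mono c1.integrableOn_Icc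
            ((continuous_const.mul c2).sub (continuous_const.mul
              (Complex.continuous_re.comp hFq))).integrableOn_Icc
            fun y => hab _ (hFre y).le
      _ = a * (∫ y in Set.Icc (-R) R, (F y).re ^ q) -
          b * (∫ y in Set.Icc (-R) R, (F y ^ (q : ℂ)).re) := by
          rw [integral_sub, integral_const_mul, integral_const_mul]
          · exact (continuous_const.mul c2).integrableOn_Icc
          · exact (continuous_const.mul (Complex.continuous_re.comp hFq)).integrableOn_Icc
      _ ≤ _ := by
          have : (∫ y in Set.Icc (-R) R, (F y ^ (q : ℂ)).re) =
              (∫ y in (-R)..R, F y ^ (q : ℂ)).re := by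
            rw [intervalIntegral.integral_of_le (by linarith), ← integral_Icc_eq_integral_Ioc]
            exact integral_re (𝕜 := ℂ) hFq.integrableOn_Icc
          rw [this]
          have := Complex.abs_re_le_norm (∫ y in (-R)..R, F y ^ (q : ℂ))
          have := (abs_le.1 this).1
          nlinarith
  show ∫⁻ y in Set.Icc (-R) R, ‖F y‖ₑ ^ q ≤ _
  rw [e1]
  refine (ENNReal.ofReal_le_ofReal key).trans (ENNReal.ofReal_add_le.trans ?_)
  rw [ENNReal.ofReal_mul ha]
  exact add_le_add (mul_le_mul_right e2 _) le_rfl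

theorem lintegral_enorm_poisson (τ : ℝ) (hτ : 0 < τ) :
    ∫⁻ z : ℝ, ‖τ / (τ ^ 2 + z ^ 2)‖ₑ = ENNReal.ofReal π := by
  have e : ∀ z : ℝ, τ / (τ ^ 2 + z ^ 2) = τ⁻¹ * (1 + (τ⁻¹ * z) ^ 2)⁻¹ := by
    intro z
    have : τ ^ 2 + z ^ 2 ≠ 0 := by positivity
    have : 1 + (τ⁻¹ * z) ^ 2 ≠ 0 := by positivity
    field_simp
  have hInt : Integrable fun z : ℝ => τ / (τ ^ 2 + z ^ 2) := by
    simp_rw [e]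
    exact (integrable_inv_one_add_sq.comp_mul_left' (inv_ne_zero hτ.ne')).const_mul _
  have hi : ∫ z : ℝ, τ / (τ ^ 2 + z ^ 2) = π := by
    simp_rw [e]
    rw [integral_const_mul, Measure.integral_comp_mul_left (fun z : ℝ => (1 + z ^ 2)⁻¹),
      integral_univ_inv_one_add_sq, inv_inv, abs_of_pos hτ, smul_eq_mul]
    field_simp
  rw [← hi, ofReal_integral_eq_lintegral_ofReal hInt]
  · refine lintegral_congr fun z => ?_
    rw [← ofReal_norm, Real.norm_of_nonneg (by positivity)]
  · exact Filter.Eventually.of_forall fun z => by positivity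

theorem lintegral_cauchyInt_re_le {q : ℝ} (hq : 1 < q) {h : ℝ → ℝ} (hm : Measurable h)
    (hi : Integrable h) {τ : ℝ} (hτ : 0 < τ) :
    ∫⁻ y : ℝ, ENNReal.ofReal (cauchyInt (fun z => (h z : ℂ)) (τ + y * Complex.I)).re ^ q ≤
      ENNReal.ofReal π ^ q * ∫⁻ z, ‖h z‖ₑ ^ q := by
  rw [← lintegral_neg_eq_self]
  have hG : Measurable fun z : ℝ => ‖τ / (τ ^ 2 + z ^ 2)‖ₑ := by fun_prop
  have := lintegral_rpow_conv_le (μ := volume) hq hG hm.enorm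
    (by rw [lintegral_enorm_poisson τ hτ]; simp)
  rw [lintegral_enorm_poisson τ hτ] at this
  refine le_trans (lintegral_mono fun x => ?_) this
  gcongr
  have hInt := integrable_div_add_I_mul (h := fun z => (h z : ℂ)) (w := τ + (-x : ℝ) * Complex.I)
    hi.ofReal (by simpa using hτ)
  rw [cauchyInt, ← Complex.reCLM_apply, ← ContinuousLinearMap.integral_comp_comm _ hInt]
  refine (Real.ofReal_le_enorm _).trans ((enorm_integral_le_lintegral_enorm _).trans_eq ?_)
  refine lintegral_congr fun z => ?_
  rw [← enorm_mul]
  congr 1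
  rw [Complex.reCLM_apply, Complex.div_re]
  simp [Complex.normSq_apply]
  rw [show τ * τ + (-x + z) * (-x + z) = τ ^ 2 + (x - z) ^ 2 by ring]
  ring

theorem cauchyInt_add {f g : ℝ → ℂ} (hf : Integrable f) (hg : Integrable g) {w : ℂ}
    (hw : 0 < w.re) : cauchyInt (fun z => f z + g z) w = cauchyInt f w + cauchyInt g w := by
  simp only [cauchyInt, add_div]
  exact integral_add (integrable_div_add_I_mul hf hw) (integrable_div_add_I_mul hg hw)

theorem cauchyInt_const_mul (c : ℂ) (f : ℝ → ℂ) (w : ℂ) :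
    cauchyInt (fun z => c * f z) w = c * cauchyInt f w := by
  simp only [cauchyInt, mul_div_assoc]
  exact integral_const_mul _ _

theorem lintegral_cauchyInt_add_le {q : ℝ} (hq : 1 < q) {f g : ℝ → ℂ} (hf : Integrable f)
    (hg : Integrable g) {τ : ℝ} (hτ : 0 < τ) {M : ℝ≥0∞} (c : ℂ) (hc : ‖c‖ₑ = 1)
    (h1 : ∫⁻ y : ℝ, ‖cauchyInt f (τ + y * Complex.I)‖ₑ ^ q ≤ M)
    (h2 : ∫⁻ y : ℝ, ‖cauchyInt g (τ + y * Complex.I)‖ₑ ^ q ≤ M) :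
    ∫⁻ y : ℝ, ‖cauchyInt (fun z => f z + c * g z) (τ + y * Complex.I)‖ₑ ^ q ≤
      2 ^ (q - 1) * (M + M) := by
  have hmf : Measurable fun y : ℝ => ‖cauchyInt f (τ + y * Complex.I)‖ₑ ^ q :=
    ((continuous_cauchyInt_vertical hf hτ).measurable.enorm).pow_const _
  calc _ ≤ ∫⁻ y : ℝ, 2 ^ (q - 1) * (‖cauchyInt f (τ + y * Complex.I)‖ₑ ^ q +
        ‖cauchyInt g (τ + y * Complex.I)‖ₑ ^ q) := by
        refine lintegral_mono fun y => ?_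
        rw [cauchyInt_add hf (hg.const_mul c) (by simpa using hτ), cauchyInt_const_mul]
        refine (ENNReal.rpow_le_rpow (enorm_add_le _ _) (by linarith)).trans ?_
        rw [enorm_mul, hc, one_mul]
        exact ENNReal.rpow_add_le_mul_rpow_add_rpow _ _ hq.le
    _ ≤ _ := by
        rw [lintegral_const_mul' _ _ (by simp), lintegral_add_left hmf]
        gcongr

theorem exists_lintegral_cauchyInt_le_of_le_two {q : ℝ} (hq : 1 < q) (hq2 : q ≤ 2) :
    ∃ C : ℝ≥0∞, C ≠ ∞ ∧ ∀ h : ℝ → ℂ, Measurable h → Integrable h →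
      Integrable (fun z : ℝ => (z : ℂ) * h z) → ∀ τ : ℝ, 0 < τ →
      ∫⁻ y : ℝ, ‖cauchyInt h (τ + y * Complex.I)‖ₑ ^ q ≤ C * ∫⁻ z, ‖h z‖ₑ ^ q := by
  obtain ⟨a, ha⟩ := lintegral_cauchyInt_le_re hq hq2
  have hq0 : 0 < q := by linarith
  set C₀ : ℝ≥0∞ := ENNReal.ofReal a * ENNReal.ofReal π ^ q with hC₀
  have hC₀t : C₀ ≠ ∞ := ENNReal.mul_ne_top (by simp) (ENNReal.rpow_ne_top_of_nonneg hq0.le (by simp))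
  refine ⟨2 ^ (q - 1) * (2 ^ (q - 1) * (C₀ + C₀) + 2 ^ (q - 1) * (C₀ + C₀)), ?_, ?_⟩
  · have : (2 : ℝ≥0∞) ^ (q - 1) ≠ ∞ := ENNReal.rpow_ne_top_of_nonneg (by linarith) (by simp)
    finiteness
  intro h hm hi hi' τ hτ
  have nonneg : ∀ g : ℝ → ℝ, Measurable g → (∀ z, 0 ≤ g z) → (∀ z, g z ≤ ‖h z‖) →
      Integrable (fun z => (g z : ℂ)) ∧
      ∫⁻ y : ℝ, ‖cauchyInt (fun z => (g z : ℂ)) (τ + y * Complex.I)‖ₑ ^ q ≤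
        C₀ * ∫⁻ z, ‖h z‖ₑ ^ q := by
    intro g hg hg0 hgh
    have hgi : Integrable g := hi.norm.mono' hg.aestronglyMeasurable
      (Filter.Eventually.of_forall fun z => by rw [Real.norm_of_nonneg (hg0 z)]; exact hgh z)
    have hgi' : Integrable fun z : ℝ => (z : ℂ) * (g z : ℂ) := by
      refine hi'.norm.mono' ?_ (Filter.Eventually.of_forall fun z => ?_)
      · exact (by fun_prop : Measurable fun z : ℝ => (z : ℂ) * (g z : ℂ)).aestronglyMeasurable
      · rw [norm_mul, norm_mul]
        gcongr
        rw [Complex.norm_real, Real.norm_of_nonneg (hg0 z)]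
        exact hgh z
    refine ⟨hgi.ofReal, (ha g hg0 hgi hgi' τ hτ).trans ?_⟩
    rw [hC₀, mul_assoc]
    gcongr
    refine (lintegral_cauchyInt_re_le hq hg hgi hτ).trans ?_
    gcongr with z
    rw [enorm_le_iff_norm_le, Real.norm_of_nonneg (hg0 z)]
    exact hgh z
  have real : ∀ g : ℝ → ℝ, Measurable g → (∀ z, |g z| ≤ ‖h z‖) →
      Integrable (fun z => (g z : ℂ)) ∧
      ∫⁻ y : ℝ, ‖cauchyInt (fun z => (g z : ℂ)) (τ + y * Complex.I)‖ₑ ^ q ≤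
        2 ^ (q - 1) * (C₀ + C₀) * ∫⁻ z, ‖h z‖ₑ ^ q := by
    intro g hg hgh
    obtain ⟨i1, b1⟩ := nonneg (fun z => max (g z) 0) (hg.max measurable_const)
      (fun z => le_max_right _ _) fun z => max_le ((le_abs_self _).trans (hgh z)) (norm_nonneg _)
    obtain ⟨i2, b2⟩ := nonneg (fun z => max (-g z) 0) (hg.neg.max measurable_const)
      (fun z => le_max_right _ _) fun z => max_le ((neg_le_abs _).trans (hgh z)) (norm_nonneg _)
    have e : (fun z => (g z : ℂ)) =
        fun z => ((max (g z) 0 : ℝ) : ℂ) + (-1) * ((max (-g z) 0 : ℝ) : ℂ) := by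
      ext z
      rcases le_total (g z) 0 with h | h
      · rw [max_eq_right h, max_eq_left (by linarith)]; simp
      · rw [max_eq_left h, max_eq_right (by linarith)]; simp
    rw [e]
    refine ⟨i1.add (i2.const_mul _), ?_⟩
    have := lintegral_cauchyInt_add_le hq i1 i2 hτ (-1) (by simp) b1 b2
    rwa [← add_mul, ← mul_assoc] at this
  obtain ⟨i1, b1⟩ := real (fun z => (h z).re) (by fun_prop) fun z => Complex.abs_re_le_norm _
  obtain ⟨i2, b2⟩ := real (fun z => (h z).im) (by fun_prop) fun z => Complex.abs_im_le_norm _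
  have e : h = fun z => ((h z).re : ℂ) + Complex.I * ((h z).im : ℂ) := by
    ext z
    rw [mul_comm, Complex.re_add_im]
  have := lintegral_cauchyInt_add_le hq i1 i2 hτ Complex.I
    (by rw [← ofReal_norm]; simp) b1 b2
  rw [← add_mul, ← mul_assoc, ← e] at this
  exact this

theorem integral_mul_cauchyInt_comm {f g : ℝ → ℂ} (hf : Integrable f) (hg : Integrable g)
    {τ : ℝ} (hτ : 0 < τ) :
    ∫ y : ℝ, cauchyInt f (τ + y * Complex.I) * g y =
      ∫ z : ℝ, f z * cauchyInt g (τ + z * Complex.I) := by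
  simp only [cauchyInt, ← integral_mul_const, ← integral_const_mul]
  rw [integral_integral_swap]
  · refine integral_congr_ae (Filter.Eventually.of_forall fun z => ?_)
    simp only
    congr 1 with y
    rw [show (τ : ℂ) + y * Complex.I + Complex.I * z = τ + z * Complex.I + Complex.I * y by ring]
    ring
  · have h1 : Integrable fun p : ℝ × ℝ => g p.1 * f p.2 := hg.mul_prod hf
    have := h1.mul_bdd (c := τ⁻¹) (g := fun p : ℝ × ℝ =>
      ((τ : ℂ) + p.1 * Complex.I + Complex.I * p.2)⁻¹)
      (by fun_prop : Measurable _).aestronglyMeasurable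
      (Filter.Eventually.of_forall fun p => by
        rw [norm_inv]
        gcongr
        simpa using re_le_norm_add_I_mul ((τ : ℂ) + p.1 * Complex.I) p.2)
    refine this.congr (Filter.Eventually.of_forall fun p => ?_)
    simp only [Function.uncurry]
    ring

theorem exists_lintegral_cauchyInt_le {q : ℝ} (hq : 1 < q) :
    ∃ C : ℝ≥0∞, C ≠ ∞ ∧ ∀ h : ℝ → ℂ, Measurable h → Integrable h →
      Integrable (fun z : ℝ => (z : ℂ) * h z) → ∀ τ : ℝ, 0 < τ →
      ∫⁻ y : ℝ, ‖cauchyInt h (τ + y * Complex.I)‖ₑ ^ q ≤ C * ∫⁻ z, ‖h z‖ₑ ^ q := by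
  rcases le_or_gt q 2 with hq2 | hq2
  · exact exists_lintegral_cauchyInt_le_of_le_two hq hq2
  have hq0 : 0 < q := by linarith
  have hqp : q.HolderConjugate (q / (q - 1)) := Real.HolderConjugate.conjExponent hq
  set p : ℝ := q / (q - 1) with hp
  have hp1 : 1 < p := hqp.symm.lt
  have hp2 : p ≤ 2 := by
    rw [hp, div_le_iff₀ (by linarith)]; linarith
  have hp0 : 0 < p := by linarith
  obtain ⟨C, hC, H⟩ := exists_lintegral_cauchyInt_le_of_le_two hp1 hp2
  refine ⟨C ^ (q / p), ENNReal.rpow_ne_top_of_nonneg (by positivity) hC, ?_⟩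
  intro h hm hi hi' τ hτ
  set U : ℝ → ℂ := fun y => cauchyInt h (τ + y * Complex.I) with hU
  have hUc : Continuous U := continuous_cauchyInt_vertical hi hτ
  have key : ∀ R : ℝ, ∫⁻ y in Set.Icc (-R) R, ‖U y‖ₑ ^ q ≤ C ^ (q / p) * ∫⁻ z, ‖h z‖ₑ ^ q := by
    intro R
    set J := ∫⁻ y in Set.Icc (-R) R, ‖U y‖ₑ ^ q with hJ
    set g₀ : ℝ → ℂ := fun y => ((‖U y‖ ^ (q - 2) : ℝ) : ℂ) * (starRingEnd ℂ) (U y) with hg₀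
    have hg₀c : Continuous g₀ := by
      refine (Complex.continuous_ofReal.comp (hUc.norm.rpow_const fun y => Or.inr ?_)).mul ?_
      · linarith
      · exact Complex.continuous_conj.comp hUc
    set g : ℝ → ℂ := (Set.Icc (-R) R).indicator g₀ with hg
    have hgm : Measurable g := hg₀c.measurable.indicator measurableSet_Icc
    have hgi : Integrable g :=
      (hg₀c.integrableOn_Icc).integrable_indicator measurableSet_Icc
    have hgi' : Integrable fun z : ℝ => (z : ℂ) * g z := by
      have : (fun z : ℝ => (z : ℂ) * g z) =
          (Set.Icc (-R) R).indicator fun z : ℝ => (z : ℂ) * g₀ z := by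
        ext z
        by_cases hz : z ∈ Set.Icc (-R) R <;> simp [hg, hz]
      rw [this]
      exact ((Complex.continuous_ofReal.mul hg₀c).integrableOn_Icc).integrable_indicator
        measurableSet_Icc
    have hgn : ∀ y, ‖g₀ y‖ₑ = ‖U y‖ₑ ^ (q - 1) := by
      intro y
      rw [← ofReal_norm, ← ofReal_norm, ENNReal.ofReal_rpow_of_nonneg (norm_nonneg _) (by linarith),
        hg₀, norm_mul, RCLike.norm_conj, Complex.norm_real, Real.norm_of_nonneg (by positivity)]
      congr 1
      rw [← Real.rpow_add_one' (norm_nonneg _) (by linarith)]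
      ring_nf
    have hgJ : ∫⁻ y, ‖g y‖ₑ ^ p = J := by
      rw [hJ, ← lintegral_indicator measurableSet_Icc]
      refine lintegral_congr fun y => ?_
      by_cases hy : y ∈ Set.Icc (-R) R
      · simp only [hg, Set.indicator_of_mem hy, hgn]
        rw [← ENNReal.rpow_mul]
        congr 1
        rw [hp, mul_div_cancel₀ _ (by linarith)]
      · simp [hg, hy, hp0]
    have hJt : J ≠ ∞ := by
      have : IntegrableOn (fun y => ‖U y‖ ^ q) (Set.Icc (-R) R) :=
        (hUc.norm.rpow_const fun y => Or.inr hq0.le).integrableOn_Icc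
      have h2 := this.2.ne
      rw [hJ]
      convert h2 using 3 with y
      rw [← ofReal_norm, ENNReal.ofReal_rpow_of_nonneg (norm_nonneg _) hq0.le,
        ← ofReal_norm, Real.norm_of_nonneg (by positivity)]
    have hJle : J ≤ ‖∫ y, U y * g y‖ₑ := by
      have e : ∫ y, U y * g y = ((∫ y in Set.Icc (-R) R, ‖U y‖ ^ q : ℝ) : ℂ) := by
        rw [← integral_complex_ofReal, ← integral_indicator measurableSet_Icc]
        congr 1 with y
        by_cases hy : y ∈ Set.Icc (-R) R
        · simp only [hg, Set.indicator_of_mem hy, hg₀]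
          rw [mul_left_comm, Complex.mul_conj, Complex.normSq_eq_norm_sq, ← Complex.ofReal_mul,
            ← Real.rpow_natCast, ← Real.rpow_add_of_nonneg (norm_nonneg _) (by linarith)
              (by norm_num)]
          norm_num
        · simp [hg, hy]
      rw [e, ← ofReal_norm, Complex.norm_real, Real.norm_of_nonneg (by positivity),
        ofReal_integral_eq_lintegral_ofReal
          (hUc.norm.rpow_const fun y => Or.inr hq0.le).integrableOn_Icc
          (Filter.Eventually.of_forall fun y => by positivity)]
      refine lintegral_mono fun y => ?_
      simp only
      rw [← ofReal_norm, ENNReal.ofReal_rpow_of_nonneg (norm_nonneg _) hq0.le]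
    have hV : Continuous fun z : ℝ => cauchyInt g (τ + z * Complex.I) :=
      continuous_cauchyInt_vertical hgi hτ
    have main : J ≤ (∫⁻ z, ‖h z‖ₑ ^ q) ^ (1 / q) * (C * J) ^ (1 / p) := by
      calc J ≤ ‖∫ y, U y * g y‖ₑ := hJle
        _ = ‖∫ z : ℝ, h z * cauchyInt g (τ + z * Complex.I)‖ₑ := by
            rw [hU, integral_mul_cauchyInt_comm hi hgi hτ]
        _ ≤ ∫⁻ z : ℝ, ‖h z‖ₑ * ‖cauchyInt g (τ + z * Complex.I)‖ₑ := by
            refine (enorm_integral_le_lintegral_enorm _).trans_eq ?_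
            simp_rw [enorm_mul]
        _ ≤ (∫⁻ z, ‖h z‖ₑ ^ q) ^ (1 / q) *
            (∫⁻ z : ℝ, ‖cauchyInt g (τ + z * Complex.I)‖ₑ ^ p) ^ (1 / p) :=
            ENNReal.lintegral_mul_le_Lp_mul_Lq _ hqp hm.enorm.aemeasurable
              hV.measurable.enorm.aemeasurable
        _ ≤ _ := by
            gcongr
            rw [← hgJ]
            exact H g hgm hgi hgi' τ hτ
    rcases eq_or_ne J 0 with hJ0 | hJ0
    · rw [hJ0]; exact zero_le
    have h2 : J ^ (1 / q) ≤ (∫⁻ z, ‖h z‖ₑ ^ q) ^ (1 / q) * C ^ (1 / p) := by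
      have e : J ^ (1 / q) = J * J ^ (-(1 / p)) := by
        nth_rewrite 2 [← ENNReal.rpow_one J]
        rw [← ENNReal.rpow_add _ _ hJ0 hJt]
        congr 1
        have := hqp.inv_add_inv_eq_one
        rw [one_div, one_div]; linarith
      rw [e]
      calc _ ≤ (∫⁻ z, ‖h z‖ₑ ^ q) ^ (1 / q) * (C * J) ^ (1 / p) * J ^ (-(1 / p)) := by gcongr
        _ = _ := by
          rw [ENNReal.mul_rpow_of_nonneg _ _ (by positivity), mul_assoc, mul_assoc,
            ← ENNReal.rpow_add _ _ hJ0 hJt]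
          simp
    have h3 := ENNReal.rpow_le_rpow h2 hq0.le
    rw [ENNReal.mul_rpow_of_nonneg _ _ hq0.le, ← ENNReal.rpow_mul, ← ENNReal.rpow_mul,
      ← ENNReal.rpow_mul, one_div_mul_cancel hq0.ne', ENNReal.rpow_one, ENNReal.rpow_one,
      one_div_mul_eq_div] at h3
    rwa [mul_comm]
  refine le_of_tendsto' ((aecover_Icc (μ := volume) (Filter.tendsto_neg_atTop_atBot)
    (Filter.tendsto_id)).lintegral_tendsto_of_countably_generated
      (hUc.measurable.enorm.pow_const q).aemeasurable) fun R => key R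

theorem sector_mul_norm_add_le {σ : ℝ} (hσ : σ ∈ Set.Ioo 0 (π / 2)) {lam : ℂ}
    (harg : |lam.arg| < π - σ) {x : ℝ} (hx : 0 ≤ x) :
    √((1 - cos σ) / 2) * (‖lam‖ + x) ≤ ‖lam + x‖ := by
  have h1 : -cos σ ≤ cos lam.arg := by
    rw [← cos_pi_sub, ← cos_abs lam.arg]
    exact cos_le_cos_of_nonneg_of_le_pi (abs_nonneg _) (by linarith [hσ.1]) harg.le
  have hre : lam.re = ‖lam‖ * cos lam.arg := (Complex.norm_mul_cos_arg lam).symm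
  have h2 : ‖lam + x‖ ^ 2 = ‖lam‖ ^ 2 + x ^ 2 + 2 * x * lam.re := by
    rw [← Complex.normSq_eq_norm_sq, ← Complex.normSq_eq_norm_sq, Complex.normSq_apply,
      Complex.normSq_apply]
    simp
    ring
  have hc : cos σ ≤ 1 := cos_le_one σ
  have hc' : -1 ≤ cos σ := neg_one_le_cos σ
  refine le_of_sq_le_sq ?_ (norm_nonneg _)
  rw [mul_pow, Real.sq_sqrt (by linarith), h2, hre]
  have h3 : 0 ≤ x * ‖lam‖ * (cos lam.arg + cos σ) :=
    mul_nonneg (mul_nonneg hx (norm_nonneg _)) (by linarith)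
  nlinarith [mul_nonneg (by linarith : 0 ≤ (1 + cos σ) / 2) (sq_nonneg (‖lam‖ - x))]

theorem cpow_half_sq (z : ℂ) : (z ^ ((1 : ℂ) / 2)) ^ 2 = z := by
  rw [one_div]
  exact Complex.cpow_nat_inv_pow z two_ne_zero

theorem cpow_half_re_nonneg (z : ℂ) : 0 ≤ (z ^ ((1 : ℂ) / 2)).re := by
  rw [one_div, Complex.cpow_inv_two_re]
  positivity

theorem norm_cpow_half_sq (z : ℂ) : ‖z ^ ((1 : ℂ) / 2)‖ ^ 2 = ‖z‖ := by
  rw [← norm_pow, cpow_half_sq]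

theorem mem_slitPlane_and_le_re_cpow_half {z : ℂ} {ε : ℝ} (hε : 0 < ε)
    (h : ∀ u : ℝ, 0 ≤ u → ε ≤ ‖z + u‖) :
    z ∈ Complex.slitPlane ∧
      ε ≤ 3 * (z ^ ((1 : ℂ) / 2)).re * ‖z ^ ((1 : ℂ) / 2)‖ := by
  constructor
  · by_contra hz
    rw [Complex.mem_slitPlane_iff, not_or, not_lt, not_not] at hz
    have h1 := h (-z.re) (by linarith [hz.1])
    have h2 : z + (-z.re : ℝ) = 0 := by
      apply Complex.ext <;> simp [hz.2]
    rw [h2, norm_zero] at h1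
    linarith
  · set a := z ^ ((1 : ℂ) / 2) with ha
    have h1 := h (a.im ^ 2) (sq_nonneg _)
    have h2 : z + (a.im ^ 2 : ℝ) = a.re * (a.re + 2 * a.im * Complex.I) := by
      rw [← cpow_half_sq z, ← ha]
      apply Complex.ext
      · simp [sq]
      · simp [sq]; ring
    have h0 : 0 ≤ a.re := cpow_half_re_nonneg z
    have h3 : ‖(a.re : ℂ) + 2 * a.im * Complex.I‖ ≤ 3 * ‖a‖ := by
      refine (norm_add_le _ _).trans ?_
      simp only [Complex.norm_real, norm_mul, Complex.norm_I, mul_one, Complex.norm_ofNat,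
        Real.norm_eq_abs]
      linarith [Complex.abs_re_le_norm a, Complex.abs_im_le_norm a]
    calc ε ≤ _ := h1
      _ = a.re * ‖(a.re : ℂ) + 2 * a.im * Complex.I‖ := by
        rw [h2, norm_mul, Complex.norm_real, Real.norm_of_nonneg h0]
      _ ≤ a.re * (3 * ‖a‖) := by gcongr
      _ = _ := by ring

theorem exists_cpow_half_bounds {σ : ℝ} (hσ : σ ∈ Set.Ioo 0 (π / 2)) {ρ : ℝ} (hρ : 0 < ρ) :
    ∃ δ c₀ C₀ : ℝ, 0 < δ ∧ δ ≤ 1 ∧ 0 < c₀ ∧ 0 < C₀ ∧ ∀ lam : ℂ, lam ≠ 0 → |lam.arg| < π - σ →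
      ∀ s : ℝ, 0 < s → s ^ 2 = ‖lam‖ → ∀ r : ℝ, 0 ≤ r → ∀ w : ℂ, ‖w‖ ≤ 3 * δ * (s + r) ^ 2 →
      (ρ * lam + (r : ℂ) ^ 2 + w) ∈ Complex.slitPlane ∧
      c₀ * (s + r) ≤ ((ρ * lam + (r : ℂ) ^ 2 + w) ^ ((1 : ℂ) / 2)).re ∧
      ‖(ρ * lam + (r : ℂ) ^ 2 + w) ^ ((1 : ℂ) / 2)‖ ≤ C₀ * (s + r) := by
  set κ := √((1 - cos σ) / 2) with hκ
  have hcos : cos σ < 1 := by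
    rw [← cos_zero]
    exact cos_lt_cos_of_nonneg_of_le_pi_div_two le_rfl hσ.2.le hσ.1
  have hκ0 : 0 < κ := Real.sqrt_pos.2 (by linarith)
  have hκ1 : κ ≤ 1 := by
    rw [hκ, Real.sqrt_le_iff]
    constructor <;> linarith [neg_one_le_cos σ]
  set ε := κ * min ρ 1 / 2 with hε
  have hm0 : 0 < min ρ 1 := lt_min hρ one_pos
  have hε0 : 0 < ε := by positivity
  have hε1 : ε ≤ 1 := by
    have : κ * min ρ 1 ≤ 1 * 1 := mul_le_mul hκ1 (min_le_right _ _) hm0.le zero_le_one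
    rw [hε]; linarith
  set M := max ρ 1 with hM
  have hM0 : 0 < M := lt_max_of_lt_right one_pos
  refine ⟨ε / 6, ε / (6 * (M + 1)), M + 1, by positivity, by linarith, by positivity,
    by positivity, ?_⟩
  intro lam hlam harg s hs hsl r hr w hw
  set S := s + r with hS
  have hS0 : 0 < S := by positivity
  have hS2 : S ^ 2 ≤ 2 * (s ^ 2 + r ^ 2) := by rw [hS]; nlinarith [sq_nonneg (s - r)]
  have hS2' : s ^ 2 + r ^ 2 ≤ S ^ 2 := by rw [hS]; nlinarith [mul_nonneg hs.le hr]
  have hw' : ‖w‖ ≤ ε / 2 * S ^ 2 := hw.trans (by linarith)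
  set z := ρ * lam + (r : ℂ) ^ 2 + w with hz
  have hlow : ∀ u : ℝ, 0 ≤ u → ε / 2 * S ^ 2 ≤ ‖z + u‖ := by
    intro u hu
    have h1 := sector_mul_norm_add_le (lam := ρ * lam) hσ (by rwa [Complex.arg_real_mul _ hρ])
      (add_nonneg (sq_nonneg r) hu)
    rw [norm_mul, Complex.norm_real, Real.norm_of_nonneg hρ.le, ← hsl, ← hκ] at h1
    have h2 : κ * (min ρ 1 * (s ^ 2 + r ^ 2)) ≤ κ * (ρ * s ^ 2 + (r ^ 2 + u)) := by
      gcongr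
      have a1 := mul_le_mul_of_nonneg_right (min_le_left ρ 1) (sq_nonneg s)
      have a2 := mul_le_mul_of_nonneg_right (min_le_right ρ 1) (sq_nonneg r)
      linarith
    have h3 : ε * S ^ 2 ≤ κ * (min ρ 1 * (s ^ 2 + r ^ 2)) := by
      have := mul_le_mul_of_nonneg_left hS2 hε0.le
      rw [hε] at this ⊢
      linarith
    have h4 : ρ * lam + ((r ^ 2 + u : ℝ) : ℂ) = z + u - w := by
      rw [hz]; push_cast; ring
    rw [h4] at h1
    have h5 := norm_sub_le (z + u) w
    linarith
  obtain ⟨h1, h2⟩ := mem_slitPlane_and_le_re_cpow_half (by positivity) hlow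
  set a := z ^ ((1 : ℂ) / 2) with ha
  have hzn : ‖z‖ ≤ (M + 1) * S ^ 2 := by
    have b1 : ‖z‖ ≤ ρ * s ^ 2 + r ^ 2 + ‖w‖ := by
      refine (norm_add_le _ _).trans ?_
      gcongr
      refine (norm_add_le _ _).trans ?_
      rw [norm_mul, norm_pow, Complex.norm_real, Complex.norm_real, Real.norm_of_nonneg hρ.le,
        Real.norm_of_nonneg hr, hsl]
    have a1 := mul_le_mul_of_nonneg_right (le_max_left ρ 1) (sq_nonneg s)
    have a2 := mul_le_mul_of_nonneg_right (le_max_right ρ 1) (sq_nonneg r)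
    have a3 := mul_le_mul_of_nonneg_left hS2' hM0.le
    have a4 := mul_le_mul_of_nonneg_right hε1 (sq_nonneg S)
    have a5 := sq_nonneg S
    rw [← hM] at a1 a2
    linarith
  have han : ‖a‖ ≤ (M + 1) * S := by
    refine le_of_sq_le_sq ?_ (by positivity)
    rw [norm_cpow_half_sq, mul_pow]
    refine hzn.trans ?_
    have : M + 1 ≤ (M + 1) ^ 2 := by nlinarith
    gcongr
  refine ⟨h1, ?_, han⟩
  have h0 : 0 ≤ a.re := cpow_half_re_nonneg z
  have h6 : ε / 2 * S ^ 2 ≤ 3 * a.re * ((M + 1) * S) :=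
    h2.trans (by gcongr)
  have h7 : ε / 2 * S ≤ 3 * a.re * (M + 1) := by
    have : (ε / 2 * S) * S ≤ (3 * a.re * (M + 1)) * S := by linarith
    exact le_of_mul_le_mul_right this hS0
  rw [div_mul_eq_mul_div, div_le_iff₀ (by positivity)]
  linarith

theorem iteratedDeriv_comp_ofReal {H : ℂ → ℂ} {U : Set ℂ} (hU : IsOpen U)
    (hH : DifferentiableOn ℂ H U) (n : ℕ) (x : ℝ) (hx : (x : ℂ) ∈ U) :
    iteratedDeriv n (fun y : ℝ => H y) x = iteratedDeriv n H x := by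
  induction n generalizing x with
  | zero => simp
  | succ n ih =>
    rw [iteratedDeriv_succ, iteratedDeriv_succ]
    have hev : ∀ᶠ y : ℝ in nhds x, (y : ℂ) ∈ U :=
      Complex.continuous_ofReal.continuousAt.eventually (hU.mem_nhds hx)
    have e : (iteratedDeriv n fun y : ℝ => H y) =ᶠ[nhds x] fun y : ℝ => iteratedDeriv n H y :=
      hev.mono fun y hy => ih y hy
    rw [e.deriv_eq]
    have hd : DifferentiableAt ℂ (iteratedDeriv n H) x := by
      rw [iteratedDeriv_eq_iterate]
      exact ((hH.analyticOnNhd hU).iterated_deriv n x hx).differentiableAt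
    exact hd.hasDerivAt.comp_ofReal.deriv

theorem hasDerivAt_iteratedFDeriv_line {E F : Type*} [NormedAddCommGroup E] [NormedSpace ℝ E]
    [NormedAddCommGroup F] [NormedSpace ℝ F] {g : E → F} {ξ v : E} {x : ℝ}
    (hg : ContDiffAt ℝ (⊤ : ℕ∞) g (ξ + x • v)) (n : ℕ) :
    HasDerivAt (fun y : ℝ => iteratedFDeriv ℝ n g (ξ + y • v) fun _ => v)
      (iteratedFDeriv ℝ (n + 1) g (ξ + x • v) fun _ => v) x := by
  have hd : DifferentiableAt ℝ (iteratedFDeriv ℝ n g) (ξ + x • v) :=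
    hg.differentiableAt_iteratedFDeriv (by exact_mod_cast WithTop.coe_lt_top _)
  have hl : HasDerivAt (fun y : ℝ => ξ + y • v) v x := by
    simpa using ((hasDerivAt_id x).smul_const v).const_add ξ
  have h1 := (hd.hasFDerivAt.comp_hasDerivAt x hl)
  have h2 := ((ContinuousMultilinearMap.apply ℝ (fun _ : Fin n => E) F (fun _ => v)).hasFDerivAt
    ).comp_hasDerivAt x h1
  exact h2

theorem iteratedDeriv_line {E F : Type*} [NormedAddCommGroup E] [NormedSpace ℝ E]
    [NormedAddCommGroup F] [NormedSpace ℝ F] {g : E → F} {ξ v : E} {Ω : Set E} (hΩ : IsOpen Ω)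
    (hg : ContDiffOn ℝ (⊤ : ℕ∞) g Ω) (n : ℕ) (x : ℝ) (hx : ξ + x • v ∈ Ω) :
    iteratedDeriv n (fun y : ℝ => g (ξ + y • v)) x =
      iteratedFDeriv ℝ n g (ξ + x • v) fun _ => v := by
  induction n generalizing x with
  | zero => simp
  | succ n ih =>
    rw [iteratedDeriv_succ]
    have hev : ∀ᶠ y : ℝ in nhds x, ξ + y • v ∈ Ω :=
      (by fun_prop : Continuous fun y : ℝ => ξ + y • v).continuousAt.eventually (hΩ.mem_nhds hx)
    have e : (iteratedDeriv n fun y : ℝ => g (ξ + y • v)) =ᶠ[nhds x]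
        fun y : ℝ => iteratedFDeriv ℝ n g (ξ + y • v) fun _ => v := hev.mono fun y hy => ih y hy
    rw [e.deriv_eq]
    exact (hasDerivAt_iteratedFDeriv_line (hg.contDiffAt (hΩ.mem_nhds hx)) n).deriv

theorem norm_iteratedFDeriv_mul_line_le {E : Type*} [NormedAddCommGroup E] [NormedSpace ℝ E]
    {k g : E → ℂ} {ξ v : E} {Ω : Set E} (hΩ : IsOpen Ω) (hξ : ξ ∈ Ω)
    (hk : ContDiffOn ℝ (⊤ : ℕ∞) k Ω) (hg : ContDiffOn ℝ (⊤ : ℕ∞) g Ω) {n : ℕ} {a b S : ℝ}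
    (hka : ∀ m ≤ n, ‖iteratedFDeriv ℝ m k ξ fun _ => v‖ ≤ a * (S ^ m)⁻¹)
    (hgb : ∀ m ≤ n, ‖iteratedFDeriv ℝ m g ξ fun _ => v‖ ≤ b * (S ^ m)⁻¹) :
    ‖iteratedFDeriv ℝ n (fun η => k η * g η) ξ fun _ => v‖ ≤ 2 ^ n * a * b * (S ^ n)⁻¹ := by
  have line : ∀ {f : E → ℂ}, ContDiffOn ℝ (⊤ : ℕ∞) f Ω → ∀ m,
      iteratedFDeriv ℝ m f ξ (fun _ => v) = iteratedDeriv m (fun y : ℝ => f (ξ + y • v)) 0 := by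
    intro f hf m
    rw [iteratedDeriv_line hΩ hf m 0 (by simpa)]
    simp
  have hcl : ∀ {f : E → ℂ}, ContDiffOn ℝ (⊤ : ℕ∞) f Ω →
      ContDiffAt ℝ n (fun y : ℝ => f (ξ + y • v)) 0 := by
    intro f hf
    have h1 : ContDiffAt ℝ (⊤ : ℕ∞) f (ξ + (0 : ℝ) • v) :=
      hf.contDiffAt (hΩ.mem_nhds (by simpa))
    have h2 : ContDiffAt ℝ (⊤ : ℕ∞) (fun y : ℝ => ξ + y • v) 0 := by fun_prop
    exact (h1.comp (0 : ℝ) h2).of_le (by exact_mod_cast le_top)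
  rw [line (hk.mul hg), iteratedDeriv_fun_mul (hcl hk) (hcl hg)]
  refine (norm_sum_le _ _).trans ?_
  calc _ ≤ ∑ i ∈ Finset.range (n + 1), (n.choose i : ℝ) * (a * b * (S ^ n)⁻¹) := by
        refine Finset.sum_le_sum fun i hi => ?_
        have hi' : i ≤ n := by simpa [Nat.lt_succ_iff] using hi
        rw [norm_mul, norm_mul, ← line hk, ← line hg]
        have e : S ^ n = S ^ i * S ^ (n - i) := by rw [← pow_add]; congr 1; omega
        have h1 := hka i hi'
        have h2 := hgb (n - i) (by omega)
        have h3 : ‖((n.choose i : ℕ) : ℂ)‖ = n.choose i := by simp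
        rw [h3, mul_assoc]
        refine mul_le_mul_of_nonneg_left ?_ (Nat.cast_nonneg _)
        calc _ ≤ (a * (S ^ i)⁻¹) * (b * (S ^ (n - i))⁻¹) :=
              mul_le_mul h1 h2 (norm_nonneg _) ((norm_nonneg _).trans h1)
          _ = _ := by rw [e, mul_inv]; ring
    _ = _ := by
        rw [← Finset.sum_mul, ← Nat.cast_sum, Nat.sum_range_choose]
        push_cast; ring

section Symbol

variable {E : Type*} [NormedAddCommGroup E]

/-- The symbol `√(ρ λ + ‖ξ‖²)`. -/
noncomputable def sqrtSymbol (ρ : ℝ) (lam : ℂ) (ξ : E) : ℂ :=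
  ((ρ : ℂ) * lam + (‖ξ‖ : ℂ) ^ 2) ^ ((1 : ℂ) / 2)

/-- The first order symbols `A`, `s` and `i ⟨ξ, e⟩`. -/
def IsFirstOrder [InnerProductSpace ℝ E] (s : ℝ) (A B : E → ℂ) : Prop :=
  B = A ∨ B = (fun _ => (s : ℂ)) ∨ ∃ e : E, ‖e‖ ≤ 1 ∧ B = fun ξ => Complex.I * (⟪ξ, e⟫ : ℂ)

variable [InnerProductSpace ℝ E]

theorem norm_add_smul_sq_complex (ξ v : E) (hv : ‖v‖ = 1) (x : ℝ) :
    ((‖ξ + x • v‖ : ℝ) : ℂ) ^ 2 = (‖ξ‖ : ℂ) ^ 2 + (2 * x * (⟪ξ, v⟫ : ℂ) + (x : ℂ) ^ 2) := by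
  have : ‖ξ + x • v‖ ^ 2 = ‖ξ‖ ^ 2 + (2 * x * ⟪ξ, v⟫ + x ^ 2) := by
    rw [norm_add_sq_real, inner_smul_right, norm_smul, hv, mul_one, Real.norm_eq_abs, sq_abs]
    ring
  exact_mod_cast this

theorem exists_symbol_bounds {σ : ℝ} (hσ : σ ∈ Set.Ioo 0 (π / 2)) {ρ : ℝ} (hρ : 0 < ρ)
    {c : ℝ} (hc : 0 < c) (N : ℕ) :
    ∃ c₀ C : ℝ, 0 < c₀ ∧ 0 < C ∧ ∀ lam : ℂ, lam ≠ 0 → |lam.arg| < π - σ →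
      ∀ s : ℝ, 0 < s → s ^ 2 = ‖lam‖ →
      ContDiff ℝ (⊤ : ℕ∞) (sqrtSymbol ρ lam : E → ℂ) ∧
      (∀ ξ : E, c₀ * (s + ‖ξ‖) ≤ (sqrtSymbol ρ lam ξ).re) ∧
      (∀ ξ : E, ‖sqrtSymbol ρ lam ξ‖ ≤ C * (s + ‖ξ‖)) ∧
      ∀ k : E → ℂ, ContDiffOn ℝ (⊤ : ℕ∞) k {0}ᶜ →
      (∀ ξ : E, ξ ≠ 0 → ∀ n ≤ N, ‖iteratedFDeriv ℝ n k ξ‖ ≤ c * ((s + ‖ξ‖) ^ n)⁻¹) →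
      ∀ B : E → ℂ, IsFirstOrder s (sqrtSymbol ρ lam) B → ∀ τ : ℝ, 0 < τ →
      ContDiffOn ℝ (⊤ : ℕ∞) (fun ξ => k ξ * (sqrtSymbol ρ lam ξ * B ξ *
        Complex.exp (-sqrtSymbol ρ lam ξ * τ))) {0}ᶜ ∧
      ∀ ξ : E, ξ ≠ 0 → ∀ v : E, ‖v‖ = 1 → ∀ n ≤ N,
        ‖iteratedFDeriv ℝ n (fun ξ => k ξ * (sqrtSymbol ρ lam ξ * B ξ *
          Complex.exp (-sqrtSymbol ρ lam ξ * τ))) ξ fun _ => v‖ ≤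
          C * ((s + ‖ξ‖) ^ 2 * rexp (-(c₀ * τ * (s + ‖ξ‖)))) * ((s + ‖ξ‖) ^ n)⁻¹ := by
  obtain ⟨δ, c₀, C₀, hδ, hδ1, hc₀, hC₀, H⟩ := exists_cpow_half_bounds hσ hρ
  set M := max C₀ 2 with hM
  have hM0 : 0 < M := lt_max_of_lt_left hC₀
  set D : ℝ := N.factorial * (M ^ 2) * (2 / δ) ^ N with hD
  have hD0 : 0 < D := by positivity
  refine ⟨c₀, max C₀ (2 ^ N * c * D), hc₀, lt_max_of_lt_left hC₀, ?_⟩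
  intro lam hlam harg s hs hsl
  have H' := H lam hlam harg s hs hsl
  set A : E → ℂ := sqrtSymbol ρ lam with hA
  have hAd : ContDiff ℝ (⊤ : ℕ∞) A := by
    rw [contDiff_iff_contDiffAt]
    intro ξ
    have h1 := (H' ‖ξ‖ (norm_nonneg _) 0 (by simp; positivity)).1
    rw [add_zero] at h1
    have h2 : ContDiffAt ℂ (⊤ : ℕ∞) (fun z : ℂ => z ^ ((1 : ℂ) / 2))
        (ρ * lam + (‖ξ‖ : ℂ) ^ 2) := (analyticAt_id.cpow analyticAt_const h1).contDiffAt
    have h3 : ContDiff ℝ (⊤ : ℕ∞) (fun η : E => (ρ * lam + (‖η‖ : ℂ) ^ 2)) := by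
      refine contDiff_const.add ?_
      have : (fun η : E => (‖η‖ : ℂ) ^ 2) = fun η => ((‖η‖ ^ 2 : ℝ) : ℂ) := by
        ext η; push_cast; rfl
      rw [this]
      exact Complex.ofRealCLM.contDiff.comp (contDiff_norm_sq ℝ)
    exact (h2.restrict_scalars ℝ).comp ξ h3.contDiffAt
  have hAb : ∀ ξ : E, c₀ * (s + ‖ξ‖) ≤ (A ξ).re ∧ ‖A ξ‖ ≤ C₀ * (s + ‖ξ‖) := by
    intro ξ
    have h1 := (H' ‖ξ‖ (norm_nonneg _) 0 (by simp; positivity)).2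
    rwa [add_zero] at h1
  refine ⟨hAd, fun ξ => (hAb ξ).1, fun ξ => (hAb ξ).2.trans ?_, ?_⟩
  · gcongr
    exact le_max_left _ _
  intro k hk hkb B hB τ hτ
  have hBd : ContDiff ℝ (⊤ : ℕ∞) B := by
    rcases hB with rfl | rfl | ⟨e, -, rfl⟩
    · exact hAd
    · exact contDiff_const
    · refine contDiff_const.mul (Complex.ofRealCLM.contDiff.comp ?_)
      exact contDiff_id.inner ℝ contDiff_const
  set Q : E → ℂ := fun ξ => A ξ * B ξ * Complex.exp (-A ξ * τ) with hQ
  have hQd : ContDiff ℝ (⊤ : ℕ∞) Q := (hAd.mul hBd).mul ((hAd.neg.mul contDiff_const).cexp)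
  refine ⟨hk.mul hQd.contDiffOn, ?_⟩
  have hQb : ∀ ξ : E, ∀ v : E, ‖v‖ = 1 → ∀ n ≤ N, ‖iteratedFDeriv ℝ n Q ξ fun _ => v‖ ≤
      D * ((s + ‖ξ‖) ^ 2 * rexp (-(c₀ * τ * (s + ‖ξ‖)))) * ((s + ‖ξ‖) ^ n)⁻¹ := by
    intro ξ v hv n hn
    set S := s + ‖ξ‖ with hS
    have hS0 : 0 < S := by positivity
    set U := Metric.ball (0 : ℂ) (δ * S) with hU
    have hwb : ∀ ζ ∈ U, ‖2 * ζ * (⟪ξ, v⟫ : ℂ) + ζ ^ 2‖ ≤ 3 * δ * (s + ‖ξ‖) ^ 2 := by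
      intro ζ hζ
      have hζ' : ‖ζ‖ ≤ δ * S := by simpa [hU] using (Metric.mem_ball.1 hζ).le
      have h1 : |⟪ξ, v⟫| ≤ S := by
        have := abs_real_inner_le_norm ξ v
        rw [hv, mul_one] at this
        linarith
      calc _ ≤ ‖2 * ζ * (⟪ξ, v⟫ : ℂ)‖ + ‖ζ ^ 2‖ := norm_add_le _ _
        _ = 2 * ‖ζ‖ * |⟪ξ, v⟫| + ‖ζ‖ ^ 2 := by simp
        _ ≤ 2 * (δ * S) * S + (δ * S) ^ 2 := by gcongr
        _ ≤ _ := by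
          have : δ * δ ≤ δ * 1 := by gcongr
          rw [← hS]
          nlinarith [sq_nonneg S]
    set a : ℂ → ℂ := fun ζ => (ρ * lam + (‖ξ‖ : ℂ) ^ 2 + (2 * ζ * (⟪ξ, v⟫ : ℂ) + ζ ^ 2)) ^
      ((1 : ℂ) / 2) with ha
    have haA : ∀ x : ℝ, a x = A (ξ + x • v) := by
      intro x
      simp only [ha, hA, sqrtSymbol]
      rw [norm_add_smul_sq_complex ξ v hv, add_assoc]
    have had : DifferentiableOn ℂ a U := by
      intro ζ hζ
      refine DifferentiableWithinAt.cpow_const (by fun_prop) ?_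
      exact (H' ‖ξ‖ (norm_nonneg _) _ (hwb ζ hζ)).1
    have hab : ∀ ζ ∈ U, c₀ * S ≤ (a ζ).re ∧ ‖a ζ‖ ≤ M * S := by
      intro ζ hζ
      have := (H' ‖ξ‖ (norm_nonneg _) _ (hwb ζ hζ)).2
      refine ⟨this.1, this.2.trans ?_⟩
      gcongr
      exact le_max_left _ _
    obtain ⟨b, hbB, hbd, hbb⟩ : ∃ b : ℂ → ℂ, (∀ x : ℝ, b x = B (ξ + x • v)) ∧
        DifferentiableOn ℂ b U ∧ ∀ ζ ∈ U, ‖b ζ‖ ≤ M * S := by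
      have hM2 : 2 ≤ M := le_max_right _ _
      rcases hB with rfl | rfl | ⟨e, he, rfl⟩
      · exact ⟨a, haA, had, fun ζ hζ => (hab ζ hζ).2⟩
      · refine ⟨fun _ => s, fun _ => rfl, by fun_prop, fun ζ _ => ?_⟩
        rw [Complex.norm_real, Real.norm_of_nonneg hs.le]
        nlinarith [norm_nonneg ξ]
      · refine ⟨fun ζ => Complex.I * ((⟪ξ, e⟫ : ℂ) + ζ * (⟪v, e⟫ : ℂ)), fun x => ?_, by fun_prop,
          fun ζ hζ => ?_⟩
        · simp only
          rw [inner_add_left, inner_smul_left]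
          push_cast
          simp
        · have hζ' : ‖ζ‖ ≤ δ * S := by simpa [hU] using (Metric.mem_ball.1 hζ).le
          rw [norm_mul, Complex.norm_I, one_mul]
          have h1 : |⟪ξ, e⟫| ≤ S := by
            have := abs_real_inner_le_norm ξ e
            nlinarith [norm_nonneg ξ, norm_nonneg e]
          have h2 : |⟪v, e⟫| ≤ 1 := by
            have := abs_real_inner_le_norm v e
            rw [hv, one_mul] at this
            linarith
          calc _ ≤ |⟪ξ, e⟫| + ‖ζ‖ * |⟪v, e⟫| := by
                refine (norm_add_le _ _).trans ?_
                simp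
            _ ≤ S + (δ * S) * 1 := by gcongr
            _ ≤ S + (1 * S) * 1 := by gcongr
            _ = 2 * S := by ring
            _ ≤ M * S := by gcongr
    set F : ℂ → ℂ := fun ζ => a ζ * b ζ * Complex.exp (-a ζ * τ) with hF
    have hFd : DifferentiableOn ℂ F U :=
      (had.mul hbd).mul ((had.neg.mul (differentiableOn_const _)).cexp)
    have hFb : ∀ ζ ∈ U, ‖F ζ‖ ≤ (M * S) * (M * S) * rexp (-(c₀ * τ * S)) := by
      intro ζ hζ
      rw [hF, norm_mul, norm_mul, Complex.norm_exp]
      have h1 := hab ζ hζ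
      have h2 := hbb ζ hζ
      gcongr
      · exact h1.2
      · simp only [neg_mul, Complex.neg_re, Complex.mul_re, Complex.ofReal_re, Complex.ofReal_im,
          mul_zero, sub_zero, neg_le_neg_iff]
        nlinarith [h1.1]
    have hsub : Metric.closedBall (0 : ℂ) (δ * S / 2) ⊆ U := by
      apply Metric.closedBall_subset_ball
      have : 0 < δ * S := by positivity
      linarith
    have e1 : iteratedFDeriv ℝ n Q ξ (fun _ => v) = iteratedDeriv n F 0 := by
      have h1 := iteratedDeriv_line isOpen_univ (contDiffOn_univ.2 hQd) (ξ := ξ) (v := v) n 0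
        (Set.mem_univ _)
      have h2 := iteratedDeriv_comp_ofReal Metric.isOpen_ball hFd n 0
        (by simp; positivity)
      rw [zero_smul, add_zero] at h1
      rw [← h1]
      rw [Complex.ofReal_zero] at h2
      rw [← h2]
      congr 1
      ext x
      simp only [hF, hQ, haA, hbB]
    rw [e1]
    have hcl : DiffContOnCl ℂ F (Metric.ball 0 (δ * S / 2)) :=
      DifferentiableOn.diffContOnCl (by
        rw [closure_ball _ (by positivity)]
        exact hFd.mono hsub)
    refine (Complex.norm_iteratedDeriv_le_of_forall_mem_sphere_norm_le n (by positivity) hcl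
      (fun z hz => hFb z (hsub (Metric.sphere_subset_closedBall hz)))).trans ?_
    have hf : (n.factorial : ℝ) ≤ N.factorial := by
      exact_mod_cast Nat.factorial_le hn
    have hp : (2 / δ) ^ n ≤ (2 / δ) ^ N := by
      apply pow_le_pow_right₀ _ hn
      rw [le_div_iff₀ hδ]; linarith
    calc _ = n.factorial * M ^ 2 * (2 / δ) ^ n * (S ^ 2 * rexp (-(c₀ * τ * S))) * (S ^ n)⁻¹ := by
          rw [div_pow, div_pow, mul_pow]
          field_simp
      _ ≤ N.factorial * M ^ 2 * (2 / δ) ^ N * (S ^ 2 * rexp (-(c₀ * τ * S))) * (S ^ n)⁻¹ := by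
          gcongr
  intro ξ hξ v hv n hn
  refine (norm_iteratedFDeriv_mul_line_le (a := c) (n := n) (S := s + ‖ξ‖)
    (b := D * ((s + ‖ξ‖) ^ 2 * rexp (-(c₀ * τ * (s + ‖ξ‖))))) isOpen_compl_singleton hξ hk
    hQd.contDiffOn
    (fun m hm => ?_) (fun m hm => hQb ξ v hv m (hm.trans hn))).trans ?_
  · refine (ContinuousMultilinearMap.le_opNorm _ _).trans ?_
    simpa [hv] using hkb ξ hξ m (hm.trans hn)
  · gcongr ?_ * _
    rw [← mul_assoc]
    gcongr ?_ * _
    refine le_trans ?_ (le_max_right _ _)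
    gcongr
    norm_num

end Symbol

section Oscillatory

variable {E : Type*} [NormedAddCommGroup E] [InnerProductSpace ℝ E] [FiniteDimensional ℝ E]
  [MeasurableSpace E] [BorelSpace E]

/-- The (unnormalised) inverse Fourier integral. -/
noncomputable def fourierInt (φ : E → ℂ) (x : E) : ℂ :=
  ∫ ξ : E, Complex.exp (Complex.I * (⟪x, ξ⟫ : ℂ)) * φ ξ

theorem norm_exp_I_mul (r : ℝ) : ‖Complex.exp (Complex.I * r)‖ = 1 := by
  rw [mul_comm]; exact Complex.norm_exp_ofReal_mul_I r

theorem continuous_exp_I_inner (x : E) :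
    Continuous fun ξ : E => Complex.exp (Complex.I * (⟪x, ξ⟫ : ℂ)) := by fun_prop

theorem integrable_exp_I_inner_mul {φ : E → ℂ} (h : Integrable φ) (x : E) :
    Integrable fun ξ : E => Complex.exp (Complex.I * (⟪x, ξ⟫ : ℂ)) * φ ξ :=
  h.bdd_mul (c := 1) (continuous_exp_I_inner x).aestronglyMeasurable
    (Filter.Eventually.of_forall fun ξ => (norm_exp_I_mul _).le)

theorem norm_fourierInt_le {φ : E → ℂ} (x : E) : ‖fourierInt φ x‖ ≤ ∫ ξ, ‖φ ξ‖ := by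
  refine (norm_integral_le_integral_norm _).trans_eq ?_
  simp_rw [norm_mul, norm_exp_I_mul, one_mul]

theorem fourierInt_comp_add {φ : E → ℂ} (x w : E) :
    fourierInt (fun ξ => φ (ξ + w)) x = Complex.exp (-(Complex.I * (⟪x, w⟫ : ℂ))) *
      fourierInt φ x := by
  rw [fourierInt, fourierInt, ← integral_const_mul,
    ← integral_add_right_eq_self (μ := volume) (fun ξ : E => Complex.exp (-(Complex.I * (⟪x, w⟫ : ℂ))) *
      (Complex.exp (Complex.I * (⟪x, ξ⟫ : ℂ)) * φ ξ)) w]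
  refine integral_congr_ae (Filter.Eventually.of_forall fun ξ => ?_)
  simp only
  rw [← mul_assoc, ← Complex.exp_add, inner_add_right]
  push_cast
  congr 2
  ring

theorem fourierInt_deriv_line {ψ ψ' : E → ℂ} (hψ : Integrable ψ) (hψ' : Integrable ψ')
    (hm : Measurable ψ') {v : E}
    (hd : ∀ᵐ ξ : E, (∀ x : ℝ, HasDerivAt (fun y : ℝ => ψ (ξ + y • v)) (ψ' (ξ + x • v)) x) ∧
      Continuous fun y : ℝ => ψ' (ξ + y • v)) (x : E) :
    fourierInt ψ' x = -(Complex.I * (⟪x, v⟫ : ℂ)) * fourierInt ψ x := by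
  set α : ℝ := ⟪x, v⟫ with hα
  have key : ∀ h : ℝ, 0 < h → (Complex.exp (-(Complex.I * (h * α : ℝ))) - 1) * fourierInt ψ x =
      (∫ y in Set.Ioc 0 h, Complex.exp (-(Complex.I * (y * α : ℝ)))) * fourierInt ψ' x := by
    intro h hh
    have e1 : (Complex.exp (-(Complex.I * (h * α : ℝ))) - 1) * fourierInt ψ x =
        ∫ ξ : E, Complex.exp (Complex.I * (⟪x, ξ⟫ : ℂ)) * (ψ (ξ + h • v) - ψ ξ) := by
      have h1 := fourierInt_comp_add (φ := ψ) x (h • v)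
      rw [inner_smul_right, ← hα] at h1
      rw [sub_mul, ← h1, one_mul, fourierInt, fourierInt, ← integral_sub]
      · simp_rw [mul_sub]
      · exact integrable_exp_I_inner_mul (hψ.comp_add_right (h • v)) x
      · exact integrable_exp_I_inner_mul hψ x
    have e2 : ∫ ξ : E, Complex.exp (Complex.I * (⟪x, ξ⟫ : ℂ)) * (ψ (ξ + h • v) - ψ ξ) =
        ∫ ξ : E, ∫ y in Set.Ioc 0 h, Complex.exp (Complex.I * (⟪x, ξ⟫ : ℂ)) * ψ' (ξ + y • v) := by
      refine integral_congr_ae (hd.mono fun ξ hξ => ?_)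
      simp only
      rw [integral_const_mul, ← intervalIntegral.integral_of_le hh.le,
        intervalIntegral.integral_eq_sub_of_hasDerivAt (fun y _ => hξ.1 y)
          (hξ.2.intervalIntegrable _ _)]
      simp
    rw [e1, e2, integral_integral_swap]
    · rw [← integral_mul_const]
      refine integral_congr_ae (Filter.Eventually.of_forall fun y => ?_)
      have h1 := fourierInt_comp_add (φ := ψ') x (y • v)
      rw [inner_smul_right, ← hα] at h1
      exact h1
    · have hmeas : AEStronglyMeasurable (Function.uncurry fun (ξ : E) (y : ℝ) =>
          Complex.exp (Complex.I * (⟪x, ξ⟫ : ℂ)) * ψ' (ξ + y • v))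
          (volume.prod (volume.restrict (Set.Ioc 0 h))) := by
        apply Measurable.aestronglyMeasurable
        refine Measurable.mul ?_ (hm.comp ?_)
        · exact ((continuous_exp_I_inner x).measurable).comp measurable_fst
        · exact (by fun_prop : Continuous fun p : E × ℝ => p.1 + p.2 • v).measurable
      rw [integrable_prod_iff' hmeas]
      constructor
      · exact Filter.Eventually.of_forall fun y =>
          integrable_exp_I_inner_mul (hψ'.comp_add_right (y • v)) x
      · have : ∀ y : ℝ, ∫ ξ : E, ‖Function.uncurry (fun (ξ : E) (y : ℝ) =>
          Complex.exp (Complex.I * (⟪x, ξ⟫ : ℂ)) * ψ' (ξ + y • v)) (ξ, y)‖ = ∫ ξ, ‖ψ' ξ‖ := by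
          intro y
          simp only [Function.uncurry, norm_mul, norm_exp_I_mul, one_mul]
          exact integral_add_right_eq_self (fun ξ => ‖ψ' ξ‖) (y • v)
        simp_rw [this]
        exact integrable_const _
  rcases eq_or_ne α 0 with h0 | h0
  · have := key 1 one_pos
    simp [h0] at this
    simp [h0, ← this]
  · have hh : 0 < π / |α| := div_pos pi_pos (abs_pos.2 h0)
    have h1 := key _ hh
    have hprim : ∫ y in Set.Ioc 0 (π / |α|), Complex.exp (-(Complex.I * (y * α : ℝ))) =
        (Complex.exp (-(Complex.I * (π / |α| * α : ℝ))) - 1) / (-(Complex.I * α)) := by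
      have h2 : (-(Complex.I * α)) ≠ 0 := by simp [h0]
      rw [← intervalIntegral.integral_of_le hh.le]
      have h3 := integral_exp_mul_complex (a := 0) (b := π / |α|) h2
      rw [Complex.ofReal_zero, mul_zero, Complex.exp_zero] at h3
      calc _ = ∫ y : ℝ in (0 : ℝ)..(π / |α|), Complex.exp (-(Complex.I * α) * y) := by
            congr 1 with y
            push_cast
            ring_nf
        _ = _ := by
          rw [h3]
          push_cast
          congr 3
          ring
    have h4 : Complex.exp (-(Complex.I * (π / |α| * α : ℝ))) - 1 ≠ 0 := by
      have : Complex.exp (-(Complex.I * (π / |α| * α : ℝ))) = -1 := by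
        rcases lt_or_gt_of_ne h0 with h | h
        · rw [abs_of_neg h, show π / -α * α = -π by field_simp]
          rw [← Complex.exp_pi_mul_I]
          push_cast
          congr 1
          ring
        · rw [abs_of_pos h, show π / α * α = π by field_simp, Complex.exp_neg, mul_comm,
            Complex.exp_pi_mul_I]
          norm_num
      rw [this]
      norm_num
    rw [hprim] at h1
    have h2 : (-(Complex.I * (α : ℂ))) ≠ 0 := by simp [h0]
    generalize Complex.exp (-(Complex.I * (π / |α| * α : ℝ))) - 1 = X at h1 h4
    rw [div_mul_eq_mul_div, eq_div_iff h2] at h1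
    exact mul_left_cancel₀ h4 (by rw [← h1]; ring)

end Oscillatory

section Radial

variable {E : Type*} [NormedAddCommGroup E] [InnerProductSpace ℝ E] [FiniteDimensional ℝ E]
  [MeasurableSpace E] [BorelSpace E]

theorem integrable_inv_norm_pow_mul_exp [Nontrivial E] {m : ℕ} (hm : m < Module.finrank ℝ E)
    {a : ℝ} (ha : 0 < a) :
    Integrable fun ξ : E => (‖ξ‖ ^ m)⁻¹ * rexp (-(a * ‖ξ‖)) := by
  rw [integrable_fun_norm_addHaar (μ := (volume : Measure E))
    (f := fun r : ℝ => (r ^ m)⁻¹ * rexp (-(a * r)))]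
  have h := integrableOn_rpow_mul_exp_neg_mul_rpow (p := 1)
    (s := ((Module.finrank ℝ E - 1 - m : ℕ) : ℝ)) (b := a)
    (lt_of_lt_of_le (by norm_num) (Nat.cast_nonneg _)) one_pos ha
  refine h.congr_fun (fun r hr => ?_) measurableSet_Ioi
  have hr' : (0 : ℝ) < r := hr
  simp only [rpow_natCast, rpow_one, smul_eq_mul, neg_mul]
  rw [← mul_assoc]
  congr 1
  rw [eq_mul_inv_iff_mul_eq₀ (by positivity), ← pow_add]
  congr 1
  omega

theorem integral_inv_norm_pow_mul_exp (m : ℕ) (a : ℝ) {τ : ℝ} (hτ : 0 < τ) :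
    ∫ ξ : E, (‖ξ‖ ^ m)⁻¹ * rexp (-(a * τ * ‖ξ‖)) =
      τ ^ m * (τ ^ Module.finrank ℝ E)⁻¹ * ∫ ξ : E, (‖ξ‖ ^ m)⁻¹ * rexp (-(a * ‖ξ‖)) := by
  have h := Measure.integral_comp_smul (volume : Measure E)
    (fun ξ : E => (‖ξ‖ ^ m)⁻¹ * rexp (-(a * ‖ξ‖))) τ
  rw [abs_of_pos (by positivity), smul_eq_mul] at h
  rw [mul_assoc, ← h, ← integral_const_mul]
  congr 1 with ξ
  rw [norm_smul, Real.norm_of_nonneg hτ.le, mul_pow, mul_inv, ← mul_assoc, ← mul_assoc,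
    mul_inv_cancel₀ (by positivity), one_mul]
  congr 3
  ring

theorem integrable_inv_norm_pow_mul_exp' [Nontrivial E] {m : ℕ} (hm : m < Module.finrank ℝ E)
    {a τ : ℝ} (ha : 0 < a) (hτ : 0 < τ) :
    Integrable fun ξ : E => (‖ξ‖ ^ m)⁻¹ * rexp (-(a * τ * ‖ξ‖)) :=
  integrable_inv_norm_pow_mul_exp hm (mul_pos ha hτ)

theorem exists_lintegral_enorm_le_of_decay :
    ∃ C : ℝ, 0 < C ∧ ∀ (G : E → ℂ) (τ A : ℝ), 0 < τ → 0 ≤ A →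
      (∀ x, ‖G x‖ ≤ A * (τ ^ (Module.finrank ℝ E + 2))⁻¹) →
      (∀ x, ‖x‖ ^ (Module.finrank ℝ E + 1) * ‖G x‖ ≤ A * τ⁻¹) →
      ∫⁻ x, ‖G x‖ₑ ≤ ENNReal.ofReal (C * A * (τ ^ 2)⁻¹) := by
  set d := Module.finrank ℝ E with hd
  have hI : Integrable fun x : E => (1 + ‖x‖) ^ (-((d : ℝ) + 1)) :=
    integrable_one_add_norm (by rw [← hd]; linarith)
  set I := ∫ x : E, (1 + ‖x‖) ^ (-((d : ℝ) + 1)) with hIdef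
  have hI0 : 0 ≤ I := integral_nonneg fun x => by positivity
  refine ⟨2 ^ (d + 1) * (I + 1), by positivity, fun G τ A hτ hA h1 h2 => ?_⟩
  have hp : ∀ x, ‖G x‖ ≤ 2 ^ (d + 1) * A * (τ ^ (d + 2))⁻¹ *
      (1 + ‖τ⁻¹ • x‖) ^ (-((d : ℝ) + 1)) := by
    intro x
    have e1 : (τ + ‖x‖) ^ (d + 1) * ‖G x‖ ≤ 2 ^ (d + 1) * A * τ⁻¹ := by
      have hadd : (τ + ‖x‖) ^ (d + 1) ≤ 2 ^ d * (τ ^ (d + 1) + ‖x‖ ^ (d + 1)) :=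
        add_pow_le hτ.le (norm_nonneg x) (d + 1)
      have h3 : τ ^ (d + 1) * ‖G x‖ ≤ A * τ⁻¹ := by
        calc _ ≤ τ ^ (d + 1) * (A * (τ ^ (d + 2))⁻¹) := by gcongr; exact h1 x
          _ = _ := by rw [pow_succ τ (d + 1)]; field_simp
      calc _ ≤ 2 ^ d * (τ ^ (d + 1) + ‖x‖ ^ (d + 1)) * ‖G x‖ := by gcongr
        _ = 2 ^ d * (τ ^ (d + 1) * ‖G x‖ + ‖x‖ ^ (d + 1) * ‖G x‖) := by ring
        _ ≤ 2 ^ d * (A * τ⁻¹ + A * τ⁻¹) :=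
          mul_le_mul_of_nonneg_left (add_le_add h3 (h2 x)) (by positivity)
        _ = _ := by ring
    have e2 : (1 + ‖τ⁻¹ • x‖) ^ (-((d : ℝ) + 1)) = τ ^ (d + 1) * ((τ + ‖x‖) ^ (d + 1))⁻¹ := by
      rw [norm_smul, norm_inv, Real.norm_of_nonneg hτ.le, rpow_neg (by positivity),
        show (d : ℝ) + 1 = ((d + 1 : ℕ) : ℝ) by push_cast; rfl, rpow_natCast,
        show 1 + τ⁻¹ * ‖x‖ = τ⁻¹ * (τ + ‖x‖) by field_simp, mul_pow, mul_inv, inv_pow, inv_inv]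
    rw [e2]
    have hpos : 0 < (τ + ‖x‖) ^ (d + 1) := by positivity
    rw [← mul_assoc, ← div_eq_mul_inv _ ((τ + ‖x‖) ^ (d + 1)), le_div_iff₀ hpos, mul_comm]
    refine e1.trans_eq ?_
    rw [pow_succ τ (d + 1)]
    field_simp
  have hInt : Integrable fun x : E => 2 ^ (d + 1) * A * (τ ^ (d + 2))⁻¹ *
      (1 + ‖τ⁻¹ • x‖) ^ (-((d : ℝ) + 1)) :=
    (hI.comp_smul (inv_ne_zero hτ.ne')).const_mul _
  calc ∫⁻ x, ‖G x‖ₑ ≤ ∫⁻ x, ENNReal.ofReal (2 ^ (d + 1) * A * (τ ^ (d + 2))⁻¹ *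
      (1 + ‖τ⁻¹ • x‖) ^ (-((d : ℝ) + 1))) := by
        refine lintegral_mono fun x => ?_
        rw [← ofReal_norm]
        exact ENNReal.ofReal_le_ofReal (hp x)
    _ = ENNReal.ofReal (∫ x, 2 ^ (d + 1) * A * (τ ^ (d + 2))⁻¹ *
      (1 + ‖τ⁻¹ • x‖) ^ (-((d : ℝ) + 1))) :=
        (ofReal_integral_eq_lintegral_ofReal hInt
          (Filter.Eventually.of_forall fun x => by positivity)).symm
    _ ≤ _ := by
        apply ENNReal.ofReal_le_ofReal
        rw [integral_const_mul, Measure.integral_comp_smul (volume : Measure E)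
          (fun x : E => (1 + ‖x‖) ^ (-((d : ℝ) + 1))), abs_of_pos (by positivity), ← hd, ← hIdef,
          smul_eq_mul]
        have : 2 ^ (d + 1) * A * (τ ^ (d + 2))⁻¹ * ((τ⁻¹ ^ d)⁻¹ * I) =
            2 ^ (d + 1) * I * A * (τ ^ 2)⁻¹ := by
          rw [inv_pow, inv_inv, pow_add τ]
          field_simp
        rw [this]
        gcongr
        linarith

end Radial

section HalfLine

theorem integrableOn_exp_neg_mul_Ioi {θ : ℝ} (hθ : 0 < θ) :
    IntegrableOn (fun r : ℝ => rexp (-(θ * r))) (Set.Ioi 0) := by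
  simpa only [neg_mul] using integrableOn_exp_mul_Ioi (neg_lt_zero.2 hθ) 0

theorem setIntegral_exp_neg_mul_Ioi {θ : ℝ} (hθ : 0 < θ) :
    ∫ r in Set.Ioi (0 : ℝ), rexp (-(θ * r)) = θ⁻¹ := by
  have := integral_exp_mul_Ioi (neg_lt_zero.2 hθ) 0
  simp only [neg_mul] at this
  rw [this]
  simp

theorem tendsto_exp_neg_mul_atTop {θ : ℝ} (hθ : 0 < θ) (B : ℝ) :
    Filter.Tendsto (fun r : ℝ => B * rexp (-(θ * r))) Filter.atTop (nhds 0) := by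
  rw [← mul_zero B]
  refine Filter.Tendsto.const_mul B (tendsto_exp_atBot.comp ?_)
  exact Filter.tendsto_neg_atTop_atBot.comp (Filter.tendsto_id.const_mul_atTop hθ)

/-- A function on a half-line decaying exponentially together with its derivative has a limit at
the endpoint. -/
theorem tendsto_nhdsGT_zero_of_exp_bound {u u' : ℝ → ℂ} {θ B B' : ℝ} (hθ : 0 < θ)
    (hu : ∀ r, 0 < r → HasDerivAt u (u' r) r) (hc : IntegrableOn u' (Set.Ioi 0))
    (hb : ∀ r, 0 < r → ‖u r‖ ≤ B * rexp (-(θ * r)))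
    (hb' : ∀ r, 0 < r → ‖u' r‖ ≤ B' * rexp (-(θ * r))) :
    Filter.Tendsto u (nhdsWithin 0 (Set.Ioi 0)) (nhds (-∫ r in Set.Ioi (0 : ℝ), u' r)) := by
  have hB' : 0 ≤ B' := by
    by_contra h
    exact (not_lt.2 ((norm_nonneg _).trans (hb' 1 one_pos)))
      (mul_neg_of_neg_of_pos (not_le.1 h) (exp_pos _))
  have hlim : Filter.Tendsto u Filter.atTop (nhds 0) :=
    squeeze_zero_norm' ((Filter.eventually_gt_atTop 0).mono hb) (tendsto_exp_neg_mul_atTop hθ B)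
  rw [tendsto_iff_norm_sub_tendsto_zero]
  have h0 : Filter.Tendsto (fun r : ℝ => B' * r) (nhdsWithin 0 (Set.Ioi 0)) (nhds 0) := by
    have : Filter.Tendsto (fun r : ℝ => B' * r) (nhds 0) (nhds (B' * 0)) :=
      (continuous_const.mul continuous_id).tendsto 0
    rw [mul_zero] at this
    exact this.mono_left nhdsWithin_le_nhds
  refine squeeze_zero' (Filter.Eventually.of_forall fun _ => norm_nonneg _) ?_ h0
  filter_upwards [self_mem_nhdsWithin] with r hr
  have hr' : (0 : ℝ) < r := hr
  have h1 := integral_Ioi_of_hasDerivAt_of_tendsto (a := r) (f := u) (f' := u') (m := 0)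
    (hu r hr').continuousAt.continuousWithinAt (fun x hx => hu x (hr'.trans hx))
    (hc.mono_set (Set.Ioi_subset_Ioi hr'.le)) hlim
  have h2 : ∫ x in Set.Ioi (0 : ℝ), u' x =
      (∫ x in Set.Ioc 0 r, u' x) + ∫ x in Set.Ioi r, u' x := by
    rw [← Set.Ioc_union_Ioi_eq_Ioi hr'.le]
    exact setIntegral_union (Set.Ioc_disjoint_Ioi le_rfl) measurableSet_Ioi
      (hc.mono_set Set.Ioc_subset_Ioi_self) (hc.mono_set (Set.Ioi_subset_Ioi hr'.le))
  rw [h2, h1]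
  have h3 : u r - -((∫ x in Set.Ioc 0 r, u' x) + (0 - u r)) = ∫ x in Set.Ioc 0 r, u' x := by ring
  rw [h3]
  refine (norm_setIntegral_le_of_norm_le_const (C := B') (by simp) ?_).trans ?_
  · intro x hx
    refine (hb' x hx.1).trans (mul_le_of_le_one_right hB' ?_)
    rw [exp_le_one_iff]
    have := mul_pos hθ hx.1
    linarith
  · simp [Measure.real, hr'.le]

theorem integrableOn_of_exp_bound {u : ℝ → ℂ} {θ B : ℝ} (hθ : 0 < θ)
    (hm : ContinuousOn u (Set.Ioi 0)) (hb : ∀ r, 0 < r → ‖u r‖ ≤ B * rexp (-(θ * r))) :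
    IntegrableOn u (Set.Ioi 0) := by
  refine ((integrableOn_exp_neg_mul_Ioi hθ).const_mul B).mono'
    (hm.aestronglyMeasurable measurableSet_Ioi) ?_
  filter_upwards [self_mem_ae_restrict measurableSet_Ioi] with r hr using hb r hr

theorem norm_setIntegral_exp_mul_le {u : ℝ → ℂ} {θ B : ℝ} (hθ : 0 < θ)
    (hb : ∀ r, 0 < r → ‖u r‖ ≤ B * rexp (-(θ * r))) (α : ℝ) :
    ‖∫ r in Set.Ioi (0 : ℝ), Complex.exp (Complex.I * ((α * r : ℝ) : ℂ)) * u r‖ ≤ B * θ⁻¹ := by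
  rw [← setIntegral_exp_neg_mul_Ioi hθ, ← integral_const_mul]
  refine norm_integral_le_of_norm_le ((integrableOn_exp_neg_mul_Ioi hθ).const_mul B) ?_
  filter_upwards [self_mem_ae_restrict measurableSet_Ioi] with r hr
  rw [norm_mul, norm_exp_I_mul, one_mul]
  exact hb r hr

theorem setIntegral_exp_mul_deriv {u u' : ℝ → ℂ} {θ B B' : ℝ} {u₀ : ℂ} (hθ : 0 < θ)
    (hu : ∀ r, 0 < r → HasDerivAt u (u' r) r) (hc : ContinuousOn u' (Set.Ioi 0))
    (hb : ∀ r, 0 < r → ‖u r‖ ≤ B * rexp (-(θ * r)))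
    (hb' : ∀ r, 0 < r → ‖u' r‖ ≤ B' * rexp (-(θ * r)))
    (h0 : Filter.Tendsto u (nhdsWithin 0 (Set.Ioi 0)) (nhds u₀)) (α : ℝ) :
    ∫ r in Set.Ioi (0 : ℝ), Complex.exp (Complex.I * ((α * r : ℝ) : ℂ)) * u' r =
      -u₀ - Complex.I * α *
        ∫ r in Set.Ioi (0 : ℝ), Complex.exp (Complex.I * ((α * r : ℝ) : ℂ)) * u r := by
  have hce : Continuous fun r : ℝ => Complex.exp (Complex.I * ((α * r : ℝ) : ℂ)) := by fun_prop
  have hcu : ContinuousOn u (Set.Ioi 0) := fun r hr => (hu r hr).continuousAt.continuousWithinAt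
  have hbd : ∀ {w : ℝ → ℂ} {D : ℝ}, (∀ r, 0 < r → ‖w r‖ ≤ D * rexp (-(θ * r))) →
      ∀ r, 0 < r → ‖Complex.exp (Complex.I * ((α * r : ℝ) : ℂ)) * w r‖ ≤ D * rexp (-(θ * r)) := by
    intro w D hw r hr
    rw [norm_mul, norm_exp_I_mul, one_mul]
    exact hw r hr
  have he : ∀ r : ℝ, HasDerivAt (fun r : ℝ => Complex.exp (Complex.I * ((α * r : ℝ) : ℂ)))
      (Complex.I * α * Complex.exp (Complex.I * ((α * r : ℝ) : ℂ))) r := by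
    intro r
    have h1 : HasDerivAt (fun r : ℝ => Complex.I * ((α * r : ℝ) : ℂ)) (Complex.I * α) r := by
      have := ((hasDerivAt_id r).const_mul α).ofReal_comp.const_mul Complex.I
      simpa using this
    convert h1.cexp using 1
    ring
  have hi1 := integrableOn_of_exp_bound hθ (hce.continuousOn.mul hc) (hbd hb')
  have hi0 := integrableOn_of_exp_bound hθ (hce.continuousOn.mul hcu) (hbd hb)
  have h := integral_Ioi_mul_deriv_eq_deriv_mul (a := 0)
    (u := fun r : ℝ => Complex.exp (Complex.I * ((α * r : ℝ) : ℂ)))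
    (v := u) (u' := fun r : ℝ => Complex.I * α * Complex.exp (Complex.I * ((α * r : ℝ) : ℂ)))
    (v' := u') (a' := u₀) (b' := 0) (fun r _ => he r) (fun r hr => hu r hr) hi1
    (by
      refine IntegrableOn.congr_fun (hi0.const_mul (Complex.I * α)) (fun r _ => ?_)
        measurableSet_Ioi
      simp only [Pi.mul_apply]; ring)
    (by
      have : Filter.Tendsto (fun r : ℝ => Complex.exp (Complex.I * ((α * r : ℝ) : ℂ)))
          (nhdsWithin 0 (Set.Ioi 0)) (nhds 1) := by
        have h2 := (hce.tendsto 0).mono_left (nhdsWithin_le_nhds (s := Set.Ioi (0 : ℝ)))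
        simpa using h2
      have h3 := this.mul h0
      rw [one_mul] at h3
      exact h3)
    (squeeze_zero_norm' ((Filter.eventually_gt_atTop 0).mono (hbd hb))
      (tendsto_exp_neg_mul_atTop hθ B))
  rw [h, ← integral_const_mul, zero_sub]
  congr 2 with r
  ring

/-- The Fourier transform of a function on a half-line with a jump at the endpoint splits into a
Cauchy kernel and a remainder of quadratic decay. -/
theorem exists_halfLine_splitting {ψ ψ' ψ'' : ℝ → ℂ} {θ B : ℝ} (hθ : 0 < θ) (hB : 0 ≤ B)
    (h1 : ∀ r, 0 < r → HasDerivAt ψ (ψ' r) r) (h2 : ∀ r, 0 < r → HasDerivAt ψ' (ψ'' r) r)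
    (hc : ContinuousOn ψ'' (Set.Ioi 0))
    (hb0 : ∀ r, 0 < r → ‖ψ r‖ ≤ B * (θ ^ 2)⁻¹ * rexp (-(θ * r)))
    (hb1 : ∀ r, 0 < r → ‖ψ' r‖ ≤ B * θ⁻¹ * rexp (-(θ * r)))
    (hb2 : ∀ r, 0 < r → ‖ψ'' r‖ ≤ B * rexp (-(θ * r))) :
    ∃ (ψ₀ : ℂ) (R : ℝ → ℂ), ‖ψ₀‖ ≤ B * (θ ^ 2)⁻¹ ∧ Continuous R ∧
      (∀ α : ℝ, ∫ r in Set.Ioi (0 : ℝ), Complex.exp (Complex.I * ((α * r : ℝ) : ℂ)) * ψ r =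
        ψ₀ / (θ - Complex.I * α) + R α) ∧
      (∀ α, ‖R α‖ ≤ 4 * B * (θ ^ 3)⁻¹) ∧ ∀ α, |α| ^ 2 * ‖R α‖ ≤ 4 * B * θ⁻¹ := by
  have hc1 : ContinuousOn ψ' (Set.Ioi 0) := fun r hr => (h2 r hr).continuousAt.continuousWithinAt
  have hc0 : ContinuousOn ψ (Set.Ioi 0) := fun r hr => (h1 r hr).continuousAt.continuousWithinAt
  obtain ⟨ψ₀, hψ₀⟩ : ∃ ψ₀ : ℂ, Filter.Tendsto ψ (nhdsWithin 0 (Set.Ioi 0)) (nhds ψ₀) :=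
    ⟨_, tendsto_nhdsGT_zero_of_exp_bound hθ h1 (integrableOn_of_exp_bound hθ hc1 hb1) hb0 hb1⟩
  have hn0 : ‖ψ₀‖ ≤ B * (θ ^ 2)⁻¹ := by
    refine le_of_tendsto hψ₀.norm ?_
    filter_upwards [self_mem_nhdsWithin] with r hr
    refine (hb0 r hr).trans (mul_le_of_le_one_right (by positivity) ?_)
    rw [exp_le_one_iff]
    have := mul_pos hθ hr
    linarith
  set g : ℝ → ℂ := fun r => ((rexp (-(θ * r)) : ℝ) : ℂ) with hg
  have hgn : ∀ r, ‖g r‖ = rexp (-(θ * r)) := fun r => by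
    rw [hg, Complex.norm_real, Real.norm_of_nonneg (exp_pos _).le]
  have hgd : ∀ r, HasDerivAt g (-θ * g r) r := fun r => by
    have h3 : HasDerivAt (fun r : ℝ => -(θ * r)) (-θ) r := by
      have h4 := ((hasDerivAt_id r).const_mul θ).neg
      rw [mul_one] at h4
      exact h4
    have := h3.exp.ofReal_comp
    convert this using 1
    simp only [hg]
    push_cast
    ring
  have hgc : Continuous g := by fun_prop
  set χ : ℝ → ℂ := fun r => ψ r - ψ₀ * g r with hχ
  set χ' : ℝ → ℂ := fun r => ψ' r + θ * ψ₀ * g r with hχ'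
  set χ'' : ℝ → ℂ := fun r => ψ'' r - θ ^ 2 * ψ₀ * g r with hχ''
  have d1 : ∀ r, 0 < r → HasDerivAt χ (χ' r) r := fun r hr => by
    refine ((h1 r hr).sub ((hgd r).const_mul ψ₀)).congr_deriv ?_
    simp only [hχ']; ring
  have d2 : ∀ r, 0 < r → HasDerivAt χ' (χ'' r) r := fun r hr => by
    refine ((h2 r hr).add ((hgd r).const_mul (θ * ψ₀))).congr_deriv ?_
    simp only [hχ'']; ring
  have b0 : ∀ r, 0 < r → ‖χ r‖ ≤ 2 * B * (θ ^ 2)⁻¹ * rexp (-(θ * r)) := fun r hr => by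
    refine (norm_sub_le _ _).trans ?_
    rw [norm_mul, hgn]
    have := mul_le_mul_of_nonneg_right hn0 (exp_pos (-(θ * r))).le
    linarith [hb0 r hr]
  have b1 : ∀ r, 0 < r → ‖χ' r‖ ≤ 2 * B * θ⁻¹ * rexp (-(θ * r)) := fun r hr => by
    refine (norm_add_le _ _).trans ?_
    rw [norm_mul, norm_mul, hgn, Complex.norm_real, Real.norm_of_nonneg hθ.le]
    have h3 : θ * ‖ψ₀‖ ≤ B * θ⁻¹ := by
      refine (mul_le_mul_of_nonneg_left hn0 hθ.le).trans_eq ?_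
      field_simp
    have := mul_le_mul_of_nonneg_right h3 (exp_pos (-(θ * r))).le
    linarith [hb1 r hr]
  have b2 : ∀ r, 0 < r → ‖χ'' r‖ ≤ 2 * B * rexp (-(θ * r)) := fun r hr => by
    refine (norm_sub_le _ _).trans ?_
    rw [norm_mul, norm_mul, hgn, norm_pow, Complex.norm_real, Real.norm_of_nonneg hθ.le]
    have h3 : θ ^ 2 * ‖ψ₀‖ ≤ B := by
      refine (mul_le_mul_of_nonneg_left hn0 (by positivity)).trans_eq ?_
      field_simp
    have := mul_le_mul_of_nonneg_right h3 (exp_pos (-(θ * r))).le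
    linarith [hb2 r hr]
  have cχ'' : ContinuousOn χ'' (Set.Ioi 0) := hc.sub (by fun_prop)
  have cχ' : ContinuousOn χ' (Set.Ioi 0) := hc1.add (by fun_prop)
  have cχ : ContinuousOn χ (Set.Ioi 0) := hc0.sub (by fun_prop)
  have t0 : Filter.Tendsto χ (nhdsWithin 0 (Set.Ioi 0)) (nhds 0) := by
    have h3 : Filter.Tendsto g (nhdsWithin 0 (Set.Ioi 0)) (nhds 1) := by
      have h4 := (hgc.tendsto 0).mono_left (nhdsWithin_le_nhds (s := Set.Ioi (0 : ℝ)))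
      simpa [hg] using h4
    simpa using hψ₀.sub (h3.const_mul ψ₀)
  have iχ'' := integrableOn_of_exp_bound hθ cχ'' b2
  have iχ := integrableOn_of_exp_bound hθ cχ b0
  have t1 := tendsto_nhdsGT_zero_of_exp_bound hθ d2 iχ'' b1 b2
  refine ⟨ψ₀, fun α => ∫ r in Set.Ioi (0 : ℝ), Complex.exp (Complex.I * ((α * r : ℝ) : ℂ)) * χ r,
    hn0, ?_, fun α => ?_, fun α => ?_, fun α => ?_⟩
  · refine continuous_of_dominated (bound := fun r => ‖χ r‖) (fun α => ?_) (fun α => ?_) iχ.norm ?_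
    · exact (by fun_prop : Continuous fun r : ℝ =>
        Complex.exp (Complex.I * ((α * r : ℝ) : ℂ))).aestronglyMeasurable.mul
          iχ.aestronglyMeasurable
    · refine Filter.Eventually.of_forall fun r => ?_
      rw [norm_mul, norm_exp_I_mul, one_mul]
    · exact Filter.Eventually.of_forall fun r => by fun_prop
  · have hce : Continuous fun r : ℝ => Complex.exp (Complex.I * ((α * r : ℝ) : ℂ)) := by fun_prop
    have hre : (-(θ : ℂ) + Complex.I * α).re < 0 := by simp [hθ]
    have h3 := integral_exp_mul_complex_Ioi hre 0
    have i1 : IntegrableOn (fun r : ℝ => Complex.exp (Complex.I * ((α * r : ℝ) : ℂ)) * χ r)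
        (Set.Ioi 0) := integrableOn_of_exp_bound hθ (hce.continuousOn.mul cχ) fun r hr => by
          rw [norm_mul, norm_exp_I_mul, one_mul]
          exact b0 r hr
    have i2 : IntegrableOn (fun r : ℝ => ψ₀ * Complex.exp ((-(θ : ℂ) + Complex.I * α) * r))
        (Set.Ioi 0) := (integrableOn_exp_mul_complex_Ioi hre 0).const_mul ψ₀
    have h4 : ψ₀ / (θ - Complex.I * α) =
        ∫ r in Set.Ioi (0 : ℝ), ψ₀ * Complex.exp ((-(θ : ℂ) + Complex.I * α) * r) := by
      rw [integral_const_mul, h3]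
      have h5 : (-(θ : ℂ) + Complex.I * α) ≠ 0 := fun h => by rw [h] at hre; simp at hre
      rw [show (θ : ℂ) - Complex.I * α = -(-(θ : ℂ) + Complex.I * α) by ring, div_neg,
        Complex.ofReal_zero, mul_zero, Complex.exp_zero, neg_div, mul_neg, mul_one_div]
    rw [h4, ← integral_add i2 i1]
    congr 1 with r
    simp only [hχ, hg, mul_sub]
    have h6 : Complex.exp ((-(θ : ℂ) + Complex.I * α) * r) =
        Complex.exp (Complex.I * ((α * r : ℝ) : ℂ)) * ((rexp (-(θ * r)) : ℝ) : ℂ) := by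
      rw [Complex.ofReal_exp, ← Complex.exp_add]
      push_cast
      ring_nf
    rw [h6]
    ring
  · refine (norm_setIntegral_exp_mul_le hθ b0 α).trans ?_
    rw [pow_succ θ 2, mul_inv, ← mul_assoc]
    gcongr
    norm_num
  · have e1 := setIntegral_exp_mul_deriv hθ d1 cχ' b0 b1 t0 α
    have e2 := setIntegral_exp_mul_deriv hθ d2 cχ'' b1 b2 t1 α
    set J := ∫ r in Set.Ioi (0 : ℝ), Complex.exp (Complex.I * ((α * r : ℝ) : ℂ)) * χ r
    have e3 : (α : ℂ) ^ 2 * J = (∫ r in Set.Ioi (0 : ℝ), χ'' r) -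
        ∫ r in Set.Ioi (0 : ℝ), Complex.exp (Complex.I * ((α * r : ℝ) : ℂ)) * χ'' r := by
      rw [e2, e1]
      ring_nf
      rw [Complex.I_sq]
      ring
    have e4 : |α| ^ 2 * ‖J‖ = ‖(α : ℂ) ^ 2 * J‖ := by
      rw [norm_mul, norm_pow, Complex.norm_real, Real.norm_eq_abs]
    rw [e4, e3]
    refine (norm_sub_le _ _).trans ?_
    have e5 := norm_setIntegral_exp_mul_le hθ b2 α
    have e6 := norm_setIntegral_exp_mul_le hθ b2 0
    simp only [zero_mul, Complex.ofReal_zero, mul_zero, Complex.exp_zero, one_mul] at e6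
    linarith

end HalfLine

section LineMultiplier

theorem lintegral_rpow_add_le {α : Type*} [MeasurableSpace α] {μ : Measure α} {q : ℝ} (hq : 1 < q)
    {f g : α → ℝ≥0∞} (hf : Measurable f) :
    ∫⁻ x, (f x + g x) ^ q ∂μ ≤ 2 ^ (q - 1) * (∫⁻ x, f x ^ q ∂μ + ∫⁻ x, g x ^ q ∂μ) := by
  have h2 : (2 : ℝ≥0∞) ^ (q - 1) ≠ ∞ := ENNReal.rpow_ne_top_of_nonneg (by linarith) (by simp)
  rw [← lintegral_add_left (hf.pow_const q), ← lintegral_const_mul' _ _ h2]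
  exact lintegral_mono fun x => ENNReal.rpow_add_le_mul_rpow_add_rpow _ _ hq.le

theorem measurable_conv {E : Type*} [NormedAddCommGroup E] [InnerProductSpace ℝ E]
    [FiniteDimensional ℝ E] [MeasurableSpace E] [BorelSpace E] {G h : E → ℂ} (hG : Measurable G)
    (hh : Measurable h) : Measurable fun x => ∫ z, G (x - z) * h z := by
  have : Measurable (Function.uncurry fun x z : E => G (x - z) * h z) :=
    (hG.comp (measurable_fst.sub measurable_snd)).mul (hh.comp measurable_snd)
  exact (this.stronglyMeasurable.integral_prod_right).measurable

theorem integrable_conv_of_bound {E : Type*} [NormedAddCommGroup E] [InnerProductSpace ℝ E]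
    [FiniteDimensional ℝ E] [MeasurableSpace E] [BorelSpace E] {G h : E → ℂ} (hG : Measurable G)
    {b : ℝ} (hb : ∀ x, ‖G x‖ ≤ b) (hi : Integrable h) (x : E) :
    Integrable fun z => G (x - z) * h z :=
  hi.bdd_mul (c := b) (hG.comp (measurable_const.sub measurable_id)).aestronglyMeasurable
    (Filter.Eventually.of_forall fun z => hb (x - z))

theorem lintegral_conv_le {E : Type*} [NormedAddCommGroup E] [InnerProductSpace ℝ E]
    [FiniteDimensional ℝ E] [MeasurableSpace E] [BorelSpace E] {q : ℝ} (hq : 1 < q) {G h : E → ℂ}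
    (hG : Measurable G) (hh : Measurable h) {M : ℝ≥0∞} (hM : M ≠ ∞) (hGM : ∫⁻ z, ‖G z‖ₑ ≤ M) :
    ∫⁻ x, ‖∫ z, G (x - z) * h z‖ₑ ^ q ≤ M ^ q * ∫⁻ z, ‖h z‖ₑ ^ q := by
  calc ∫⁻ x, ‖∫ z, G (x - z) * h z‖ₑ ^ q
      ≤ ∫⁻ x, (∫⁻ z, ‖G (x - z)‖ₑ * ‖h z‖ₑ) ^ q := by
        gcongr with x
        refine (enorm_integral_le_lintegral_enorm _).trans_eq ?_
        simp_rw [enorm_mul]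
    _ ≤ (∫⁻ z, ‖G z‖ₑ) ^ q * ∫⁻ z, ‖h z‖ₑ ^ q :=
        lintegral_rpow_conv_le hq (G := fun z => ‖G z‖ₑ) hG.enorm hh.enorm
          (ne_top_of_le_ne_top hM hGM)
    _ ≤ _ := by gcongr

theorem exists_lintegral_halfLine_le {q : ℝ} (hq : 1 < q) :
    ∃ C : ℝ≥0∞, C ≠ ∞ ∧ ∀ (ψ ψ' ψ'' : ℝ → ℂ) (θ B : ℝ), 0 < θ → 0 ≤ B →
      (∀ r, 0 < r → HasDerivAt ψ (ψ' r) r) → (∀ r, 0 < r → HasDerivAt ψ' (ψ'' r) r) →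
      ContinuousOn ψ'' (Set.Ioi 0) →
      (∀ r, 0 < r → ‖ψ r‖ ≤ B * (θ ^ 2)⁻¹ * rexp (-(θ * r))) →
      (∀ r, 0 < r → ‖ψ' r‖ ≤ B * θ⁻¹ * rexp (-(θ * r))) →
      (∀ r, 0 < r → ‖ψ'' r‖ ≤ B * rexp (-(θ * r))) →
      ∃ G : ℝ → ℂ, Measurable G ∧ (∃ b : ℝ, ∀ x, ‖G x‖ ≤ b) ∧
        (∀ α : ℝ, ∫ r in Set.Ioi (0 : ℝ), Complex.exp (Complex.I * ((α * r : ℝ) : ℂ)) * ψ r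
          = G α) ∧
        ∀ h : ℝ → ℂ, Measurable h → Integrable h → Integrable (fun z : ℝ => (z : ℂ) * h z) →
          ∫⁻ x, ‖∫ z, G (x - z) * h z‖ₑ ^ q ≤
            C * ENNReal.ofReal (B * (θ ^ 2)⁻¹) ^ q * ∫⁻ z, ‖h z‖ₑ ^ q := by
  obtain ⟨CH, hCH, hH⟩ := exists_lintegral_cauchyInt_le hq
  obtain ⟨C₁, hC₁, hL1⟩ := exists_lintegral_enorm_le_of_decay (E := ℝ)
  simp only [Module.finrank_self] at hL1
  have hq0 : 0 < q := by linarith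
  have h2 : (2 : ℝ≥0∞) ^ (q - 1) ≠ ∞ := ENNReal.rpow_ne_top_of_nonneg (by linarith) (by simp)
  refine ⟨2 ^ (q - 1) * (CH + ENNReal.ofReal (C₁ * 4) ^ q), ?_, ?_⟩
  · exact ENNReal.mul_ne_top h2 (ENNReal.add_ne_top.2 ⟨hCH, ENNReal.rpow_ne_top_of_nonneg hq0.le
      ENNReal.ofReal_ne_top⟩)
  intro ψ ψ' ψ'' θ B hθ hB h1 h2 hc hb0 hb1 hb2
  obtain ⟨ψ₀, R, hψ₀, hRc, hG, hR0, hR2⟩ := exists_halfLine_splitting hθ hB h1 h2 hc hb0 hb1 hb2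
  have hden : ∀ α : ℝ, θ ≤ ‖(θ : ℂ) - Complex.I * α‖ := fun α => by
    have := re_le_norm_add_I_mul (θ : ℂ) (-α)
    push_cast at this
    rwa [Complex.ofReal_re, mul_neg, ← sub_eq_add_neg] at this
  have hcm : Measurable fun α : ℝ => ψ₀ / ((θ : ℂ) - Complex.I * α) := by fun_prop
  have hcb : ∀ α : ℝ, ‖ψ₀ / ((θ : ℂ) - Complex.I * α)‖ ≤ ‖ψ₀‖ / θ := fun α => by
    rw [norm_div]
    gcongr
    exact hden α
  refine ⟨fun α => ψ₀ / (θ - Complex.I * α) + R α, hcm.add hRc.measurable,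
    ⟨‖ψ₀‖ / θ + 4 * B * (θ ^ 3)⁻¹, fun x => (norm_add_le _ _).trans (add_le_add (hcb x) (hR0 x))⟩,
    hG, fun h hm hi hzi => ?_⟩
  have hsplit : ∀ x : ℝ, ∫ z, (ψ₀ / (θ - Complex.I * ((x - z : ℝ) : ℂ)) + R (x - z)) * h z =
      ψ₀ * cauchyInt h (θ + (-x : ℝ) * Complex.I) + ∫ z, R (x - z) * h z := by
    intro x
    simp_rw [add_mul]
    rw [integral_add (integrable_conv_of_bound (G := fun α : ℝ => ψ₀ / ((θ : ℂ) - Complex.I * α))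
      hcm hcb hi x) (integrable_conv_of_bound hRc.measurable hR0 hi x), cauchyInt,
      ← integral_const_mul]
    congr 2 with z
    rw [div_mul_eq_mul_div, mul_div_assoc]
    congr 3
    push_cast
    ring
  have hA : ∫⁻ x : ℝ, ‖ψ₀ * cauchyInt h (θ + (-x : ℝ) * Complex.I)‖ₑ ^ q ≤
      ENNReal.ofReal (B * (θ ^ 2)⁻¹) ^ q * (CH * ∫⁻ z, ‖h z‖ₑ ^ q) := by
    simp_rw [enorm_mul, ENNReal.mul_rpow_of_nonneg _ _ hq0.le]
    rw [lintegral_const_mul' _ _ (ENNReal.rpow_ne_top_of_nonneg hq0.le enorm_ne_top)]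
    gcongr
    · rw [← ofReal_norm]
      exact ENNReal.ofReal_le_ofReal hψ₀
    · rw [lintegral_neg_eq_self (fun y : ℝ => ‖cauchyInt h (θ + (y : ℝ) * Complex.I)‖ₑ ^ q)]
      exact hH h hm hi hzi θ hθ
  have hR1 : ∫⁻ x, ‖R x‖ₑ ≤ ENNReal.ofReal (C₁ * 4) * ENNReal.ofReal (B * (θ ^ 2)⁻¹) := by
    rw [← ENNReal.ofReal_mul (by positivity)]
    refine (hL1 R θ (4 * B) hθ (by positivity) hR0 fun x => ?_).trans_eq ?_
    · simpa using hR2 x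
    · congr 1; ring
  have hBc := lintegral_conv_le hq hRc.measurable hm
    (ENNReal.mul_ne_top ENNReal.ofReal_ne_top ENNReal.ofReal_ne_top) hR1
  have hmeas : Measurable fun x : ℝ => ‖ψ₀ * cauchyInt h (θ + (-x : ℝ) * Complex.I)‖ₑ :=
    (((continuous_cauchyInt_vertical hi hθ).comp continuous_neg).measurable.const_mul ψ₀).enorm
  calc _ = ∫⁻ x : ℝ, ‖ψ₀ * cauchyInt h (θ + (-x : ℝ) * Complex.I) + ∫ z, R (x - z) * h z‖ₑ ^ q := by
        simp_rw [← hsplit]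
    _ ≤ ∫⁻ x : ℝ, (‖ψ₀ * cauchyInt h (θ + (-x : ℝ) * Complex.I)‖ₑ +
          ‖∫ z, R (x - z) * h z‖ₑ) ^ q := by
        gcongr with x
        exact enorm_add_le _ _
    _ ≤ _ := lintegral_rpow_add_le hq hmeas
    _ ≤ 2 ^ (q - 1) * (ENNReal.ofReal (B * (θ ^ 2)⁻¹) ^ q * (CH * ∫⁻ z, ‖h z‖ₑ ^ q) +
          (ENNReal.ofReal (C₁ * 4) * ENNReal.ofReal (B * (θ ^ 2)⁻¹)) ^ q * ∫⁻ z, ‖h z‖ₑ ^ q) := by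
        gcongr
    _ = _ := by
        rw [ENNReal.mul_rpow_of_nonneg _ _ hq0.le]
        ring

theorem exists_lintegral_line_le {q : ℝ} (hq : 1 < q) :
    ∃ C : ℝ≥0∞, C ≠ ∞ ∧ ∀ (φ φ' φ'' : ℝ → ℂ) (θ B : ℝ), 0 < θ → 0 ≤ B → Integrable φ →
      (∀ r, r ≠ 0 → HasDerivAt φ (φ' r) r) → (∀ r, r ≠ 0 → HasDerivAt φ' (φ'' r) r) →
      ContinuousOn φ'' {0}ᶜ →
      (∀ r, r ≠ 0 → ‖φ r‖ ≤ B * (θ ^ 2)⁻¹ * rexp (-(θ * |r|))) →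
      (∀ r, r ≠ 0 → ‖φ' r‖ ≤ B * θ⁻¹ * rexp (-(θ * |r|))) →
      (∀ r, r ≠ 0 → ‖φ'' r‖ ≤ B * rexp (-(θ * |r|))) →
        ∀ h : ℝ → ℂ, Measurable h → Integrable h → Integrable (fun z : ℝ => (z : ℂ) * h z) →
          ∫⁻ x, ‖∫ z, fourierInt φ (x - z) * h z‖ₑ ^ q ≤
            C * ENNReal.ofReal (B * (θ ^ 2)⁻¹) ^ q * ∫⁻ z, ‖h z‖ₑ ^ q := by
  obtain ⟨C, hC, hK⟩ := exists_lintegral_halfLine_le hq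
  have h2 : (2 : ℝ≥0∞) ^ (q - 1) ≠ ∞ := ENNReal.rpow_ne_top_of_nonneg (by linarith) (by simp)
  refine ⟨2 ^ (q - 1) * (C + C), ENNReal.mul_ne_top h2 (by simp [hC]), ?_⟩
  intro φ φ' φ'' θ B hθ hB hφ h1 h2 hc hb0 hb1 hb2 h hm hi hzi
  have habs : ∀ r : ℝ, 0 < r → |r| = r ∧ |-r| = r := fun r hr =>
    ⟨abs_of_pos hr, by rw [abs_neg, abs_of_pos hr]⟩
  obtain ⟨G, hGm, ⟨b, hGb⟩, hG, hGq⟩ := hK φ φ' φ'' θ B hθ hB (fun r hr => h1 r hr.ne')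
    (fun r hr => h2 r hr.ne') (hc.mono fun r hr => ne_of_gt hr)
    (fun r hr => by simpa [(habs r hr).1] using hb0 r hr.ne')
    (fun r hr => by simpa [(habs r hr).1] using hb1 r hr.ne')
    (fun r hr => by simpa [(habs r hr).1] using hb2 r hr.ne')
  obtain ⟨G', hGm', ⟨b', hGb'⟩, hG', hGq'⟩ := hK (fun r => φ (-r)) (fun r => -φ' (-r))
    (fun r => φ'' (-r)) θ B hθ hB
    (fun r hr => by
      have := (h1 (-r) (by linarith)).scomp r (hasDerivAt_neg r)
      simpa using! this)
    (fun r hr => by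
      have := ((h2 (-r) (by linarith)).scomp r (hasDerivAt_neg r)).neg
      simpa using! this)
    (hc.comp continuous_neg.continuousOn fun r hr => neg_ne_zero.2 (ne_of_gt hr))
    (fun r hr => by simpa [(habs r hr).1] using hb0 (-r) (by linarith))
    (fun r hr => by simpa [(habs r hr).1] using hb1 (-r) (by linarith))
    (fun r hr => by simpa [(habs r hr).1] using hb2 (-r) (by linarith))
  have hF : ∀ x : ℝ, fourierInt φ x = G' (-x) + G x := by
    intro x
    have hInt := integrable_exp_I_inner_mul hφ x
    rw [← hG, ← hG', fourierInt, ← intervalIntegral.integral_Iic_add_Ioi (b := 0)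
      hInt.integrableOn hInt.integrableOn]
    congr 1
    · rw [← neg_zero, ← integral_comp_neg_Ioi, neg_zero]
      congr 1 with r
      congr 4
      simp [mul_comm]
    · congr 1 with r
      congr 4
      simp [mul_comm]
  set h' : ℝ → ℂ := fun z => h (-z) with hh'
  have hsplit : ∀ x : ℝ, ∫ z, fourierInt φ (x - z) * h z =
      (∫ z, G' (-x - z) * h' z) + ∫ z, G (x - z) * h z := by
    intro x
    simp_rw [hF, add_mul]
    rw [integral_add _ (integrable_conv_of_bound hGm hGb hi x)]
    · congr 1
      rw [← integral_neg_eq_self]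
      congr 1 with z
      simp only [hh']
      congr 2
      ring
    · exact integrable_conv_of_bound (G := fun x => G' (-x)) (hGm'.comp measurable_neg)
        (fun x => hGb' _) hi x
  have hm' : Measurable h' := hm.comp measurable_neg
  have key := hGq' h' hm' hi.comp_neg (by
    have := hzi.comp_neg.neg
    refine this.congr (Filter.Eventually.of_forall fun z => ?_)
    simp [hh'])
  calc _ = ∫⁻ x : ℝ, ‖(∫ z, G' (-x - z) * h' z) + ∫ z, G (x - z) * h z‖ₑ ^ q := by
        simp_rw [hsplit]
    _ ≤ ∫⁻ x : ℝ, (‖∫ z, G' (-x - z) * h' z‖ₑ + ‖∫ z, G (x - z) * h z‖ₑ) ^ q := by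
        gcongr with x
        exact enorm_add_le _ _
    _ ≤ 2 ^ (q - 1) * ((∫⁻ x : ℝ, ‖∫ z, G' (-x - z) * h' z‖ₑ ^ q) +
          ∫⁻ x : ℝ, ‖∫ z, G (x - z) * h z‖ₑ ^ q) :=
        lintegral_rpow_add_le hq ((measurable_conv hGm' hm').comp measurable_neg).enorm
    _ ≤ 2 ^ (q - 1) * (C * ENNReal.ofReal (B * (θ ^ 2)⁻¹) ^ q * (∫⁻ z, ‖h z‖ₑ ^ q) +
          C * ENNReal.ofReal (B * (θ ^ 2)⁻¹) ^ q * ∫⁻ z, ‖h z‖ₑ ^ q) := by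
        gcongr
        · rw [lintegral_neg_eq_self (fun x : ℝ => ‖∫ z, G' (x - z) * h' z‖ₑ ^ q)]
          refine key.trans_eq ?_
          rw [hh', lintegral_neg_eq_self (fun z : ℝ => ‖h z‖ₑ ^ q)]
        · exact hGq h hm hi hzi
    _ = _ := by ring

end LineMultiplier

section KernelSymbol

variable {E : Type*} [NormedAddCommGroup E] [InnerProductSpace ℝ E] [FiniteDimensional ℝ E]
  [MeasurableSpace E] [BorelSpace E]

/-- Symbols of order two with the exponential decay of `exp (-τ * sqrt (s ^ 2 + ‖ξ‖ ^ 2))`. -/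
def IsKernelSymbol (c₀ A s τ : ℝ) (φ : E → ℂ) : Prop :=
  ContDiffOn ℝ (⊤ : ℕ∞) φ {0}ᶜ ∧ ∀ ξ : E, ξ ≠ 0 → ∀ v : E, ‖v‖ = 1 →
    ∀ n ≤ Module.finrank ℝ E + 1, ‖iteratedFDeriv ℝ n φ ξ fun _ => v‖ ≤
      A * ((s + ‖ξ‖) ^ 2 * rexp (-(c₀ * τ * (s + ‖ξ‖)))) * ((s + ‖ξ‖) ^ n)⁻¹

theorem mul_exp_neg_le {θ S : ℝ} (hθ : 0 < θ) : S * rexp (-(θ * S)) ≤ θ⁻¹ := by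
  have h := add_one_le_exp (θ * S)
  rw [exp_neg, ← div_eq_mul_inv, div_le_iff₀ (exp_pos _), inv_mul_eq_div, le_div_iff₀ hθ]
  linarith

theorem sq_mul_exp_neg_le {θ S : ℝ} (hθ : 0 < θ) (hS : 0 ≤ S) :
    S ^ 2 * rexp (-(θ * S)) ≤ 2 * (θ ^ 2)⁻¹ := by
  have h := quadratic_le_exp_of_nonneg (mul_nonneg hθ.le hS)
  rw [exp_neg, ← div_eq_mul_inv, div_le_iff₀ (exp_pos _), ← div_eq_mul_inv, div_mul_eq_mul_div,
    le_div_iff₀ (by positivity)]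
  nlinarith [mul_nonneg hθ.le hS]

theorem exp_neg_le_exp_half {c₀ τ s r : ℝ} (hc₀ : 0 < c₀) (hτ : 0 < τ) (hs : 0 < s) :
    rexp (-(c₀ * τ * (s + r))) ≤
      rexp (-(c₀ / 2 * τ * (s + r))) * rexp (-(c₀ / 2 * τ * r)) := by
  rw [← exp_add]
  apply exp_le_exp.2
  have : 0 < c₀ * τ * s := by positivity
  linarith

namespace IsKernelSymbol

variable {c₀ A s τ : ℝ} {φ : E → ℂ}

theorem measurable_iteratedFDeriv (h : IsKernelSymbol c₀ A s τ φ) (n : ℕ) (v : E) :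
    Measurable fun ξ => iteratedFDeriv ℝ n φ ξ fun _ => v := by
  refine measurable_of_continuousOn_compl_singleton 0 fun ξ hξ => ?_
  have h1 : ContDiffAt ℝ (⊤ : ℕ∞) φ ξ := h.1.contDiffAt (isOpen_compl_singleton.mem_nhds hξ)
  have h2 : ContinuousAt (iteratedFDeriv ℝ n φ) ξ :=
    (h1.differentiableAt_iteratedFDeriv (by exact_mod_cast WithTop.coe_lt_top _)).continuousAt
  have h3 := (ContinuousMultilinearMap.apply ℝ (fun _ : Fin n => E) ℂ
    (fun _ => v)).continuous.continuousAt (x := iteratedFDeriv ℝ n φ ξ)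
  exact (h3.comp h2).continuousWithinAt

theorem measurable [Nontrivial E] (h : IsKernelSymbol c₀ A s τ φ) : Measurable φ := by
  obtain ⟨v, -⟩ := exists_norm_eq E zero_le_one
  simpa using h.measurable_iteratedFDeriv 0 v

theorem norm_zero_le (h : IsKernelSymbol c₀ A s τ φ) (hc₀ : 0 < c₀) (hA : 0 ≤ A) (hs : 0 < s)
    (hτ : 0 < τ) {ξ : E} (hξ : ξ ≠ 0) {v : E} (hv : ‖v‖ = 1) :
    ‖iteratedFDeriv ℝ 0 φ ξ fun _ => v‖ ≤
      2 * A * ((c₀ / 2 * τ) ^ 2)⁻¹ * rexp (-(c₀ / 2 * τ * ‖ξ‖)) := by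
  refine (h.2 ξ hξ v hv 0 (Nat.zero_le _)).trans ?_
  have e := exp_neg_le_exp_half (r := ‖ξ‖) hc₀ hτ hs
  have e' := sq_mul_exp_neg_le (θ := c₀ / 2 * τ) (S := s + ‖ξ‖) (by positivity) (by positivity)
  calc _ ≤ A * ((s + ‖ξ‖) ^ 2 * (rexp (-(c₀ / 2 * τ * (s + ‖ξ‖))) * rexp (-(c₀ / 2 * τ * ‖ξ‖)))) := by
        rw [pow_zero, inv_one, mul_one]
        gcongr
    _ = A * ((s + ‖ξ‖) ^ 2 * rexp (-(c₀ / 2 * τ * (s + ‖ξ‖)))) * rexp (-(c₀ / 2 * τ * ‖ξ‖)) := by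
        ring
    _ ≤ A * (2 * ((c₀ / 2 * τ) ^ 2)⁻¹) * rexp (-(c₀ / 2 * τ * ‖ξ‖)) := by gcongr
    _ = _ := by ring

theorem norm_one_le (h : IsKernelSymbol c₀ A s τ φ) (hc₀ : 0 < c₀) (hA : 0 ≤ A) (hs : 0 < s)
    (hτ : 0 < τ) {ξ : E} (hξ : ξ ≠ 0) {v : E} (hv : ‖v‖ = 1) :
    ‖iteratedFDeriv ℝ 1 φ ξ fun _ => v‖ ≤
      2 * A * (c₀ / 2 * τ)⁻¹ * rexp (-(c₀ / 2 * τ * ‖ξ‖)) := by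
  refine (h.2 ξ hξ v hv 1 (by omega)).trans ?_
  have e := exp_neg_le_exp_half (r := ‖ξ‖) hc₀ hτ hs
  have e' := mul_exp_neg_le (θ := c₀ / 2 * τ) (S := s + ‖ξ‖) (by positivity)
  have hS : 0 < s + ‖ξ‖ := by positivity
  calc _ = A * ((s + ‖ξ‖) * rexp (-(c₀ * τ * (s + ‖ξ‖)))) := by
        rw [pow_one]
        field_simp
    _ ≤ A * ((s + ‖ξ‖) * (rexp (-(c₀ / 2 * τ * (s + ‖ξ‖))) * rexp (-(c₀ / 2 * τ * ‖ξ‖)))) := by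
        gcongr
    _ = A * ((s + ‖ξ‖) * rexp (-(c₀ / 2 * τ * (s + ‖ξ‖)))) * rexp (-(c₀ / 2 * τ * ‖ξ‖)) := by
        ring
    _ ≤ A * ((c₀ / 2 * τ)⁻¹) * rexp (-(c₀ / 2 * τ * ‖ξ‖)) := by gcongr
    _ ≤ _ := by
        gcongr
        linarith

theorem norm_add_two_le (h : IsKernelSymbol c₀ A s τ φ) (hc₀ : 0 < c₀) (hA : 0 ≤ A) (hs : 0 < s)
    (hτ : 0 < τ) {ξ : E} (hξ : ξ ≠ 0) {v : E} (hv : ‖v‖ = 1) {m : ℕ}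
    (hm : m + 1 ≤ Module.finrank ℝ E) :
    ‖iteratedFDeriv ℝ (m + 2) φ ξ fun _ => v‖ ≤
      2 * A * ((‖ξ‖ ^ m)⁻¹ * rexp (-(c₀ / 2 * τ * ‖ξ‖))) := by
  refine (h.2 ξ hξ v hv (m + 2) (by omega)).trans ?_
  have hξ' : 0 < ‖ξ‖ := norm_pos_iff.2 hξ
  have hS : 0 < s + ‖ξ‖ := by positivity
  calc _ = A * (((s + ‖ξ‖) ^ m)⁻¹ * rexp (-(c₀ * τ * (s + ‖ξ‖)))) := by
        rw [pow_add]
        field_simp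
    _ ≤ A * ((‖ξ‖ ^ m)⁻¹ * rexp (-(c₀ / 2 * τ * ‖ξ‖))) := by
        gcongr
        · linarith
        · linarith
        · nlinarith [mul_pos hc₀ hτ, mul_pos (mul_pos hc₀ hτ) hs, mul_pos (mul_pos hc₀ hτ) hξ']
    _ ≤ _ := by
        have : 0 ≤ A * ((‖ξ‖ ^ m)⁻¹ * rexp (-(c₀ / 2 * τ * ‖ξ‖))) := by positivity
        linarith

theorem integrable_iteratedFDeriv [Nontrivial E] (h : IsKernelSymbol c₀ A s τ φ) (hc₀ : 0 < c₀)
    (hA : 0 ≤ A) (hs : 0 < s) (hτ : 0 < τ) {v : E} (hv : ‖v‖ = 1) {n : ℕ}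
    (hn : n ≤ Module.finrank ℝ E + 1) :
    Integrable fun ξ => iteratedFDeriv ℝ n φ ξ fun _ => v := by
  have hne : ∀ᵐ ξ : E, ξ ≠ 0 := by simp [ae_iff]
  have h0 := integrable_inv_norm_pow_mul_exp' (E := E) (m := 0) Module.finrank_pos
    (half_pos hc₀) hτ
  match n, hn with
  | 0, _ =>
    refine (h0.const_mul (2 * A * ((c₀ / 2 * τ) ^ 2)⁻¹)).mono'
      (h.measurable_iteratedFDeriv 0 v).aestronglyMeasurable (hne.mono fun ξ hξ => ?_)
    simpa only [pow_zero, inv_one, one_mul] using h.norm_zero_le hc₀ hA hs hτ hξ hv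
  | 1, _ =>
    refine (h0.const_mul (2 * A * (c₀ / 2 * τ)⁻¹)).mono'
      (h.measurable_iteratedFDeriv 1 v).aestronglyMeasurable (hne.mono fun ξ hξ => ?_)
    simpa only [pow_zero, inv_one, one_mul] using h.norm_one_le hc₀ hA hs hτ hξ hv
  | m + 2, hn =>
    have hm := integrable_inv_norm_pow_mul_exp' (E := E) (m := m) (by omega) (half_pos hc₀) hτ
    exact (hm.const_mul (2 * A)).mono'
      (h.measurable_iteratedFDeriv (m + 2) v).aestronglyMeasurable
      (hne.mono fun ξ hξ => h.norm_add_two_le hc₀ hA hs hτ hξ hv (by omega))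

theorem integrable [Nontrivial E] (h : IsKernelSymbol c₀ A s τ φ) (hc₀ : 0 < c₀)
    (hA : 0 ≤ A) (hs : 0 < s) (hτ : 0 < τ) : Integrable φ := by
  obtain ⟨v, hv⟩ := exists_norm_eq E zero_le_one
  simpa using h.integrable_iteratedFDeriv hc₀ hA hs hτ hv (Nat.zero_le _)

theorem fourierInt_iteratedFDeriv (h : IsKernelSymbol c₀ A s τ φ) (hc₀ : 0 < c₀)
    (hA : 0 ≤ A) (hs : 0 < s) (hτ : 0 < τ) (hd : 2 ≤ Module.finrank ℝ E) {v : E} (hv : ‖v‖ = 1)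
    (x : E) {n : ℕ} (hn : n ≤ Module.finrank ℝ E + 1) :
    fourierInt (fun ξ => iteratedFDeriv ℝ n φ ξ fun _ => v) x =
      (-(Complex.I * (⟪x, v⟫ : ℂ))) ^ n * fourierInt φ x := by
  have : Nontrivial E := Module.nontrivial_of_finrank_pos (R := ℝ) (by omega)
  induction n with
  | zero => simp
  | succ n ih =>
    have hae : ∀ᵐ ξ : E, ξ ∉ (Submodule.span ℝ {v} : Submodule ℝ E) := by
      have hne : (Submodule.span ℝ {v} : Submodule ℝ E) ≠ ⊤ := by
        intro htop
        have h1 := finrank_span_le_card (R := ℝ) ({v} : Set E)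
        rw [htop, finrank_top] at h1
        simp at h1
        omega
      have := Measure.addHaar_submodule (volume : Measure E) _ hne
      rw [ae_iff]
      simpa using! this
    rw [fourierInt_deriv_line (v := v) (h.integrable_iteratedFDeriv hc₀ hA hs hτ hv (n := n) (by omega))
      (h.integrable_iteratedFDeriv hc₀ hA hs hτ hv hn) (h.measurable_iteratedFDeriv _ v)
      (hae.mono fun ξ hξ => ?_) x, ih (by omega), pow_succ]
    · ring
    · have hmem : ∀ y : ℝ, ContDiffAt ℝ (⊤ : ℕ∞) φ (ξ + y • v) := by
        intro y
        refine h.1.contDiffAt (isOpen_compl_singleton.mem_nhds fun h0 => hξ ?_)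
        have h0' : ξ + y • v = 0 := h0
        rw [add_eq_zero_iff_eq_neg.1 h0']
        exact Submodule.neg_mem _ (Submodule.smul_mem _ _ (Submodule.mem_span_singleton_self v))
      exact ⟨fun y => hasDerivAt_iteratedFDeriv_line (hmem y) n, continuous_iff_continuousAt.2
        fun y => (hasDerivAt_iteratedFDeriv_line (hmem y) (n + 1)).continuousAt⟩

end IsKernelSymbol

theorem measurable_fourierInt {φ : E → ℂ} (hφ : Measurable φ) : Measurable (fourierInt φ) := by
  have : Measurable (Function.uncurry fun x ξ : E =>
      Complex.exp (Complex.I * (⟪x, ξ⟫ : ℂ)) * φ ξ) := by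
    refine Measurable.mul ?_ (hφ.comp measurable_snd)
    exact (by fun_prop : Continuous fun p : E × E =>
      Complex.exp (Complex.I * (⟪p.1, p.2⟫ : ℂ))).measurable
  exact (this.stronglyMeasurable.integral_prod_right).measurable

theorem exists_lintegral_fourierInt_le {c₀ : ℝ} (hc₀ : 0 < c₀) (hd : 2 ≤ Module.finrank ℝ E) :
    ∃ C : ℝ, 0 < C ∧ ∀ (A s τ : ℝ) (φ : E → ℂ), 0 ≤ A → 0 < s → 0 < τ →
      IsKernelSymbol c₀ A s τ φ →
      ∫⁻ x, ‖fourierInt φ x‖ₑ ≤ ENNReal.ofReal C * ENNReal.ofReal (A * (τ ^ 2)⁻¹) := by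
  have : Nontrivial E := Module.nontrivial_of_finrank_pos (R := ℝ) (by omega)
  obtain ⟨C₁, hC₁, H⟩ := exists_lintegral_enorm_le_of_decay (E := E)
  set d := Module.finrank ℝ E with hdd
  set I₀ := ∫ ξ : E, (‖ξ‖ ^ 0)⁻¹ * rexp (-(c₀ / 2 * ‖ξ‖)) with hI₀
  set I₁ := ∫ ξ : E, (‖ξ‖ ^ (d - 1))⁻¹ * rexp (-(c₀ / 2 * ‖ξ‖)) with hI₁
  have h0 : 0 ≤ I₀ := integral_nonneg fun ξ => by positivity
  have h1 : 0 ≤ I₁ := integral_nonneg fun ξ => by positivity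
  set D : ℝ := 8 / c₀ ^ 2 * I₀ + 2 * I₁ + 1 with hD
  have hD0 : 0 < D := by positivity
  have hne : ∀ᵐ ξ : E, ξ ≠ 0 := by simp [ae_iff]
  refine ⟨C₁ * D, by positivity, fun A s τ φ hA hs hτ h => ?_⟩
  refine (H (fourierInt φ) τ (A * D) hτ (by positivity) (fun x => ?_) (fun x => ?_)).trans_eq ?_
  · obtain ⟨v, hv⟩ := exists_norm_eq E zero_le_one
    refine (norm_fourierInt_le x).trans ?_
    calc ∫ ξ, ‖φ ξ‖ ≤ ∫ ξ : E, 2 * A * ((c₀ / 2 * τ) ^ 2)⁻¹ *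
          ((‖ξ‖ ^ 0)⁻¹ * rexp (-(c₀ / 2 * τ * ‖ξ‖))) := by
          refine integral_mono_ae (h.integrable hc₀ hA hs hτ).norm
            ((integrable_inv_norm_pow_mul_exp' (m := 0) Module.finrank_pos (half_pos hc₀)
              hτ).const_mul _) (hne.mono fun ξ hξ => ?_)
          simpa using h.norm_zero_le hc₀ hA hs hτ hξ hv
      _ = A * (8 / c₀ ^ 2 * I₀) * (τ ^ (d + 2))⁻¹ := by
          rw [integral_const_mul, integral_inv_norm_pow_mul_exp 0 _ hτ, ← hI₀, ← hdd, pow_add τ]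
          field_simp
          ring
      _ ≤ _ := by gcongr; linarith
  · rcases eq_or_ne x 0 with rfl | hx
    · simp only [norm_zero, ne_eq, Nat.add_eq_zero_iff, one_ne_zero, and_false, not_false_eq_true,
        zero_pow, zero_mul]
      positivity
    have hx' : 0 < ‖x‖ := norm_pos_iff.2 hx
    set v := ‖x‖⁻¹ • x with hvdef
    have hv : ‖v‖ = 1 := norm_smul_inv_norm hx
    have hxv : (⟪x, v⟫ : ℝ) = ‖x‖ := by
      rw [hvdef, inner_smul_right, real_inner_self_eq_norm_sq]
      field_simp
    have h3 := h.fourierInt_iteratedFDeriv hc₀ hA hs hτ hd hv x le_rfl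
    have h4 : ‖x‖ ^ (d + 1) * ‖fourierInt φ x‖ =
        ‖fourierInt (fun ξ => iteratedFDeriv ℝ (d + 1) φ ξ fun _ => v) x‖ := by
      rw [hdd, h3, hxv]
      simp
    rw [h4]
    refine (norm_fourierInt_le x).trans ?_
    have hd1 : d + 1 = (d - 1) + 2 := by omega
    calc ∫ ξ, ‖iteratedFDeriv ℝ (d + 1) φ ξ fun _ => v‖ ≤ ∫ ξ : E, 2 * A *
          ((‖ξ‖ ^ (d - 1))⁻¹ * rexp (-(c₀ / 2 * τ * ‖ξ‖))) := by
          refine integral_mono_ae (h.integrable_iteratedFDeriv hc₀ hA hs hτ hv le_rfl).norm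
            ((integrable_inv_norm_pow_mul_exp' (m := d - 1) (by omega) (half_pos hc₀)
              hτ).const_mul _) (hne.mono fun ξ hξ => ?_)
          rw [hd1]
          exact h.norm_add_two_le hc₀ hA hs hτ hξ hv (by omega)
      _ = A * (2 * I₁) * τ⁻¹ := by
          rw [integral_const_mul, integral_inv_norm_pow_mul_exp _ _ hτ, ← hI₁, ← hdd]
          have : τ ^ d = τ ^ (d - 1) * τ := by rw [← pow_succ]; congr 1; omega
          rw [this]
          field_simp
      _ ≤ _ := by
          gcongr
          have : 0 ≤ 8 / c₀ ^ 2 * I₀ := by positivity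
          linarith
  · rw [← ENNReal.ofReal_mul (by positivity)]
    congr 1
    ring

end KernelSymbol

section Multiplier

variable {E : Type*} [NormedAddCommGroup E] [InnerProductSpace ℝ E] [FiniteDimensional ℝ E]
  [MeasurableSpace E] [BorelSpace E]

theorem exists_lintegral_conv_fourierInt_le_of_one {q : ℝ} (hq : 1 < q) {c₀ : ℝ} (hc₀ : 0 < c₀)
    (hd : Module.finrank ℝ E = 1) :
    ∃ C : ℝ≥0∞, C ≠ ∞ ∧ ∀ (A s τ : ℝ) (φ : E → ℂ), 0 ≤ A → 0 < s → 0 < τ →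
      IsKernelSymbol c₀ A s τ φ → ∀ h : E → ℂ, Measurable h → Integrable h →
      Integrable (fun z => ‖z‖ • h z) →
      ∫⁻ x, ‖∫ z, fourierInt φ (x - z) * h z‖ₑ ^ q ≤
        C * ENNReal.ofReal (A * (τ ^ 2)⁻¹) ^ q * ∫⁻ z, ‖h z‖ₑ ^ q := by
  have : Nontrivial E := Module.nontrivial_of_finrank_pos (R := ℝ) (by omega)
  obtain ⟨C, hC, H⟩ := exists_lintegral_line_le hq
  have hq0 : 0 < q := by linarith
  let L : ℝ ≃ₗᵢ[ℝ] E := (stdOrthonormalBasis ℝ ℝ).equiv (stdOrthonormalBasis ℝ E)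
    (finCongr (by rw [hd, Module.finrank_self]))
  have hLm : MeasurePreserving L := L.measurePreserving
  have hLe : MeasurableEmbedding L := L.toHomeomorph.measurableEmbedding
  set v := L 1 with hv
  have hvn : ‖v‖ = 1 := by rw [hv, L.norm_map]; simp
  have hLv : ∀ r : ℝ, L r = 0 + r • v := fun r => by
    rw [zero_add, hv, ← map_smul, smul_eq_mul, mul_one]
  refine ⟨C * ENNReal.ofReal (2 * (2 / c₀) ^ 2) ^ q, ENNReal.mul_ne_top hC
    (ENNReal.rpow_ne_top_of_nonneg hq0.le ENNReal.ofReal_ne_top), ?_⟩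
  intro A s τ φ hA hs hτ hφ h hm hi hzi
  have hθ : 0 < c₀ / 2 * τ := by positivity
  have hL0 : ∀ r : ℝ, r ≠ 0 → L r ≠ 0 := fun r hr => by simpa using hr
  have hLn : ∀ r : ℝ, ‖L r‖ = |r| := fun r => by rw [L.norm_map, Real.norm_eq_abs]
  have hda : ∀ (n : ℕ) (r : ℝ), r ≠ 0 →
      HasDerivAt (fun y : ℝ => iteratedFDeriv ℝ n φ (L y) fun _ => v)
        (iteratedFDeriv ℝ (n + 1) φ (L r) fun _ => v) r := by
    intro n r hr
    simp_rw [hLv]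
    refine hasDerivAt_iteratedFDeriv_line ?_ n
    rw [← hLv]
    exact hφ.1.contDiffAt (isOpen_compl_singleton.mem_nhds (hL0 r hr))
  have hInt : Integrable φ := hφ.integrable hc₀ hA hs hτ
  have key := H (fun r => iteratedFDeriv ℝ 0 φ (L r) fun _ => v)
    (fun r => iteratedFDeriv ℝ 1 φ (L r) fun _ => v)
    (fun r => iteratedFDeriv ℝ 2 φ (L r) fun _ => v) (c₀ / 2 * τ) (2 * A) hθ (by positivity)
    (by
      simp only [iteratedFDeriv_zero_apply]
      exact (hLm.integrable_comp_emb hLe).2 hInt)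
    (hda 0) (hda 1) (fun r hr => (hda 2 r hr).continuousAt.continuousWithinAt)
    (fun r hr => by
      rw [← hLn]
      exact hφ.norm_zero_le hc₀ hA hs hτ (hL0 r hr) hvn)
    (fun r hr => by
      rw [← hLn]
      exact hφ.norm_one_le hc₀ hA hs hτ (hL0 r hr) hvn)
    (fun r hr => by
      rw [← hLn]
      simpa using hφ.norm_add_two_le hc₀ hA hs hτ (hL0 r hr) hvn (m := 0) (by omega))
    (fun r => h (L r)) (hm.comp L.continuous.measurable) ((hLm.integrable_comp_emb hLe).2 hi)
    (by
      have h1 : Integrable fun z : ℝ => ‖L z‖ • h (L z) :=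
        (hLm.integrable_comp_emb hLe (g := fun z => ‖z‖ • h z)).2 hzi
      refine h1.mono (Measurable.aestronglyMeasurable ?_) (Filter.Eventually.of_forall fun z => ?_)
      · exact Complex.continuous_ofReal.measurable.mul (hm.comp L.continuous.measurable)
      · rw [hLn, norm_mul, norm_smul, Complex.norm_real, Real.norm_eq_abs, Real.norm_eq_abs,
          abs_abs])
  simp only [iteratedFDeriv_zero_apply] at key
  have hF : ∀ y : ℝ, fourierInt (fun r => φ (L r)) y = fourierInt φ (L y) := by
    intro y
    rw [fourierInt, fourierInt, ← hLm.integral_comp hLe]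
    congr 1 with r
    rw [L.inner_map_map]
  rw [← hLm.lintegral_comp_emb hLe, ← hLm.lintegral_comp_emb hLe (fun z => ‖h z‖ₑ ^ q)]
  calc _ = ∫⁻ y : ℝ, ‖∫ z, fourierInt (fun r => φ (L r)) (y - z) * h (L z)‖ₑ ^ q := by
        congr 1 with y
        rw [← hLm.integral_comp hLe]
        simp_rw [hF, map_sub]
    _ ≤ _ := key
    _ = _ := by
        rw [mul_assoc C (ENNReal.ofReal (2 * (2 / c₀) ^ 2) ^ q),
          ← ENNReal.mul_rpow_of_nonneg _ _ hq0.le, ← ENNReal.ofReal_mul (by positivity)]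
        have e : 2 * A * ((c₀ / 2 * τ) ^ 2)⁻¹ = 2 * (2 / c₀) ^ 2 * (A * (τ ^ 2)⁻¹) := by
          field_simp
        rw [e, mul_assoc]

theorem exists_lintegral_conv_fourierInt_le {q : ℝ} (hq : 1 < q) {c₀ : ℝ} (hc₀ : 0 < c₀)
    (hd : 1 ≤ Module.finrank ℝ E) :
    ∃ C : ℝ≥0∞, C ≠ ∞ ∧ ∀ (A s τ : ℝ) (φ : E → ℂ), 0 ≤ A → 0 < s → 0 < τ →
      IsKernelSymbol c₀ A s τ φ → ∀ h : E → ℂ, Measurable h → Integrable h →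
      Integrable (fun z => ‖z‖ • h z) →
      ∫⁻ x, ‖∫ z, fourierInt φ (x - z) * h z‖ₑ ^ q ≤
        C * ENNReal.ofReal (A * (τ ^ 2)⁻¹) ^ q * ∫⁻ z, ‖h z‖ₑ ^ q := by
  rcases hd.eq_or_lt with hd | hd
  · exact exists_lintegral_conv_fourierInt_le_of_one hq hc₀ hd.symm
  have : Nontrivial E := Module.nontrivial_of_finrank_pos (R := ℝ) (by omega)
  have hq0 : 0 < q := by linarith
  obtain ⟨C, hC, H⟩ := exists_lintegral_fourierInt_le (E := E) hc₀ hd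
  refine ⟨ENNReal.ofReal C ^ q, ENNReal.rpow_ne_top_of_nonneg hq0.le ENNReal.ofReal_ne_top, ?_⟩
  intro A s τ φ hA hs hτ hφ h hm hi _
  rw [← ENNReal.mul_rpow_of_nonneg _ _ hq0.le]
  exact lintegral_conv_le hq (measurable_fourierInt hφ.measurable) hm
    (ENNReal.mul_ne_top ENNReal.ofReal_ne_top ENNReal.ofReal_ne_top) (H A s τ φ hA hs hτ hφ)

/-- The (unnormalised) Fourier integral. -/
noncomputable def fourierHat (h : E → ℂ) (ξ : E) : ℂ :=
  ∫ z, Complex.exp (-Complex.I * (⟪z, ξ⟫ : ℂ)) * h z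

theorem fourierInt_mul_fourierHat {φ h : E → ℂ} (hφm : Measurable φ) (hφ : Integrable φ)
    (hhm : Measurable h) (hh : Integrable h) (x : E) :
    fourierInt (fun ξ => φ ξ * fourierHat h ξ) x = ∫ z, fourierInt φ (x - z) * h z := by
  have e1 : ∀ ξ, Complex.exp (Complex.I * (⟪x, ξ⟫ : ℂ)) * (φ ξ * fourierHat h ξ) =
      ∫ z, Complex.exp (Complex.I * (⟪x - z, ξ⟫ : ℂ)) * φ ξ * h z := by
    intro ξ
    rw [fourierHat, ← mul_assoc, ← integral_const_mul]
    congr 1 with z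
    rw [inner_sub_left]
    push_cast
    rw [mul_sub, Complex.exp_sub, neg_mul, Complex.exp_neg]
    ring
  rw [fourierInt]
  simp_rw [e1]
  rw [integral_integral_swap]
  · congr 1 with z
    rw [integral_mul_const, fourierInt]
  · have hc : Continuous fun p : E × E => Complex.exp (Complex.I * (⟪x - p.2, p.1⟫ : ℂ)) := by
      fun_prop
    refine (hφ.mul_prod hh).norm.mono' (Measurable.aestronglyMeasurable ?_)
      (Filter.Eventually.of_forall fun p => ?_)
    · exact (hc.measurable.mul (hφm.comp measurable_fst)).mul (hhm.comp measurable_snd)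
    · simp only [Function.uncurry]
      rw [norm_mul, norm_mul, norm_exp_I_mul, one_mul, norm_mul]

end Multiplier

/-- Lebesgue measure on `(0, ∞)`. -/
noncomputable abbrev halfLine : Measure ℝ := volume.restrict (Set.Ioi 0)

theorem lintegral_halfLine_comp_mul {G : ℝ → ℝ≥0∞} (hG : Measurable G) {u : ℝ} (hu : 0 < u) :
    ∫⁻ t, G (t * u) ∂halfLine = ENNReal.ofReal u⁻¹ * ∫⁻ y, G y ∂halfLine := by
  have h1 : ∀ t : ℝ, (Set.Ioi (0 : ℝ)).indicator (fun t => G (t * u)) t =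
      (Set.Ioi (0 : ℝ)).indicator G (t * u) := by
    intro t
    by_cases ht : 0 < t
    · simp [Set.indicator, ht, mul_pos ht hu]
    · simp [Set.indicator, ht, hu]
  rw [halfLine, ← lintegral_indicator measurableSet_Ioi, ← lintegral_indicator measurableSet_Ioi]
  simp_rw [h1]
  rw [← lintegral_map (f := (Set.Ioi (0 : ℝ)).indicator G) (g := fun t => t * u)
    (hG.indicator measurableSet_Ioi) (measurable_mul_const u),
    Real.map_volume_mul_right hu.ne', lintegral_smul_measure, abs_of_pos (inv_pos.2 hu)]
  rfl

theorem integrable_halfLine_inv_mul_rpow {q : ℝ} (hq : 1 < q) :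
    Integrable (fun u : ℝ => (1 + u)⁻¹ * u ^ (-(1 / q))) halfLine := by
  have hq' : 1 / q < 1 := by rw [div_lt_one (by linarith)]; exact hq
  have hq0 : 0 < 1 / q := by positivity
  have hm : Measurable fun u : ℝ => (1 + u)⁻¹ * u ^ (-(1 / q)) :=
    (by fun_prop : Measurable fun u : ℝ => (1 + u)⁻¹).mul (measurable_id.pow_const _)
  rw [show (halfLine : Measure ℝ) = volume.restrict (Set.Ioc 0 1 ∪ Set.Ioi 1) by
    rw [Set.Ioc_union_Ioi_eq_Ioi zero_le_one]]
  refine IntegrableOn.union ?_ ?_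
  · have h : IntegrableOn (fun u : ℝ => u ^ (-(1 / q))) (Set.Ioc 0 1) := by
      rw [← intervalIntegrable_iff_integrableOn_Ioc_of_le zero_le_one]
      exact intervalIntegral.intervalIntegrable_rpow' (by linarith)
    refine h.mono' hm.aestronglyMeasurable ((ae_restrict_iff' measurableSet_Ioc).2
      (Filter.Eventually.of_forall fun u hu => ?_))
    have hu0 : 0 < u := hu.1
    rw [norm_of_nonneg (by positivity)]
    refine mul_le_of_le_one_left (by positivity) (inv_le_one_of_one_le₀ (by linarith))
  · refine (integrableOn_Ioi_rpow_of_lt (a := -1 - 1 / q) (by linarith) one_pos).mono'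
      hm.aestronglyMeasurable ((ae_restrict_iff' measurableSet_Ioi).2
      (Filter.Eventually.of_forall fun u hu => ?_))
    have hu0 : 0 < u := zero_lt_one.trans hu
    rw [norm_of_nonneg (by positivity), sub_eq_add_neg, rpow_add hu0, rpow_neg_one]
    gcongr
    linarith

theorem integrable_halfLine_inv_sq : Integrable (fun w : ℝ => ((1 + w) ^ 2)⁻¹) halfLine := by
  have h := (integrable_inv_one_add_sq).restrict (s := Set.Ioi (0 : ℝ))
  refine h.mono' (by fun_prop : Measurable fun w : ℝ => ((1 + w) ^ 2)⁻¹).aestronglyMeasurable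
    ((ae_restrict_iff' measurableSet_Ioi).2 (Filter.Eventually.of_forall fun w hw => ?_))
  have hw0 : 0 < w := hw
  rw [norm_of_nonneg (by positivity)]
  gcongr
  nlinarith

section Majorant

variable {E : Type*} [NormedAddCommGroup E] [InnerProductSpace ℝ E] [FiniteDimensional ℝ E]
  [MeasurableSpace E] [BorelSpace E]

theorem measurable_fourierInt_param {β : Type*} [MeasurableSpace β] {F : β → E → ℂ}
    (hF : Measurable (Function.uncurry F)) {x : β → E} (hx : Measurable x) :
    Measurable fun y => fourierInt (F y) (x y) := by
  have h : Measurable (Function.uncurry fun (y : β) (ξ : E) =>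
      Complex.exp (Complex.I * (⟪x y, ξ⟫ : ℂ)) * F y ξ) := by
    refine Measurable.mul ?_ hF
    have hc : Continuous fun p : E × E => Complex.exp (Complex.I * (⟪p.1, p.2⟫ : ℂ)) := by
      fun_prop
    exact hc.measurable.comp ((hx.comp measurable_fst).prodMk measurable_snd)
  exact (h.stronglyMeasurable.integral_prod_right (ν := (volume : Measure E))).measurable

theorem measurable_fourierHat_param {β : Type*} [MeasurableSpace β] {F : β → E → ℂ}
    (hF : Measurable (Function.uncurry F)) {x : β → E} (hx : Measurable x) :
    Measurable fun y => fourierHat (F y) (x y) := by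
  have h : Measurable (Function.uncurry fun (y : β) (z : E) =>
      Complex.exp (-Complex.I * (⟪z, x y⟫ : ℂ)) * F y z) := by
    refine Measurable.mul ?_ hF
    have hc : Continuous fun p : E × E => Complex.exp (-Complex.I * (⟪p.2, p.1⟫ : ℂ)) := by
      fun_prop
    exact hc.measurable.comp ((hx.comp measurable_fst).prodMk measurable_snd)
  exact (h.stronglyMeasurable.integral_prod_right (ν := (volume : Measure E))).measurable

/-- The integrand of the majorant of a Poisson-type operator with symbols `φ τ`. -/
noncomputable def majorantKernel (φ : ℝ → E → ℂ) (g : E × ℝ → ℂ) (p : E × ℝ) (y : ℝ × ℝ) : ℝ≥0∞ :=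
  ENNReal.ofReal (p.2 ^ 2 * (1 + y.1)) *
    ‖fourierInt (fun ξ => φ (p.2 * (1 + y.1) * (1 + y.2)) ξ *
      fourierHat (fun z => g (z, p.2 * y.1)) ξ) p.1‖ₑ

theorem measurable_majorantKernel {φ : ℝ → E → ℂ} (hφ : Measurable (Function.uncurry φ))
    {g : E × ℝ → ℂ} (hg : Measurable g) :
    Measurable (Function.uncurry (majorantKernel φ g)) := by
  refine Measurable.mul (by fun_prop) (Measurable.enorm ?_)
  refine measurable_fourierInt_param (β := (E × ℝ) × (ℝ × ℝ)) (x := fun r => r.1.1)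
    (F := fun r ξ => φ (r.1.2 * (1 + r.2.1) * (1 + r.2.2)) ξ *
      fourierHat (fun z => g (z, r.1.2 * r.2.1)) ξ) ?_ (by fun_prop)
  refine Measurable.mul ?_ ?_
  · exact hφ.comp (f := fun r : ((E × ℝ) × (ℝ × ℝ)) × E =>
      (r.1.1.2 * (1 + r.1.2.1) * (1 + r.1.2.2), r.2)) (by fun_prop)
  · refine measurable_fourierHat_param (β := ((E × ℝ) × (ℝ × ℝ)) × E) (x := fun r => r.2)
      (F := fun r z => g (z, r.1.1.2 * r.1.2.1)) ?_ measurable_snd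
    exact hg.comp (by fun_prop)

theorem exists_lintegral_majorant_le {q : ℝ} (hq : 1 < q) {c₀ : ℝ} (hc₀ : 0 < c₀)
    (hd : 1 ≤ Module.finrank ℝ E) :
    ∃ C : ℝ≥0∞, C ≠ ∞ ∧ ∀ (A s : ℝ) (φ : ℝ → E → ℂ), 0 ≤ A → 0 < s →
      Measurable (Function.uncurry φ) → (∀ τ, 0 < τ → IsKernelSymbol c₀ A s τ (φ τ)) →
      ∀ g : E × ℝ → ℂ, Measurable g → (∀ y, Integrable fun z => g (z, y)) →
      (∀ y, Integrable fun z => ‖z‖ • g (z, y)) →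
      ∫⁻ p, (∫⁻ y, majorantKernel φ g p y ∂(halfLine.prod halfLine)) ^ q
          ∂((volume : Measure E).prod halfLine) ≤
        C * (ENNReal.ofReal A ^ q * ∫⁻ p, ‖g p‖ₑ ^ q ∂((volume : Measure E).prod halfLine)) := by
  have : Nontrivial E := Module.nontrivial_of_finrank_pos (R := ℝ) (by omega)
  have hq0 : 0 < q := by linarith
  obtain ⟨C, hC, H⟩ := exists_lintegral_conv_fourierInt_le (E := E) hq hc₀ hd
  set b : ℝ × ℝ → ℝ≥0∞ := fun y =>
    ENNReal.ofReal ((1 + y.1)⁻¹ * y.1 ^ (-(1 / q)) * ((1 + y.2) ^ 2)⁻¹) with hb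
  have hbm : Measurable b := by
    refine Measurable.ennreal_ofReal (Measurable.mul (Measurable.mul (by fun_prop) ?_)
      (by fun_prop))
    exact measurable_fst.pow_const _
  have hbi : ∫⁻ y, b y ∂(halfLine.prod halfLine) ≠ ∞ :=
    ((integrable_halfLine_inv_mul_rpow hq).mul_prod integrable_halfLine_inv_sq).lintegral_lt_top.ne
  have hpos : ∀ᵐ y ∂(halfLine.prod halfLine), 0 < y.1 ∧ 0 < y.2 := by
    rw [Measure.prod_restrict, ae_restrict_iff' (measurableSet_Ioi.prod measurableSet_Ioi)]
    exact Filter.Eventually.of_forall fun y hy => hy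
  refine ⟨(∫⁻ y, b y ∂(halfLine.prod halfLine)) ^ q * C,
    ENNReal.mul_ne_top (ENNReal.rpow_ne_top_of_nonneg hq0.le hbi) hC, ?_⟩
  intro A s φ hA hs hφm hφ g hgm hgi hzi
  rw [mul_assoc, ← mul_assoc C]
  have hGm : Measurable fun y : ℝ => ∫⁻ z, ‖g (z, y)‖ₑ ^ q :=
    (hgm.enorm.pow_const q).lintegral_prod_left'
  have hWm := measurable_majorantKernel hφm hgm
  refine lintegral_rpow_lintegral_le hq hWm hbm ?_ ?_ ?_
  · filter_upwards [hpos] with y hy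
    have := hy.1
    have := hy.2
    rw [hb]
    simp only [ne_eq, ENNReal.ofReal_eq_zero, not_le]
    positivity
  · exact Filter.Eventually.of_forall fun y => ENNReal.ofReal_ne_top
  filter_upwards [hpos] with y hy
  obtain ⟨u, w⟩ := y
  obtain ⟨hu, hw⟩ : 0 < u ∧ 0 < w := hy
  have hslice : ∀ t : ℝ, 0 < t → ∫⁻ x : E, majorantKernel φ g (x, t) (u, w) ^ q ≤
      C * ENNReal.ofReal A ^ q * ENNReal.ofReal ((1 + u)⁻¹ * ((1 + w) ^ 2)⁻¹) ^ q *
        ∫⁻ z, ‖g (z, t * u)‖ₑ ^ q := by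
    intro t ht
    have hτ : 0 < t * (1 + u) * (1 + w) := by positivity
    have h1 := hφ _ hτ
    have h2 := H A s _ _ hA hs hτ h1 (fun z => g (z, t * u)) (hgm.comp (by fun_prop))
      (hgi _) (hzi _)
    have h3 : ∀ x, majorantKernel φ g (x, t) (u, w) ^ q = ENNReal.ofReal (t ^ 2 * (1 + u)) ^ q *
        ‖∫ z, fourierInt (φ (t * (1 + u) * (1 + w))) (x - z) * g (z, t * u)‖ₑ ^ q := by
      intro x
      rw [majorantKernel, ENNReal.mul_rpow_of_nonneg _ _ hq0.le]
      simp only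
      rw [fourierInt_mul_fourierHat h1.measurable (h1.integrable hc₀ hA hs hτ)
          (h := fun z => g (z, t * u)) (hgm.comp (by fun_prop)) (hgi _)]
    simp_rw [h3]
    rw [lintegral_const_mul' _ _ (ENNReal.rpow_ne_top_of_nonneg hq0.le ENNReal.ofReal_ne_top)]
    calc _ ≤ ENNReal.ofReal (t ^ 2 * (1 + u)) ^ q * (C *
          ENNReal.ofReal (A * ((t * (1 + u) * (1 + w)) ^ 2)⁻¹) ^ q *
            ∫⁻ z, ‖g (z, t * u)‖ₑ ^ q) := by gcongr
      _ = C * (ENNReal.ofReal (t ^ 2 * (1 + u)) ^ q *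
          ENNReal.ofReal (A * ((t * (1 + u) * (1 + w)) ^ 2)⁻¹) ^ q) *
            ∫⁻ z, ‖g (z, t * u)‖ₑ ^ q := by ring
      _ = _ := by
        rw [← ENNReal.mul_rpow_of_nonneg _ _ hq0.le, ← ENNReal.ofReal_mul (by positivity),
          mul_assoc C (ENNReal.ofReal A ^ q), ← ENNReal.mul_rpow_of_nonneg _ _ hq0.le,
          ← ENNReal.ofReal_mul hA]
        have e : t ^ 2 * (1 + u) * (A * ((t * (1 + u) * (1 + w)) ^ 2)⁻¹) =
            A * ((1 + u)⁻¹ * ((1 + w) ^ 2)⁻¹) := by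
          field_simp
        rw [e]
  have hWy : Measurable fun p => majorantKernel φ g p (u, w) ^ q :=
    (hWm.comp (measurable_id.prodMk measurable_const)).pow_const q
  have hsl : ∀ᵐ t ∂halfLine, ∫⁻ x : E, majorantKernel φ g (x, t) (u, w) ^ q ≤
      C * ENNReal.ofReal A ^ q * ENNReal.ofReal ((1 + u)⁻¹ * ((1 + w) ^ 2)⁻¹) ^ q *
        ∫⁻ z, ‖g (z, t * u)‖ₑ ^ q :=
    (ae_restrict_iff' measurableSet_Ioi).2 (Filter.Eventually.of_forall hslice)
  rw [lintegral_prod_symm' _ hWy, lintegral_prod_symm' _ (hgm.enorm.pow_const q)]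
  refine (lintegral_mono_ae hsl).trans_eq ?_
  rw [lintegral_const_mul (f := fun t => ∫⁻ z, ‖g (z, t * u)‖ₑ ^ q) _
    (hGm.comp (measurable_mul_const u)), lintegral_halfLine_comp_mul hGm hu]
  have e : ENNReal.ofReal u⁻¹ = ENNReal.ofReal (u ^ (-(1 / q))) ^ q := by
    rw [ENNReal.ofReal_rpow_of_nonneg (by positivity) hq0.le, ← rpow_mul hu.le]
    rw [show -(1 / q) * q = -1 by field_simp, rpow_neg_one]
  have e2 : b (u, w) ^ q = ENNReal.ofReal ((1 + u)⁻¹ * ((1 + w) ^ 2)⁻¹) ^ q *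
      ENNReal.ofReal u⁻¹ := by
    rw [e, ← ENNReal.mul_rpow_of_nonneg _ _ hq0.le, ← ENNReal.ofReal_mul (by positivity)]
    simp only [hb]
    congr 2
    ring
  rw [e2]
  ring

end Majorant

theorem integrable_halfLine_exp_neg {θ : ℝ} (hθ : 0 < θ) :
    Integrable (fun u : ℝ => rexp (-(θ * u))) halfLine :=
  integrableOn_exp_neg_mul_Ioi hθ

theorem integrable_halfLine_one_add_mul_exp {θ : ℝ} (hθ : 0 < θ) :
    Integrable (fun u : ℝ => (1 + u) * rexp (-(θ * u))) halfLine := by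
  refine ((integrable_halfLine_exp_neg (half_pos hθ)).const_mul (1 + (θ / 2)⁻¹)).mono'
    (by fun_prop : Measurable fun u : ℝ => (1 + u) * rexp (-(θ * u))).aestronglyMeasurable
    ((ae_restrict_iff' measurableSet_Ioi).2 (Filter.Eventually.of_forall fun u hu => ?_))
  have hu0 : 0 < u := hu
  rw [norm_of_nonneg (by positivity)]
  have e : rexp (-(θ * u)) = rexp (-(θ / 2 * u)) * rexp (-(θ / 2 * u)) := by
    rw [← exp_add]; congr 1; ring
  have h1 := mul_exp_neg_le (θ := θ / 2) (S := u) (by positivity)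
  have h2 : rexp (-(θ / 2 * u)) ≤ 1 := exp_le_one_iff.2 (by have : 0 < θ / 2 * u := by positivity
                                                            linarith)
  rw [e, ← mul_assoc]
  gcongr
  linarith

theorem integrable_halfLine_prod_exp {θ : ℝ} (hθ : 0 < θ) :
    Integrable (fun y : ℝ × ℝ => (1 + y.1) * rexp (-(θ * y.1)) * rexp (-(θ * y.2)))
      (halfLine.prod halfLine) :=
  (integrable_halfLine_one_add_mul_exp hθ).mul_prod (integrable_halfLine_exp_neg hθ)

theorem ae_halfLine_prod : ∀ᵐ y ∂(halfLine.prod halfLine), 0 < y.1 ∧ 0 < y.2 := by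
  rw [Measure.prod_restrict, ae_restrict_iff' (measurableSet_Ioi.prod measurableSet_Ioi)]
  exact Filter.Eventually.of_forall fun y hy => hy

/-- The Laplace transform on the half-line. -/
noncomputable def laplaceInt (a : ℂ) (h : ℝ → ℂ) : ℂ := ∫ y, Complex.exp (-a * y) * h y ∂halfLine

theorem norm_cexp_neg_mul (a : ℂ) (r : ℝ) : ‖Complex.exp (-a * r)‖ = rexp (-(a.re * r)) := by
  rw [Complex.norm_exp]
  simp

theorem integrable_cexp_neg_mul {a : ℂ} (ha : 0 < a.re) {h : ℝ → ℂ} (hm : Measurable h) {M : ℝ}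
    (hM : ∀ y, ‖h y‖ ≤ M) : Integrable (fun y : ℝ => Complex.exp (-a * y) * h y) halfLine := by
  refine ((integrable_halfLine_exp_neg ha).mul_const M).mono' ?_
    (Filter.Eventually.of_forall fun y => ?_)
  · exact ((by fun_prop : Continuous fun y : ℝ => Complex.exp (-a * y)).measurable.mul
      hm).aestronglyMeasurable
  · rw [norm_mul, norm_cexp_neg_mul]
    gcongr
    exact hM y

theorem integral_halfLine_cexp_neg {a : ℂ} (ha : 0 < a.re) :
    ∫ w, a * Complex.exp (-a * w) ∂halfLine = 1 := by
  have h0 : a ≠ 0 := by rintro rfl; simp at ha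
  rw [integral_const_mul]
  have := integral_exp_mul_complex_Ioi (a := -a) (by simpa using ha) 0
  rw [this]
  simp [h0]

theorem integral_halfLine_prod_kernel {a : ℂ} (ha : 0 < a.re) {h : ℝ → ℂ} (hm : Measurable h)
    {M : ℝ} (hM : ∀ y, ‖h y‖ ≤ M) {t : ℝ} (ht : 0 < t) :
    ∫ y : ℝ × ℝ, ((t ^ 2 * (1 + y.1) : ℝ) : ℂ) *
      (a * Complex.exp (-a * (t * (1 + y.1) * (1 + y.2) : ℝ)) * h (t * y.1))
        ∂(halfLine.prod halfLine) = Complex.exp (-a * t) * laplaceInt a h := by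
  have hM0 : 0 ≤ M := (norm_nonneg _).trans (hM 0)
  rw [integral_prod]
  · have e1 : ∀ u : ℝ, 0 < u → ∫ w, ((t ^ 2 * (1 + u) : ℝ) : ℂ) *
        (a * Complex.exp (-a * (t * (1 + u) * (1 + w) : ℝ)) * h (t * u)) ∂halfLine =
        t * (Complex.exp (-a * t) * (Complex.exp (-a * (t * u : ℝ)) * h (t * u))) := by
      intro u hu
      have hT : 0 < (a * (t * (1 + u) : ℝ)).re := by
        rw [Complex.re_mul_ofReal]; positivity
      have h1 := integral_halfLine_cexp_neg hT
      calc _ = ∫ w : ℝ, (t * (Complex.exp (-a * t) * (Complex.exp (-a * (t * u : ℝ)) * h (t * u)))) *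
            ((a * (t * (1 + u) : ℝ)) * Complex.exp (-(a * (t * (1 + u) : ℝ)) * w)) ∂halfLine := by
            congr 1 with w
            have : Complex.exp (-a * (t * (1 + u) * (1 + w) : ℝ)) = Complex.exp (-a * t) *
                Complex.exp (-a * (t * u : ℝ)) * Complex.exp (-(a * (t * (1 + u) : ℝ)) * w) := by
              rw [← Complex.exp_add, ← Complex.exp_add]
              congr 1
              push_cast
              ring
            rw [this]
            push_cast
            ring
        _ = _ := by rw [integral_const_mul, h1, mul_one]
    rw [setIntegral_congr_fun measurableSet_Ioi (fun u hu => e1 u hu), integral_const_mul,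
      integral_const_mul]
    have h2 := integral_comp_mul_left_Ioi (fun y : ℝ => Complex.exp (-a * y) * h y) 0 ht
    rw [h2, mul_zero, laplaceInt, Complex.real_smul]
    have : (t : ℂ) ≠ 0 := by exact_mod_cast ht.ne'
    push_cast
    field_simp
  · have hθ : 0 < a.re * t := by positivity
    refine ((integrable_halfLine_prod_exp hθ).const_mul (t ^ 2 * (‖a‖ * M))).mono'
      (Measurable.aestronglyMeasurable ?_) (ae_halfLine_prod.mono fun y hy => ?_)
    · refine Measurable.mul (by fun_prop) (Measurable.mul (Continuous.measurable (by fun_prop)) ?_)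
      exact hm.comp (by fun_prop)
    · obtain ⟨hu, hw⟩ := hy
      rw [norm_mul, norm_mul, norm_mul, norm_cexp_neg_mul, Complex.norm_real,
        norm_of_nonneg (by positivity)]
      have e2 : rexp (-(a.re * (t * (1 + y.1) * (1 + y.2)))) ≤
          rexp (-(a.re * t * y.1)) * rexp (-(a.re * t * y.2)) := by
        rw [← exp_add]
        apply exp_le_exp.2
        nlinarith [mul_pos hθ (mul_pos hu hw)]
      calc _ ≤ t ^ 2 * (1 + y.1) * (‖a‖ * (rexp (-(a.re * t * y.1)) * rexp (-(a.re * t * y.2))) *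
            M) := by
            gcongr
            exact hM _
        _ = _ := by ring

theorem laplaceInt_deriv {a : ℂ} (ha : 0 < a.re) {h h' : ℝ → ℂ} (hm : Measurable h')
    (hd : ∀ y, HasDerivAt h (h' y) y) {M : ℝ} (hM : ∀ y, ‖h y‖ ≤ M) (hM' : ∀ y, ‖h' y‖ ≤ M) :
    a * laplaceInt a h - laplaceInt a h' = h 0 := by
  have hcont : Continuous h := continuous_iff_continuousAt.2 fun y => (hd y).continuousAt
  have i1 := integrable_cexp_neg_mul ha hcont.measurable hM
  have i2 := integrable_cexp_neg_mul ha hm hM'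
  rw [laplaceInt, laplaceInt, ← integral_const_mul, ← integral_sub (i1.const_mul a) i2]
  have hlim : Filter.Tendsto (fun y : ℝ => -(Complex.exp (-a * y) * h y)) Filter.atTop (nhds 0) := by
    rw [← neg_zero]
    refine Filter.Tendsto.neg ?_
    rw [tendsto_zero_iff_norm_tendsto_zero]
    refine squeeze_zero (fun y => norm_nonneg _) (fun y => ?_) (tendsto_exp_neg_mul_atTop ha M)
    rw [norm_mul, norm_cexp_neg_mul, mul_comm]
    gcongr
    exact hM y
  have := integral_Ioi_of_hasDerivAt_of_tendsto (a := 0)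
    (f := fun y : ℝ => -(Complex.exp (-a * y) * h y))
    (f' := fun y : ℝ => a * (Complex.exp (-a * y) * h y) - Complex.exp (-a * y) * h' y)
    (by
      have : Continuous fun y : ℝ => -(Complex.exp (-a * y) * h y) := by fun_prop
      exact this.continuousWithinAt)
    (fun y _ => by
      have h1 : HasDerivAt (fun y : ℝ => Complex.exp (-a * y)) (Complex.exp (-a * y) * (-a)) y := by
        have := ((hasDerivAt_id (y : ℂ)).const_mul (-a)).cexp.comp_ofReal
        simpa using this
      refine (h1.mul (hd y)).neg.congr_deriv ?_
      ring)
    ((i1.const_mul a).sub i2) hlim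
  rw [this]
  simp

section Superposition

variable {E : Type*} [NormedAddCommGroup E] [InnerProductSpace ℝ E] [FiniteDimensional ℝ E]
  [MeasurableSpace E] [BorelSpace E]

/-- Measurable functions on `E × ℝ` decaying in the first variable so fast that they have an
integrable first moment, uniformly in the second variable. -/
def HasSliceDecay (g : E × ℝ → ℂ) : Prop :=
  Measurable g ∧ ∃ M : ℝ, 0 ≤ M ∧
    ∀ p, ‖g p‖ ≤ M * (1 + ‖p.1‖) ^ (-((Module.finrank ℝ E + 2 : ℕ) : ℝ))

namespace HasSliceDecay

variable {g : E × ℝ → ℂ}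

theorem integrable_smul (h : HasSliceDecay g) (y : ℝ) : Integrable fun z => ‖z‖ • g (z, y) := by
  obtain ⟨hm, M, hM0, hM⟩ := h
  have h1 := (integrable_one_add_norm (E := E) (μ := volume)
    (r := ((Module.finrank ℝ E + 1 : ℕ) : ℝ)) (by push_cast; linarith)).const_mul M
  refine h1.mono' (Measurable.aestronglyMeasurable ?_) (Filter.Eventually.of_forall fun z => ?_)
  · exact measurable_norm.smul (hm.comp (by fun_prop))
  · rw [norm_smul, norm_norm]
    have h0 : 0 < 1 + ‖z‖ := by positivity
    have h2 : (1 + ‖z‖) ^ (-((Module.finrank ℝ E + 1 : ℕ) : ℝ)) =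
        (1 + ‖z‖) * (1 + ‖z‖) ^ (-((Module.finrank ℝ E + 2 : ℕ) : ℝ)) := by
      rw [← rpow_one_add' h0.le]
      · congr 1; push_cast; ring
      · push_cast; intro h; have : (0 : ℝ) ≤ Module.finrank ℝ E := by positivity
        linarith
    rw [h2]
    calc _ ≤ (1 + ‖z‖) * (M * (1 + ‖z‖) ^ (-((Module.finrank ℝ E + 2 : ℕ) : ℝ))) := by
          gcongr
          · linarith
          · exact hM (z, y)
      _ = _ := by ring

theorem integrable_bound (M : ℝ) :
    Integrable fun z : E => M * (1 + ‖z‖) ^ (-((Module.finrank ℝ E + 2 : ℕ) : ℝ)) :=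
  (integrable_one_add_norm (E := E) (μ := volume) (by push_cast; linarith)).const_mul M

theorem integrable (h : HasSliceDecay g) (y : ℝ) : Integrable fun z => g (z, y) := by
  obtain ⟨hm, M, hM0, hM⟩ := h
  exact (integrable_bound M).mono' (hm.comp (by fun_prop)).aestronglyMeasurable
    (Filter.Eventually.of_forall fun z => hM (z, y))

theorem const_mul (h : HasSliceDecay g) (b : ℂ) : HasSliceDecay fun p => b * g p := by
  obtain ⟨hm, M, hM0, hM⟩ := h
  refine ⟨hm.const_mul b, ‖b‖ * M, by positivity, fun p => ?_⟩
  rw [norm_mul, mul_assoc]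
  gcongr
  exact hM p

theorem norm_fourierHat_le (h : HasSliceDecay g) :
    ∃ M : ℝ, 0 ≤ M ∧ ∀ ξ y, ‖fourierHat (fun z => g (z, y)) ξ‖ ≤ M := by
  obtain ⟨hm, M, hM0, hM⟩ := h
  refine ⟨∫ z : E, M * (1 + ‖z‖) ^ (-((Module.finrank ℝ E + 2 : ℕ) : ℝ)),
    integral_nonneg fun z => by positivity, fun ξ y => ?_⟩
  refine norm_integral_le_of_norm_le (integrable_bound M) (Filter.Eventually.of_forall fun z => ?_)
  rw [norm_mul, neg_mul, ← mul_neg, ← Complex.ofReal_neg, norm_exp_I_mul, one_mul]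
  exact hM (z, y)

theorem measurable_fourierHat (h : HasSliceDecay g) :
    Measurable fun p : E × ℝ => fourierHat (fun z => g (z, p.2)) p.1 :=
  measurable_fourierHat_param (β := E × ℝ) (F := fun p z => g (z, p.2))
    (h.1.comp (by fun_prop)) measurable_fst

end HasSliceDecay

theorem IsKernelSymbol.norm_le [Nontrivial E] {c₀ A s τ : ℝ} {φ : E → ℂ}
    (h : IsKernelSymbol c₀ A s τ φ) {ξ : E} (hξ : ξ ≠ 0) :
    ‖φ ξ‖ ≤ A * ((s + ‖ξ‖) ^ 2 * rexp (-(c₀ * τ * (s + ‖ξ‖)))) := by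
  obtain ⟨v, hv⟩ := exists_norm_eq E zero_le_one
  simpa using h.2 ξ hξ v hv 0 (Nat.zero_le _)

/-- The symbol obtained by superposing the symbols `φ τ` against the slices of `g`. -/
noncomputable def superposition (φ : ℝ → E → ℂ) (g : E × ℝ → ℂ) (t : ℝ) (ξ : E) : ℂ :=
  ∫ y : ℝ × ℝ, ((t ^ 2 * (1 + y.1) : ℝ) : ℂ) * (φ (t * (1 + y.1) * (1 + y.2)) ξ *
    fourierHat (fun z => g (z, t * y.1)) ξ) ∂(halfLine.prod halfLine)

variable {c₀ A s : ℝ} {φ : ℝ → E → ℂ} {g : E × ℝ → ℂ} {t : ℝ}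

theorem integrable_superposition_prod [Nontrivial E] (hc₀ : 0 < c₀) (hA : 0 ≤ A) (hs : 0 < s)
    (hφm : Measurable (Function.uncurry φ)) (hφ : ∀ τ, 0 < τ → IsKernelSymbol c₀ A s τ (φ τ))
    (hg : HasSliceDecay g) (ht : 0 < t) :
    Integrable (fun r : E × (ℝ × ℝ) => ((t ^ 2 * (1 + r.2.1) : ℝ) : ℂ) *
      (φ (t * (1 + r.2.1) * (1 + r.2.2)) r.1 * fourierHat (fun z => g (z, t * r.2.1)) r.1))
      ((volume : Measure E).prod (halfLine.prod halfLine)) := by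
  obtain ⟨M, hM0, hM⟩ := hg.norm_fourierHat_le
  have hθ : 0 < c₀ * t * s := by positivity
  have h1 := (integrable_inv_norm_pow_mul_exp' (E := E) (m := 0) Module.finrank_pos
    (half_pos hc₀) ht).mul_prod (integrable_halfLine_prod_exp hθ)
  refine (h1.const_mul (t ^ 2 * (2 * A * ((c₀ / 2 * t) ^ 2)⁻¹) * M)).mono'
    (Measurable.aestronglyMeasurable ?_) ?_
  · refine Measurable.mul (by fun_prop) (Measurable.mul ?_ ?_)
    · exact hφm.comp (f := fun r : E × (ℝ × ℝ) => (t * (1 + r.2.1) * (1 + r.2.2), r.1))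
        (by fun_prop)
    · exact hg.measurable_fourierHat.comp (f := fun r : E × (ℝ × ℝ) => (r.1, t * r.2.1))
        (by fun_prop)
  · have hne : ∀ᵐ ξ : E, ξ ≠ 0 := by simp [ae_iff]
    filter_upwards [Measure.quasiMeasurePreserving_fst.ae hne,
      Measure.quasiMeasurePreserving_snd.ae ae_halfLine_prod] with r hr hy
    obtain ⟨ξ, u, w⟩ := r
    obtain ⟨hu, hw⟩ : 0 < u ∧ 0 < w := hy
    replace hr : ξ ≠ 0 := hr
    have hτ : 0 < t * (1 + u) * (1 + w) := by positivity
    have hS : 0 < s + ‖ξ‖ := by positivity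
    have b1 := (hφ _ hτ).norm_le hr
    have b2 : rexp (-(c₀ * (t * (1 + u) * (1 + w)) * (s + ‖ξ‖))) ≤
        rexp (-(c₀ / 2 * t * (s + ‖ξ‖))) * rexp (-(c₀ / 2 * t * ‖ξ‖)) *
          (rexp (-(c₀ * t * s * u)) * rexp (-(c₀ * t * s * w))) := by
      rw [← exp_add, ← exp_add, ← exp_add]
      apply exp_le_exp.2
      have p1 : 0 < c₀ * t * s * (u * w) := by positivity
      have p2 : 0 ≤ c₀ * t * ‖ξ‖ * (u * w) := by positivity
      have p3 : 0 ≤ c₀ * t * ‖ξ‖ * u := by positivity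
      have p4 : 0 ≤ c₀ * t * ‖ξ‖ * w := by positivity
      nlinarith
    have b3 := sq_mul_exp_neg_le (θ := c₀ / 2 * t) (by positivity) hS.le
    simp only
    rw [norm_mul, norm_mul, Complex.norm_real, norm_of_nonneg (by positivity), pow_zero, inv_one,
      one_mul]
    calc _ ≤ t ^ 2 * (1 + u) * ((A * ((s + ‖ξ‖) ^ 2 *
          (rexp (-(c₀ / 2 * t * (s + ‖ξ‖))) * rexp (-(c₀ / 2 * t * ‖ξ‖)) *
          (rexp (-(c₀ * t * s * u)) * rexp (-(c₀ * t * s * w)))))) * M) := by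
          gcongr
          · refine b1.trans ?_
            gcongr
          · exact hM _ _
      _ = t ^ 2 * (1 + u) * ((A * ((s + ‖ξ‖) ^ 2 * rexp (-(c₀ / 2 * t * (s + ‖ξ‖)))) *
          rexp (-(c₀ / 2 * t * ‖ξ‖)) *
          (rexp (-(c₀ * t * s * u)) * rexp (-(c₀ * t * s * w)))) * M) := by ring
      _ ≤ t ^ 2 * (1 + u) * ((A * (2 * ((c₀ / 2 * t) ^ 2)⁻¹) *
          rexp (-(c₀ / 2 * t * ‖ξ‖)) *
          (rexp (-(c₀ * t * s * u)) * rexp (-(c₀ * t * s * w)))) * M) := by gcongr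
      _ = _ := by ring

theorem integrable_superposition [Nontrivial E] (hc₀ : 0 < c₀) (hA : 0 ≤ A) (hs : 0 < s)
    (hφm : Measurable (Function.uncurry φ)) (hφ : ∀ τ, 0 < τ → IsKernelSymbol c₀ A s τ (φ τ))
    (hg : HasSliceDecay g) (ht : 0 < t) : Integrable (superposition φ g t) :=
  (integrable_superposition_prod hc₀ hA hs hφm hφ hg ht).integral_prod_left

theorem enorm_fourierInt_superposition_le [Nontrivial E] (hc₀ : 0 < c₀) (hA : 0 ≤ A) (hs : 0 < s)
    (hφm : Measurable (Function.uncurry φ)) (hφ : ∀ τ, 0 < τ → IsKernelSymbol c₀ A s τ (φ τ))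
    (hg : HasSliceDecay g) (ht : 0 < t) (x : E) :
    ‖fourierInt (superposition φ g t) x‖ₑ ≤
      ∫⁻ y, majorantKernel φ g (x, t) y ∂(halfLine.prod halfLine) := by
  have hI := integrable_superposition_prod hc₀ hA hs hφm hφ hg ht
  have e : fourierInt (superposition φ g t) x = ∫ y : ℝ × ℝ, ((t ^ 2 * (1 + y.1) : ℝ) : ℂ) *
      fourierInt (fun ξ => φ (t * (1 + y.1) * (1 + y.2)) ξ *
        fourierHat (fun z => g (z, t * y.1)) ξ) x ∂(halfLine.prod halfLine) := by
    simp_rw [fourierInt, superposition, ← integral_const_mul]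
    rw [integral_integral_swap]
    · congr 1 with y
      congr 1 with ξ
      ring
    · refine hI.norm.mono' (AEStronglyMeasurable.mul ?_ hI.aestronglyMeasurable)
        (Filter.Eventually.of_forall fun r => ?_)
      · exact ((continuous_exp_I_inner x).comp continuous_fst).aestronglyMeasurable
      · simp only [Function.uncurry]
        rw [norm_mul, norm_exp_I_mul, one_mul]
  rw [e]
  refine (enorm_integral_le_lintegral_enorm _).trans_eq (lintegral_congr_ae ?_)
  filter_upwards [ae_halfLine_prod] with y hy
  have := hy.1
  rw [majorantKernel, enorm_mul, ← ofReal_norm, Complex.norm_real,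
    norm_of_nonneg (by positivity)]

end Superposition

section Schwartz

variable {E : Type*} [NormedAddCommGroup E] [InnerProductSpace ℝ E] [FiniteDimensional ℝ E]
  [MeasurableSpace E] [BorelSpace E]

theorem SchwartzMap.exists_norm_iteratedFDeriv_le (f : SchwartzMap (E × ℝ) ℂ) (n : ℕ) :
    ∃ M : ℝ, 0 ≤ M ∧ ∀ p : E × ℝ, ‖iteratedFDeriv ℝ n f p‖ ≤
      M * (1 + ‖p.1‖) ^ (-((Module.finrank ℝ E + 2 : ℕ) : ℝ)) := by
  set m := Module.finrank ℝ E + 2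
  have h := SchwartzMap.one_add_le_sup_seminorm_apply (𝕜 := ℝ) (m := (m, n)) le_rfl le_rfl f
  refine ⟨_, (by positivity : (0 : ℝ) ≤ (1 + ‖(0 : E × ℝ)‖) ^ m * ‖iteratedFDeriv ℝ n f 0‖).trans
    (h 0), fun p => ?_⟩
  have hp : 0 < 1 + ‖p.1‖ := by positivity
  rw [rpow_neg hp.le, rpow_natCast, ← div_eq_mul_inv, le_div_iff₀ (by positivity), mul_comm]
  refine le_trans ?_ (h p)
  gcongr
  exact norm_fst_le p

theorem SchwartzMap.hasSliceDecay (f : SchwartzMap (E × ℝ) ℂ) : HasSliceDecay fun p => f p := by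
  obtain ⟨M, hM0, hM⟩ := f.exists_norm_iteratedFDeriv_le 0
  exact ⟨f.continuous.measurable, M, hM0, fun p => by simpa using hM p⟩

theorem SchwartzMap.hasSliceDecay_fderiv (f : SchwartzMap (E × ℝ) ℂ) (v : E × ℝ) :
    HasSliceDecay fun p => fderiv ℝ (fun p' => f p') p v := by
  obtain ⟨M, hM0, hM⟩ := f.exists_norm_iteratedFDeriv_le 1
  have hc : Continuous (fderiv ℝ fun p' => f p') :=
    (f.smooth 1).continuous_fderiv one_ne_zero
  refine ⟨(hc.clm_apply continuous_const).measurable, M * ‖v‖, by positivity, fun p => ?_⟩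
  have h := hM p
  rw [norm_iteratedFDeriv_one] at h
  calc _ ≤ ‖fderiv ℝ (fun p' => f p') p‖ * ‖v‖ := ContinuousLinearMap.le_opNorm _ _
    _ ≤ (M * (1 + ‖p.1‖) ^ (-((Module.finrank ℝ E + 2 : ℕ) : ℝ))) * ‖v‖ := by
        gcongr
    _ = _ := by ring

theorem continuous_exp_neg_I_inner (ξ : E) :
    Continuous fun z : E => Complex.exp (-Complex.I * (⟪z, ξ⟫ : ℂ)) := by fun_prop

theorem norm_exp_neg_I_mul (r : ℝ) : ‖Complex.exp (-Complex.I * r)‖ = 1 := by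
  rw [neg_mul, ← mul_neg, ← Complex.ofReal_neg, norm_exp_I_mul]

theorem integrable_exp_neg_I_inner_mul {h : E → ℂ} (hh : Integrable h) (ξ : E) :
    Integrable fun z : E => Complex.exp (-Complex.I * (⟪z, ξ⟫ : ℂ)) * h z :=
  hh.bdd_mul (c := 1) (continuous_exp_neg_I_inner ξ).aestronglyMeasurable
    (Filter.Eventually.of_forall fun z => (norm_exp_neg_I_mul _).le)

theorem SchwartzMap.hasFDerivAt_coe (f : SchwartzMap (E × ℝ) ℂ) (p : E × ℝ) :
    HasFDerivAt (fun p' => f p') (fderiv ℝ (fun p' => f p') p) p :=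
  (f.differentiableAt (x := p)).hasFDerivAt

theorem SchwartzMap.fourierHat_fderiv_fst (f : SchwartzMap (E × ℝ) ℂ) (e ξ : E) (y : ℝ) :
    fourierHat (fun z => fderiv ℝ (fun p' => f p') (z, y) (e, 0)) ξ =
      Complex.I * (⟪ξ, e⟫ : ℂ) * fourierHat (fun z => f (z, y)) ξ := by
  have hi := f.hasSliceDecay.integrable y
  have hi' := (f.hasSliceDecay_fderiv (e, 0)).integrable y
  have key := integral_bilinear_hasLineDerivAt_right_eq_neg_left_of_integrable
    (μ := (volume : Measure E)) (v := e) (B := ContinuousLinearMap.mul ℝ ℂ)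
    (f := fun z : E => Complex.exp (-Complex.I * (⟪z, ξ⟫ : ℂ)))
    (f' := fun z : E => -(Complex.I * (⟪ξ, e⟫ : ℂ)) * Complex.exp (-Complex.I * (⟪z, ξ⟫ : ℂ)))
    (g := fun z => f (z, y)) (g' := fun z => fderiv ℝ (fun p' => f p') (z, y) (e, 0))
    (by
      simp only [ContinuousLinearMap.mul_apply', mul_assoc]
      exact (integrable_exp_neg_I_inner_mul hi ξ).const_mul _)
    (integrable_exp_neg_I_inner_mul hi' ξ) (integrable_exp_neg_I_inner_mul hi ξ)
    (fun z _ => by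
      rw [HasLineDerivAt]
      have h1 : HasDerivAt (fun t : ℝ => ((⟪z + t • e, ξ⟫ : ℝ) : ℂ)) ((⟪e, ξ⟫ : ℝ) : ℂ) 0 := by
        refine HasDerivAt.ofReal_comp ?_
        simp_rw [inner_add_left, inner_smul_left]
        simpa using ((hasDerivAt_id (0 : ℝ)).mul_const ⟪e, ξ⟫).const_add ⟪z, ξ⟫
      refine (h1.const_mul (-Complex.I)).cexp.congr_deriv ?_
      rw [zero_smul, add_zero, real_inner_comm ξ e]
      ring)
    (fun z _ => by
      rw [HasLineDerivAt]
      have h1 : HasDerivAt (fun t : ℝ => ((z + t • e, y) : E × ℝ)) (e, 0) 0 := by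
        refine HasDerivAt.prodMk ?_ (hasDerivAt_const _ _)
        simpa using ((hasDerivAt_id (0 : ℝ)).smul_const e).const_add z
      have h2 : HasFDerivAt (fun p' => f p') (fderiv ℝ (fun p' => f p') (z, y))
          ((z + (0 : ℝ) • e, y) : E × ℝ) := by
        rw [zero_smul, add_zero]
        exact f.hasFDerivAt_coe (z, y)
      exact h2.comp_hasDerivAt (0 : ℝ) h1)
  simp only [ContinuousLinearMap.mul_apply', mul_assoc] at key
  rw [integral_const_mul] at key
  rw [fourierHat, fourierHat, key]
  ring

theorem SchwartzMap.hasDerivAt_fourierHat (f : SchwartzMap (E × ℝ) ℂ) (ξ : E) (y : ℝ) :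
    HasDerivAt (fun y => fourierHat (fun z => f (z, y)) ξ)
      (fourierHat (fun z => fderiv ℝ (fun p' => f p') (z, y) (0, 1)) ξ) y := by
  obtain ⟨M, hM0, hM⟩ := (f.hasSliceDecay_fderiv (0, 1)).2
  refine (hasDerivAt_integral_of_dominated_loc_of_deriv_le (μ := (volume : Measure E))
    (s := Set.univ)
    (F := fun (y : ℝ) (z : E) => Complex.exp (-Complex.I * (⟪z, ξ⟫ : ℂ)) * f (z, y))
    (F' := fun (y : ℝ) (z : E) => Complex.exp (-Complex.I * (⟪z, ξ⟫ : ℂ)) *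
      fderiv ℝ (fun p' => f p') (z, y) (0, 1))
    Filter.univ_mem (Filter.Eventually.of_forall fun y => ?_)
    (integrable_exp_neg_I_inner_mul (f.hasSliceDecay.integrable y) ξ)
    (integrable_exp_neg_I_inner_mul ((f.hasSliceDecay_fderiv (0, 1)).integrable y)
      ξ).aestronglyMeasurable
    (Filter.Eventually.of_forall fun z y _ => ?_) (HasSliceDecay.integrable_bound M)
    (Filter.Eventually.of_forall fun z y _ => ?_)).2
  · exact (integrable_exp_neg_I_inner_mul (f.hasSliceDecay.integrable y) ξ).aestronglyMeasurable
  · rw [norm_mul, norm_exp_neg_I_mul, one_mul]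
    exact hM (z, y)
  · have h1 : HasDerivAt (fun t : ℝ => ((z, t) : E × ℝ)) (0, 1) y :=
      (hasDerivAt_const _ _).prodMk (hasDerivAt_id _)
    exact ((f.hasFDerivAt_coe (z, y)).comp_hasDerivAt y h1).const_mul _

theorem SchwartzMap.laplaceInt_fourierHat (f : SchwartzMap (E × ℝ) ℂ) {a : ℂ} (ha : 0 < a.re)
    (ξ : E) :
    a * laplaceInt a (fun y => fourierHat (fun z => f (z, y)) ξ) -
      laplaceInt a (fun y => fourierHat (fun z => fderiv ℝ (fun p' => f p') (z, y) (0, 1)) ξ) =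
      fourierHat (fun z => f (z, 0)) ξ := by
  obtain ⟨M₁, -, h₁⟩ := f.hasSliceDecay.norm_fourierHat_le
  obtain ⟨M₂, -, h₂⟩ := (f.hasSliceDecay_fderiv (0, 1)).norm_fourierHat_le
  exact laplaceInt_deriv (h := fun y => fourierHat (fun z => f (z, y)) ξ) ha
    ((f.hasSliceDecay_fderiv (0, 1)).measurable_fourierHat.comp (f := fun y : ℝ => (ξ, y))
      (by fun_prop))
    (f.hasDerivAt_fourierHat ξ) (M := max M₁ M₂) (fun y => (h₁ ξ y).trans (le_max_left _ _))
    (fun y => (h₂ ξ y).trans (le_max_right _ _))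

theorem SchwartzMap.laplaceInt_fourierHat_fderiv_fst (f : SchwartzMap (E × ℝ) ℂ) (a : ℂ)
    (e ξ : E) :
    laplaceInt a (fun y => fourierHat (fun z => fderiv ℝ (fun p' => f p') (z, y) (e, 0)) ξ) =
      Complex.I * (⟪ξ, e⟫ : ℂ) * laplaceInt a (fun y => fourierHat (fun z => f (z, y)) ξ) := by
  simp_rw [f.fourierHat_fderiv_fst]
  rw [laplaceInt, laplaceInt, ← integral_const_mul]
  congr 1 with y
  ring

theorem laplaceInt_fourierHat_const_mul (a b : ℂ) (g : E × ℝ → ℂ) (ξ : E) :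
    laplaceInt a (fun y => fourierHat (fun z => b * g (z, y)) ξ) =
      b * laplaceInt a (fun y => fourierHat (fun z => g (z, y)) ξ) := by
  rw [laplaceInt, laplaceInt, ← integral_const_mul]
  congr 1 with y
  rw [fourierHat, fourierHat, ← integral_const_mul, ← integral_const_mul, ← integral_const_mul]
  congr 1 with z
  ring

end Schwartz

section Poisson

variable {E : Type*} [NormedAddCommGroup E] [InnerProductSpace ℝ E] [FiniteDimensional ℝ E]
  [MeasurableSpace E] [BorelSpace E]

theorem ae_prod_halfLine : ∀ᵐ p ∂((volume : Measure E).prod halfLine), 0 < p.2 :=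
  Measure.quasiMeasurePreserving_snd.ae (p := fun t : ℝ => 0 < t)
    ((ae_restrict_iff' measurableSet_Ioi).2 (Filter.Eventually.of_forall fun _ ht => ht))

theorem lintegral_fourierInt_sum_superposition_le [Nontrivial E] {q : ℝ} (hq : 1 < q)
    {c₀ A s : ℝ} (hc₀ : 0 < c₀) (hA : 0 ≤ A) (hs : 0 < s) {ι : Type*} [Fintype ι]
    {c : ι → ℂ} {Φ : ι → ℝ → E → ℂ} {g : ι → E × ℝ → ℂ}
    (hm : ∀ i, Measurable (Function.uncurry (Φ i)))
    (hΦ : ∀ i τ, 0 < τ → IsKernelSymbol c₀ A s τ (Φ i τ)) (hg : ∀ i, HasSliceDecay (g i))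
    {C b : ℝ≥0∞}
    (hC : ∀ i, ∫⁻ p, (∫⁻ y, majorantKernel (Φ i) (g i) p y ∂(halfLine.prod halfLine)) ^ q
      ∂((volume : Measure E).prod halfLine) ≤ C)
    (hb : ∀ i, ‖c i‖ₑ ≤ b) {Ψ : ℝ → E → ℂ}
    (hΨ : ∀ t, 0 < t → ∀ᵐ ξ, Ψ t ξ = ∑ i, c i * superposition (Φ i) (g i) t ξ) :
    ∫⁻ p, ‖fourierInt (Ψ p.2) p.1‖ₑ ^ q ∂((volume : Measure E).prod halfLine) ≤
      (Fintype.card ι : ℝ≥0∞) ^ q * (b ^ q * C) := by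
  have hq0 : 0 < q := by linarith
  set V : ι → E × ℝ → ℝ≥0∞ := fun i p =>
    ∫⁻ y, majorantKernel (Φ i) (g i) p y ∂(halfLine.prod halfLine) with hV
  have hVm : ∀ i, Measurable (V i) := fun i =>
    (measurable_majorantKernel (hm i) (hg i).1).lintegral_prod_right'
  have hpt : ∀ p : E × ℝ, 0 < p.2 → ‖fourierInt (Ψ p.2) p.1‖ₑ ^ q ≤
      (Fintype.card ι : ℝ≥0∞) ^ (q - 1) * ∑ i, b ^ q * V i p ^ q := by
    rintro ⟨x, t⟩ ht
    replace ht : 0 < t := ht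
    have e : fourierInt (Ψ t) x = ∑ i, c i * fourierInt (superposition (Φ i) (g i) t) x := by
      have : fourierInt (Ψ t) x = ∫ ξ, ∑ i, c i * (Complex.exp (Complex.I * (⟪x, ξ⟫ : ℂ)) *
          superposition (Φ i) (g i) t ξ) := by
        refine integral_congr_ae ((hΨ t ht).mono fun ξ hξ => ?_)
        simp only
        rw [hξ, Finset.mul_sum]
        refine Finset.sum_congr rfl fun i _ => ?_
        ring
      rw [this, integral_finsetSum]
      · simp_rw [integral_const_mul]
        rfl
      · intro i _
        exact (integrable_exp_I_inner_mul
          (integrable_superposition hc₀ hA hs (hm i) (hΦ i) (hg i) ht) x).const_mul _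
    calc _ ≤ (∑ i, b * V i (x, t)) ^ q := by
          gcongr
          simp only
          rw [e]
          refine (enorm_sum_le _ _).trans (Finset.sum_le_sum fun i _ => ?_)
          rw [enorm_mul]
          gcongr
          · exact hb i
          · exact enorm_fourierInt_superposition_le hc₀ hA hs (hm i) (hΦ i) (hg i) ht x
      _ ≤ _ := ENNReal.rpow_sum_le_const_mul_sum_rpow _ _ hq.le
      _ = _ := by
        simp_rw [ENNReal.mul_rpow_of_nonneg _ _ hq0.le]
        rfl
  calc _ ≤ ∫⁻ p, (Fintype.card ι : ℝ≥0∞) ^ (q - 1) * ∑ i, b ^ q * V i p ^ q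
          ∂((volume : Measure E).prod halfLine) := lintegral_mono_ae (ae_prod_halfLine.mono hpt)
    _ = (Fintype.card ι : ℝ≥0∞) ^ (q - 1) * ∑ i, b ^ q * ∫⁻ p, V i p ^ q
          ∂((volume : Measure E).prod halfLine) := by
        have h1 : ∀ i, Measurable fun p => b ^ q * V i p ^ q := fun i =>
          ((hVm i).pow_const q).const_mul _
        rw [lintegral_const_mul _ (Finset.measurable_sum _ fun i _ => h1 i),
          lintegral_finsetSum _ fun i _ => h1 i]
        simp_rw [lintegral_const_mul _ ((hVm _).pow_const q)]
    _ ≤ (Fintype.card ι : ℝ≥0∞) ^ (q - 1) * ∑ _i : ι, b ^ q * C := by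
        gcongr with i
        exact hC i
    _ = _ := by
        rw [Finset.sum_const, Finset.card_univ, nsmul_eq_mul, ← mul_assoc]
        congr 1
        rcases Nat.eq_zero_or_pos (Fintype.card ι) with h | h
        · rw [h, Nat.cast_zero, mul_zero, ENNReal.zero_rpow_of_pos hq0]
        · have h0 : (Fintype.card ι : ℝ≥0∞) ≠ 0 := by exact_mod_cast h.ne'
          nth_rewrite 2 [← ENNReal.rpow_one (Fintype.card ι : ℝ≥0∞)]
          rw [← ENNReal.rpow_add _ _ h0 (ENNReal.natCast_ne_top _)]
          congr 1
          ring

theorem superposition_eq {k a B : E → ℂ} {g : E × ℝ → ℂ} (hg : HasSliceDecay g) {ξ : E}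
    (ha : 0 < (a ξ).re) {t : ℝ} (ht : 0 < t) :
    superposition (fun (τ : ℝ) ξ => k ξ * (a ξ * B ξ * Complex.exp (-a ξ * τ))) g t ξ =
      k ξ * B ξ * Complex.exp (-a ξ * t) *
        laplaceInt (a ξ) (fun y => fourierHat (fun z => g (z, y)) ξ) := by
  obtain ⟨M, -, hM⟩ := hg.norm_fourierHat_le
  have key := integral_halfLine_prod_kernel ha
    (h := fun y => fourierHat (fun z => g (z, y)) ξ)
    (hg.measurable_fourierHat.comp (f := fun y : ℝ => (ξ, y)) (by fun_prop)) (hM ξ) ht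
  rw [mul_assoc, ← key, superposition, ← integral_const_mul]
  congr 1 with y
  ring

theorem IsFirstOrder.continuous {s : ℝ} {a B : E → ℂ} (ha : Continuous a)
    (h : IsFirstOrder s a B) : Continuous B := by
  rcases h with rfl | rfl | ⟨e, -, rfl⟩
  · exact ha
  · exact continuous_const
  · fun_prop

theorem exists_lintegral_poisson_le {q : ℝ} (hq : 1 < q) {σ ρ c : ℝ} (hσ : σ ∈ Set.Ioo 0 (π / 2))
    (hρ : 0 < ρ) (hc : 0 < c) (hd : 1 ≤ Module.finrank ℝ E) :
    ∃ C : ℝ≥0∞, C ≠ ∞ ∧ ∀ lam : ℂ, lam ≠ 0 → |lam.arg| < π - σ → ∀ s : ℝ, 0 < s →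
      s ^ 2 = ‖lam‖ → ∀ k : E → ℂ, ContDiffOn ℝ (⊤ : ℕ∞) k {0}ᶜ →
      (∀ ξ : E, ξ ≠ 0 → ∀ n ≤ Module.finrank ℝ E + 1,
        ‖iteratedFDeriv ℝ n k ξ‖ ≤ c * ((s + ‖ξ‖) ^ n)⁻¹) →
      ∀ Q : E → ℂ, IsFirstOrder s (sqrtSymbol ρ lam) Q → ∀ f : SchwartzMap (E × ℝ) ℂ,
      ∫⁻ p, ‖fourierInt (fun ξ => k ξ * Q ξ * Complex.exp (-sqrtSymbol ρ lam ξ * p.2) *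
          fourierHat (fun z => f (z, 0)) ξ) p.1‖ₑ ^ q ∂((volume : Measure E).prod halfLine) ≤
        C * ∫⁻ p, ((ENNReal.ofReal s * ‖f p‖ₑ) ^ q + ‖fderiv ℝ (fun p' => f p') p‖ₑ ^ q)
          ∂((volume : Measure E).prod halfLine) := by
  have : Nontrivial E := Module.nontrivial_of_finrank_pos (R := ℝ) (by omega)
  have hq0 : 0 < q := by linarith
  obtain ⟨c₀, A, hc₀, hA, H⟩ := exists_symbol_bounds (E := E) hσ hρ hc (Module.finrank ℝ E + 1)
  obtain ⟨C, hC, HM⟩ := exists_lintegral_majorant_le (E := E) hq hc₀ hd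
  set D : ℝ≥0∞ := ((Module.finrank ℝ E + 2 : ℕ) : ℝ≥0∞) ^ q *
    (ENNReal.ofReal (1 + ρ) ^ q * (C * ENNReal.ofReal A ^ q)) with hD
  refine ⟨D, ?_, ?_⟩
  · have h1 : ∀ r : ℝ, ENNReal.ofReal r ^ q ≠ ∞ := fun r =>
      ENNReal.rpow_ne_top_of_nonneg hq0.le ENNReal.ofReal_ne_top
    exact ENNReal.mul_ne_top (ENNReal.rpow_ne_top_of_nonneg hq0.le (ENNReal.natCast_ne_top _))
      (ENNReal.mul_ne_top (h1 _) (ENNReal.mul_ne_top hC (h1 _)))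
  intro lam hlam harg s hs hsl k hk hkb Q hQ f
  obtain ⟨ha, hare, -, HB⟩ := H lam hlam harg s hs hsl
  set a : E → ℂ := sqrtSymbol ρ lam with had
  set R : ℝ≥0∞ := ∫⁻ p, ((ENNReal.ofReal s * ‖f p‖ₑ) ^ q +
    ‖fderiv ℝ (fun p' => f p') p‖ₑ ^ q) ∂((volume : Measure E).prod halfLine) with hR
  set fam : (E → ℂ) → ℝ → E → ℂ :=
    fun B τ ξ => k ξ * (a ξ * B ξ * Complex.exp (-a ξ * τ)) with hfam
  have hre : ∀ ξ, 0 < (a ξ).re := fun ξ => (by positivity : 0 < c₀ * (s + ‖ξ‖)).trans_le (hare ξ)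
  have hkm : Measurable k := measurable_of_continuousOn_compl_singleton 0 hk.continuousOn
  have hfm : ∀ B, IsFirstOrder s a B → Measurable (Function.uncurry (fam B)) := by
    intro B hB
    have hBc := hB.continuous ha.continuous
    have hac := ha.continuous
    refine (hkm.comp measurable_snd).mul (Continuous.measurable ?_)
    fun_prop
  have hfk : ∀ B, IsFirstOrder s a B → ∀ τ, 0 < τ → IsKernelSymbol c₀ A s τ (fam B τ) :=
    fun B hB τ hτ => HB k hk hkb B hB τ hτ
  have hmaj : ∀ B, IsFirstOrder s a B → ∀ g, HasSliceDecay g →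
      (∀ p, ‖g p‖ₑ ≤ ENNReal.ofReal s * ‖f p‖ₑ ∨ ‖g p‖ₑ ≤ ‖fderiv ℝ (fun p' => f p') p‖ₑ) →
      ∫⁻ p, (∫⁻ y, majorantKernel (fam B) g p y ∂(halfLine.prod halfLine)) ^ q
        ∂((volume : Measure E).prod halfLine) ≤ C * ENNReal.ofReal A ^ q * R := by
    intro B hB g hg hgb
    refine (HM A s (fam B) hA.le hs (hfm B hB) (hfk B hB) g hg.1 hg.integrable
      hg.integrable_smul).trans ?_
    rw [mul_assoc, hR]
    gcongr with p
    rcases hgb p with h | h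
    · exact (ENNReal.rpow_le_rpow h hq0.le).trans le_self_add
    · exact (ENNReal.rpow_le_rpow h hq0.le).trans le_add_self
  set fs : E × ℝ → ℂ := fun p => (s : ℂ) * f p with hfs
  set fd : E × ℝ → E × ℝ → ℂ := fun v p => fderiv ℝ (fun p' => f p') p v with hfd
  have gs : HasSliceDecay fs := f.hasSliceDecay.const_mul s
  have gd : ∀ v, HasSliceDecay (fd v) := f.hasSliceDecay_fderiv
  have ms := fun B hB => hmaj B hB fs gs fun p => Or.inl (by
    rw [hfs, enorm_mul, ← ofReal_norm (s : ℂ), Complex.norm_real, norm_of_nonneg hs.le])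
  have md := fun B hB v (hv : ‖v‖ ≤ 1) => hmaj B hB (fd v) (gd v) fun p => Or.inr (by
    rw [hfd, ← ofReal_norm, ← ofReal_norm]
    refine ENNReal.ofReal_le_ofReal ((ContinuousLinearMap.le_opNorm _ _).trans ?_)
    exact mul_le_of_le_one_right (norm_nonneg _) hv)
  have hN : ‖((0, 1) : E × ℝ)‖ ≤ 1 := by simp [Prod.norm_def]
  have hE : ∀ e : E, ‖e‖ ≤ 1 → ‖((e, 0) : E × ℝ)‖ ≤ 1 := fun e he => by simp [Prod.norm_def, he]
  have fa : IsFirstOrder s a a := Or.inl rfl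
  have fS : IsFirstOrder s a fun _ => (s : ℂ) := Or.inr (Or.inl rfl)
  have fe : ∀ e : E, ‖e‖ ≤ 1 → IsFirstOrder s a fun ξ => Complex.I * (⟪ξ, e⟫ : ℂ) :=
    fun e he => Or.inr (Or.inr ⟨e, he, rfl⟩)
  have one_le : (1 : ℝ≥0∞) ≤ ENNReal.ofReal (1 + ρ) := by
    rw [ENNReal.one_le_ofReal]; linarith
  have volevich : ∀ ξ : E, fourierHat (fun z => f (z, 0)) ξ =
      a ξ * laplaceInt (a ξ) (fun y => fourierHat (fun z => f (z, y)) ξ) -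
        laplaceInt (a ξ) (fun y => fourierHat (fun z => fd (0, 1) (z, y)) ξ) :=
    fun ξ => (f.laplaceInt_fourierHat (hre ξ) ξ).symm
  have Js : ∀ ξ : E, laplaceInt (a ξ) (fun y => fourierHat (fun z => fs (z, y)) ξ) =
      s * laplaceInt (a ξ) (fun y => fourierHat (fun z => f (z, y)) ξ) :=
    fun ξ => laplaceInt_fourierHat_const_mul (a ξ) s (fun p => f p) ξ
  have Je : ∀ e ξ : E, laplaceInt (a ξ) (fun y => fourierHat (fun z => fd (e, 0) (z, y)) ξ) =
      Complex.I * (⟪ξ, e⟫ : ℂ) * laplaceInt (a ξ) (fun y => fourierHat (fun z => f (z, y)) ξ) :=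
    fun e ξ => f.laplaceInt_fourierHat_fderiv_fst (a ξ) e ξ
  have fin : ∀ n : ℕ, n ≤ Module.finrank ℝ E + 2 →
      (n : ℝ≥0∞) ^ q * (ENNReal.ofReal (1 + ρ) ^ q * (C * ENNReal.ofReal A ^ q * R)) ≤ D * R := by
    intro n hn
    calc _ ≤ ((Module.finrank ℝ E + 2 : ℕ) : ℝ≥0∞) ^ q *
          (ENNReal.ofReal (1 + ρ) ^ q * (C * ENNReal.ofReal A ^ q * R)) := by gcongr
      _ = D * R := by rw [hD]; ring
  rcases hQ with rfl | rfl | ⟨e, he, rfl⟩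
  · set b := stdOrthonormalBasis ℝ E
    have hbn : ∀ j, ‖b j‖ ≤ 1 := fun j => (b.orthonormal.1 j).le
    refine (lintegral_fourierInt_sum_superposition_le hq hc₀ hA.le hs
      (ι := Option (Option (Fin (Module.finrank ℝ E))))
      (c := fun i => i.elim (-1) fun i => i.elim ((ρ : ℂ) * lam / (s : ℂ) ^ 2) fun _ => -1)
      (Φ := fun i => i.elim (fam a) fun i => i.elim (fam fun _ => (s : ℂ)) fun j =>
        fam fun ξ => Complex.I * (⟪ξ, b j⟫ : ℂ))
      (g := fun i => i.elim (fd (0, 1)) fun i => i.elim fs fun j => fd (b j, 0))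
      (C := C * ENNReal.ofReal A ^ q * R) (b := ENNReal.ofReal (1 + ρ))
      ?_ ?_ ?_ ?_ ?_ (Ψ := fun t ξ => k ξ * a ξ * Complex.exp (-a ξ * t) *
        fourierHat (fun z => f (z, 0)) ξ) ?_).trans (fin _ (by simp))
    · rintro (_ | _ | j)
      exacts [hfm _ fa, hfm _ fS, hfm _ (fe _ (hbn j))]
    · rintro (_ | _ | j)
      exacts [hfk _ fa, hfk _ fS, hfk _ (fe _ (hbn j))]
    · rintro (_ | _ | j)
      exacts [gd _, gs, gd _]
    · rintro (_ | _ | j)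
      exacts [md _ fa _ hN, ms _ fS, md _ (fe _ (hbn j)) _ (hE _ (hbn j))]
    · rintro (_ | _ | j)
      · simpa using one_le
      · simp only [Option.elim]
        rw [← ofReal_norm]
        apply ENNReal.ofReal_le_ofReal
        rw [norm_div, norm_mul, norm_pow, Complex.norm_real, Complex.norm_real,
          norm_of_nonneg hρ.le, norm_of_nonneg hs.le, hsl,
          mul_div_cancel_right₀ _ (norm_ne_zero_iff.2 hlam)]
        linarith
      · simpa using one_le
    · intro t ht
      refine Filter.Eventually.of_forall fun ξ => ?_
      rw [Fintype.sum_option, Fintype.sum_option]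
      simp only [Option.elim, hfam]
      rw [superposition_eq (gd _) (hre ξ) ht, superposition_eq gs (hre ξ) ht]
      simp_rw [superposition_eq (gd _) (hre ξ) ht, Js, Je, volevich]
      have hsc : (s : ℂ) ≠ 0 := by exact_mod_cast hs.ne'
      have ha2 : a ξ ^ 2 = (ρ : ℂ) * lam + (‖ξ‖ : ℂ) ^ 2 := cpow_half_sq _
      have hsum : ∑ j, (⟪ξ, b j⟫ : ℂ) ^ 2 = (‖ξ‖ : ℂ) ^ 2 := by
        have := b.sum_sq_inner_left ξ
        exact_mod_cast this
      set J := laplaceInt (a ξ) (fun y => fourierHat (fun z => f (z, y)) ξ)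
      set X := Complex.exp (-a ξ * t)
      have e1 : ∑ j, -1 * (k ξ * (Complex.I * (⟪ξ, b j⟫ : ℂ)) * X *
          (Complex.I * (⟪ξ, b j⟫ : ℂ) * J)) = k ξ * X * J * (‖ξ‖ : ℂ) ^ 2 := by
        rw [← hsum, Finset.mul_sum]
        refine Finset.sum_congr rfl fun j _ => ?_
        linear_combination (-(k ξ * (⟪ξ, b j⟫ : ℂ) ^ 2 * X * J)) * Complex.I_sq
      rw [e1]
      have e2 : (ρ : ℂ) * lam / (s : ℂ) ^ 2 * (k ξ * s * X * (s * J)) =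
          k ξ * X * J * ((ρ : ℂ) * lam) := by
        field_simp
      rw [e2]
      linear_combination (k ξ * X * J) * ha2
  · refine (lintegral_fourierInt_sum_superposition_le hq hc₀ hA.le hs (ι := Option Unit)
      (c := fun i => i.elim 1 fun _ => -1)
      (Φ := fun i => i.elim (fam a) fun _ => fam fun _ => (s : ℂ))
      (g := fun i => i.elim fs fun _ => fd (0, 1))
      (C := C * ENNReal.ofReal A ^ q * R) (b := ENNReal.ofReal (1 + ρ))
      ?_ ?_ ?_ ?_ ?_ (Ψ := fun t ξ => k ξ * s * Complex.exp (-a ξ * t) *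
        fourierHat (fun z => f (z, 0)) ξ) ?_).trans (fin _ (by simp))
    · rintro (_ | _)
      exacts [hfm _ fa, hfm _ fS]
    · rintro (_ | _)
      exacts [hfk _ fa, hfk _ fS]
    · rintro (_ | _)
      exacts [gs, gd _]
    · rintro (_ | _)
      exacts [ms _ fa, md _ fS _ hN]
    · rintro (_ | _) <;> simpa using one_le
    · intro t ht
      refine Filter.Eventually.of_forall fun ξ => ?_
      rw [Fintype.sum_option]
      simp only [Option.elim, hfam, Finset.univ_unique, Finset.sum_singleton]
      rw [superposition_eq (gd _) (hre ξ) ht, superposition_eq gs (hre ξ) ht, Js, volevich]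
      ring
  · refine (lintegral_fourierInt_sum_superposition_le hq hc₀ hA.le hs (ι := Option Unit)
      (c := fun i => i.elim 1 fun _ => -1)
      (Φ := fun i => i.elim (fam a) fun _ => fam fun ξ => Complex.I * (⟪ξ, e⟫ : ℂ))
      (g := fun i => i.elim (fd (e, 0)) fun _ => fd (0, 1))
      (C := C * ENNReal.ofReal A ^ q * R) (b := ENNReal.ofReal (1 + ρ))
      ?_ ?_ ?_ ?_ ?_ (Ψ := fun t ξ => k ξ * (Complex.I * (⟪ξ, e⟫ : ℂ)) *
        Complex.exp (-a ξ * t) * fourierHat (fun z => f (z, 0)) ξ) ?_).trans (fin _ (by simp))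
    · rintro (_ | _)
      exacts [hfm _ fa, hfm _ (fe _ he)]
    · rintro (_ | _)
      exacts [hfk _ fa, hfk _ (fe _ he)]
    · rintro (_ | _)
      exacts [gd _, gd _]
    · rintro (_ | _)
      exacts [md _ fa _ (hE _ he), md _ (fe _ he) _ hN]
    · rintro (_ | _) <;> simpa using one_le
    · intro t ht
      refine Filter.Eventually.of_forall fun ξ => ?_
      rw [Fintype.sum_option]
      simp only [Option.elim, hfam, Finset.univ_unique, Finset.sum_singleton]
      rw [superposition_eq (gd _) (hre ξ) ht, superposition_eq (gd _) (hre ξ) ht, Je, volevich]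
      ring

end Poisson

section PoissonDeriv

variable {E : Type*} [NormedAddCommGroup E] [InnerProductSpace ℝ E] [FiniteDimensional ℝ E]
  [MeasurableSpace E] [BorelSpace E]

/-- The differential in `(x, t)` of the phase `I⟪x, ξ⟫ - a t`. -/
noncomputable def phaseDeriv (a : ℂ) (ξ : E) : E × ℝ →L[ℝ] ℂ :=
  Complex.I • (Complex.ofRealCLM.comp ((innerSL ℝ ξ).comp (ContinuousLinearMap.fst ℝ E ℝ))) -
    a • (Complex.ofRealCLM.comp (ContinuousLinearMap.snd ℝ E ℝ))

theorem phaseDeriv_apply (a : ℂ) (ξ : E) (w : E × ℝ) :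
    phaseDeriv a ξ w = Complex.I * (⟪ξ, w.1⟫ : ℂ) - a * w.2 := by
  simp [phaseDeriv]

theorem norm_phaseDeriv_le (a : ℂ) (ξ : E) : ‖phaseDeriv a ξ‖ ≤ ‖ξ‖ + ‖a‖ := by
  refine ContinuousLinearMap.opNorm_le_bound _ (by positivity) fun w => ?_
  rw [phaseDeriv_apply, add_mul]
  refine (norm_sub_le _ _).trans (add_le_add ?_ ?_)
  · rw [norm_mul, Complex.norm_I, one_mul, Complex.norm_real]
    exact (norm_inner_le_norm _ _).trans (by gcongr; exact norm_fst_le w)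
  · rw [norm_mul, Complex.norm_real]
    gcongr
    exact norm_snd_le w

theorem continuous_phaseDeriv {a : E → ℂ} (ha : Continuous a) :
    Continuous fun ξ => phaseDeriv (a ξ) ξ := by
  have h : Continuous fun ξ : E => innerSL ℝ ξ := (innerSL ℝ (E := E)).continuous
  exact ((continuous_const.clm_comp (h.clm_comp continuous_const)).const_smul Complex.I).sub
    (ha.smul continuous_const)

theorem hasFDerivAt_integral_mul_cexp {α H : Type*} [MeasurableSpace α] {μ : Measure α}
    [NormedAddCommGroup H] [NormedSpace ℝ H] {m : α → ℂ} {ℓ : α → H →L[ℝ] ℂ} {x₀ : H} {S : Set H}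
    (hS : S ∈ nhds x₀)
    (hm : ∀ x, AEStronglyMeasurable (fun ξ => m ξ * Complex.exp (ℓ ξ x)) μ)
    (hℓ : AEStronglyMeasurable ℓ μ) (hi : Integrable (fun ξ => m ξ * Complex.exp (ℓ ξ x₀)) μ)
    {bd : α → ℝ} (hbi : Integrable bd μ)
    (hb : ∀ᵐ ξ ∂μ, ∀ x ∈ S, ‖m ξ * Complex.exp (ℓ ξ x)‖ * ‖ℓ ξ‖ ≤ bd ξ) :
    ∃ L : H →L[ℝ] ℂ, HasFDerivAt (fun x => ∫ ξ, m ξ * Complex.exp (ℓ ξ x) ∂μ) L x₀ ∧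
      ∀ w, L w = ∫ ξ, m ξ * Complex.exp (ℓ ξ x₀) * ℓ ξ w ∂μ := by
  have hF'm : AEStronglyMeasurable (fun ξ => (m ξ * Complex.exp (ℓ ξ x₀)) • ℓ ξ) μ :=
    (hm x₀).smul hℓ
  have hb' : ∀ᵐ ξ ∂μ, ∀ x ∈ S, ‖(m ξ * Complex.exp (ℓ ξ x)) • ℓ ξ‖ ≤ bd ξ := by
    simpa only [norm_smul] using hb
  refine ⟨_, hasFDerivAt_integral_of_dominated_of_fderiv_le
    (F' := fun x ξ => (m ξ * Complex.exp (ℓ ξ x)) • ℓ ξ) hS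
    (Filter.Eventually.of_forall hm) hi hF'm hb' hbi (Filter.Eventually.of_forall fun ξ x _ => ?_),
    fun w => ?_⟩
  · have h0 : HasFDerivAt (fun x => ℓ ξ x) (ℓ ξ) x := (ℓ ξ).hasFDerivAt
    refine ((h0.cexp).const_mul (m ξ)).congr_fderiv ?_
    rw [smul_smul]
  · rw [ContinuousLinearMap.integral_apply
      (hbi.mono' hF'm (hb'.mono fun ξ hξ => hξ x₀ (mem_of_mem_nhds hS)))]
    rfl

theorem hasFDerivAt_fourierInt_mul_exp [Nontrivial E] {a m : E → ℂ} (ha : Continuous a)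
    (hm : Measurable m) {c₀ A s M : ℝ} (hc₀ : 0 < c₀) (hA : 0 ≤ A) (hs : 0 < s) (hM : 0 ≤ M)
    (hre : ∀ ξ, c₀ * (s + ‖ξ‖) ≤ (a ξ).re) (hle : ∀ ξ, ‖a ξ‖ ≤ A * (s + ‖ξ‖))
    (hmM : ∀ ξ ≠ 0, ‖m ξ‖ ≤ M) {p : E × ℝ} (hp : 0 < p.2) :
    ∃ L : E × ℝ →L[ℝ] ℂ,
      HasFDerivAt (fun p : E × ℝ => fourierInt (fun ξ => m ξ * Complex.exp (-a ξ * p.2)) p.1) L p ∧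
        ∀ w, L w = fourierInt (fun ξ => m ξ * (Complex.I * (⟪ξ, w.1⟫ : ℂ) - a ξ * w.2) *
          Complex.exp (-a ξ * p.2)) p.1 := by
  set θ : ℝ := c₀ * (p.2 / 4) with hθ
  have hθ0 : 0 < θ := by positivity
  have hphase : ∀ (ξ : E) (x : E × ℝ), m ξ * Complex.exp (phaseDeriv (a ξ) ξ x) =
      Complex.exp (Complex.I * (⟪x.1, ξ⟫ : ℂ)) * (m ξ * Complex.exp (-a ξ * x.2)) := fun ξ x => by
    rw [phaseDeriv_apply, sub_eq_add_neg, Complex.exp_add, real_inner_comm, neg_mul]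
    ring
  have hFm : ∀ x : E × ℝ, Measurable fun ξ => m ξ * Complex.exp (phaseDeriv (a ξ) ξ x) :=
    fun x => hm.mul (Continuous.measurable (by simp_rw [phaseDeriv_apply]; fun_prop))
  have hne : ∀ᵐ ξ : E, ξ ≠ 0 := by simp [ae_iff, measure_singleton]
  set S : Set (E × ℝ) := {x | p.2 / 2 < x.2} with hS
  have hexp : ∀ ξ : E, rexp (-(2 * θ * (s + ‖ξ‖))) =
      rexp (-(θ * (s + ‖ξ‖))) * rexp (-(θ * (s + ‖ξ‖))) := fun ξ => by
    rw [← Real.exp_add]; congr 1; ring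
  have hle1 : ∀ ξ : E, rexp (-(θ * (s + ‖ξ‖))) ≤ rexp (-(θ * 1 * ‖ξ‖)) := fun ξ => by
    rw [exp_le_exp, neg_le_neg_iff, mul_one]
    gcongr
    linarith
  have hFb : ∀ ξ ≠ 0, ∀ x ∈ S, ‖m ξ * Complex.exp (phaseDeriv (a ξ) ξ x)‖ ≤
      M * (rexp (-(θ * (s + ‖ξ‖))) * rexp (-(θ * 1 * ‖ξ‖))) := by
    intro ξ hξ x hx
    rw [hphase, norm_mul, norm_exp_I_mul, one_mul, norm_mul, norm_cexp_neg_mul]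
    have h1 : 2 * θ * (s + ‖ξ‖) ≤ (a ξ).re * x.2 := by
      have h2 : p.2 / 2 < x.2 := hx
      calc _ = c₀ * (s + ‖ξ‖) * (p.2 / 2) := by rw [hθ]; ring
        _ ≤ _ := mul_le_mul (hre ξ) h2.le (by positivity)
          ((by positivity : 0 ≤ c₀ * (s + ‖ξ‖)).trans (hre ξ))
    refine mul_le_mul (hmM ξ hξ) ?_ (exp_nonneg _) hM
    refine (exp_le_exp.2 (neg_le_neg h1)).trans ?_
    rw [hexp]
    exact mul_le_mul_of_nonneg_left (hle1 ξ) (exp_nonneg _)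
  have hInt : Integrable fun ξ : E => rexp (-(θ * 1 * ‖ξ‖)) := by
    simpa using integrable_inv_norm_pow_mul_exp' (E := E) (m := 0) Module.finrank_pos hθ0 one_pos
  have hpS : p ∈ S := by
    change p.2 / 2 < p.2
    linarith
  have hi : Integrable fun ξ => m ξ * Complex.exp (phaseDeriv (a ξ) ξ p) := by
    refine (hInt.const_mul M).mono' (hFm p).aestronglyMeasurable (hne.mono fun ξ hξ => ?_)
    refine (hFb ξ hξ p hpS).trans (mul_le_mul_of_nonneg_left ?_ hM)
    refine mul_le_of_le_one_left (exp_nonneg _) ?_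
    rw [exp_le_one_iff, neg_nonpos]
    positivity
  have hb : ∀ ξ ≠ 0, ∀ x ∈ S, ‖m ξ * Complex.exp (phaseDeriv (a ξ) ξ x)‖ *
      ‖phaseDeriv (a ξ) ξ‖ ≤ M * ((1 + A) * θ⁻¹) * rexp (-(θ * 1 * ‖ξ‖)) := by
    intro ξ hξ x hx
    have h1 : ‖phaseDeriv (a ξ) ξ‖ ≤ (1 + A) * (s + ‖ξ‖) :=
      (norm_phaseDeriv_le _ _).trans (by linarith [hle ξ])
    calc _ ≤ M * (rexp (-(θ * (s + ‖ξ‖))) * rexp (-(θ * 1 * ‖ξ‖))) * ((1 + A) * (s + ‖ξ‖)) := by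
          gcongr
          exact hFb ξ hξ x hx
      _ = M * ((1 + A) * ((s + ‖ξ‖) * rexp (-(θ * (s + ‖ξ‖))))) * rexp (-(θ * 1 * ‖ξ‖)) := by
          ring
      _ ≤ _ := by
          gcongr
          exact mul_exp_neg_le hθ0
  obtain ⟨L, hL, hLw⟩ := hasFDerivAt_integral_mul_cexp
    ((isOpen_lt continuous_const continuous_snd).mem_nhds hpS)
    (fun x => (hFm x).aestronglyMeasurable) (continuous_phaseDeriv ha).aestronglyMeasurable hi
    (hInt.const_mul (M * ((1 + A) * θ⁻¹))) (hne.mono hb)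
  simp_rw [hphase] at hL hLw
  refine ⟨L, hL, fun w => ?_⟩
  rw [hLw, fourierInt]
  congr 1 with ξ
  rw [phaseDeriv_apply]
  ring

theorem enorm_le_sum_orthonormalBasis {ι : Type*} [Fintype ι] (b : OrthonormalBasis ι ℝ E)
    (L : E × ℝ →L[ℝ] ℂ) : ‖L‖ₑ ≤ ‖L (0, 1)‖ₑ + ∑ j, ‖L (b j, 0)‖ₑ := by
  have h : ‖L‖ ≤ ‖L (0, 1)‖ + ∑ j, ‖L (b j, 0)‖ := by
    refine ContinuousLinearMap.opNorm_le_bound _ (by positivity) fun w => ?_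
    have hw : w = w.2 • ((0, 1) : E × ℝ) + ∑ j, ⟪b j, w.1⟫ • ((b j, 0) : E × ℝ) := by
      refine Prod.ext ?_ ?_
      · simp [Prod.fst_sum, b.sum_repr']
      · simp [Prod.snd_sum]
    have h1 : L w = w.2 • L (0, 1) + ∑ j, ⟪b j, w.1⟫ • L (b j, 0) := by
      conv_lhs => rw [hw, map_add, map_sum, map_smul]
      simp_rw [map_smul]
    rw [h1, add_mul, Finset.sum_mul]
    refine (norm_add_le _ _).trans (add_le_add ?_ ((norm_sum_le _ _).trans ?_))
    · rw [norm_smul, mul_comm]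
      gcongr
      exact norm_snd_le w
    · gcongr with j
      rw [norm_smul, mul_comm]
      gcongr
      refine (norm_inner_le_norm _ _).trans ?_
      rw [b.orthonormal.1 j, one_mul]
      exact norm_fst_le w
  rw [← ofReal_norm]
  refine (ENNReal.ofReal_le_ofReal h).trans ?_
  rw [ENNReal.ofReal_add (norm_nonneg _) (by positivity),
    ENNReal.ofReal_sum_of_nonneg fun _ _ => norm_nonneg _]
  simp [ofReal_norm]

end PoissonDeriv

section PoissonGradient

variable {E : Type*} [NormedAddCommGroup E] [InnerProductSpace ℝ E] [FiniteDimensional ℝ E]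
  [MeasurableSpace E] [BorelSpace E]

theorem exists_lintegral_poisson_gradient_le {q : ℝ} (hq : 1 < q) {σ ρ c : ℝ}
    (hσ : σ ∈ Set.Ioo 0 (π / 2)) (hρ : 0 < ρ) (hc : 0 < c) (hd : 1 ≤ Module.finrank ℝ E) (b : ℂ) :
    ∃ C : ℝ≥0∞, C ≠ ∞ ∧ ∀ lam : ℂ, lam ≠ 0 → |lam.arg| < π - σ → ∀ s : ℝ, 0 < s →
      s ^ 2 = ‖lam‖ → ∀ k : E → ℂ, ContDiffOn ℝ (⊤ : ℕ∞) k {0}ᶜ →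
      (∀ ξ : E, ξ ≠ 0 → ∀ n ≤ Module.finrank ℝ E + 1,
        ‖iteratedFDeriv ℝ n k ξ‖ ≤ c * ((s + ‖ξ‖) ^ n)⁻¹) →
      ∀ f : SchwartzMap (E × ℝ) ℂ, ∀ K : E × ℝ → ℂ,
      (∀ p, K p = b * fourierInt (fun ξ => k ξ * Complex.exp (-sqrtSymbol ρ lam ξ * p.2) *
        fourierHat (fun z => f (z, 0)) ξ) p.1) →
      ∫⁻ p, (ENNReal.ofReal s * ‖K p‖ₑ) ^ q ∂((volume : Measure E).prod halfLine) ≤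
          C * ∫⁻ p, ((ENNReal.ofReal s * ‖f p‖ₑ) ^ q + ‖fderiv ℝ (fun p' => f p') p‖ₑ ^ q)
            ∂((volume : Measure E).prod halfLine) ∧
        ∫⁻ p, ‖fderiv ℝ K p‖ₑ ^ q ∂((volume : Measure E).prod halfLine) ≤
          C * ∫⁻ p, ((ENNReal.ofReal s * ‖f p‖ₑ) ^ q + ‖fderiv ℝ (fun p' => f p') p‖ₑ ^ q)
            ∂((volume : Measure E).prod halfLine) := by
  have : Nontrivial E := Module.nontrivial_of_finrank_pos (R := ℝ) (by omega)
  have hq0 : 0 < q := by linarith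
  obtain ⟨c₀, A, hc₀, hA, H⟩ := exists_symbol_bounds (E := E) hσ hρ hc 0
  obtain ⟨C, hC, HP⟩ := exists_lintegral_poisson_le (E := E) hq hσ hρ hc hd
  set n : ℕ := Module.finrank ℝ E + 1 with hn
  set D : ℝ≥0∞ := (n : ℝ≥0∞) ^ (q - 1) * (n * (‖b‖ₑ ^ q * C)) with hD
  have hbq : ‖b‖ₑ ^ q ≠ ∞ := ENNReal.rpow_ne_top_of_nonneg hq0.le enorm_ne_top
  refine ⟨‖b‖ₑ ^ q * C + D, ?_, ?_⟩
  · refine ENNReal.add_ne_top.2 ⟨ENNReal.mul_ne_top hbq hC, ENNReal.mul_ne_top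
      (ENNReal.rpow_ne_top_of_nonneg (by linarith) (ENNReal.natCast_ne_top _))
      (ENNReal.mul_ne_top (ENNReal.natCast_ne_top _) (ENNReal.mul_ne_top hbq hC))⟩
  intro lam hlam harg s hs hsl k hk hkb f K hK
  obtain ⟨ha, hare, hale, -⟩ := H lam hlam harg s hs hsl
  have HQ := fun Q hQ => HP lam hlam harg s hs hsl k hk hkb Q hQ f
  set a : E → ℂ := sqrtSymbol ρ lam with had
  set R : ℝ≥0∞ := ∫⁻ p, ((ENNReal.ofReal s * ‖f p‖ₑ) ^ q +
    ‖fderiv ℝ (fun p' => f p') p‖ₑ ^ q) ∂((volume : Measure E).prod halfLine) with hR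
  have hkm : Measurable k := measurable_of_continuousOn_compl_singleton 0 hk.continuousOn
  set h : E → ℂ := fourierHat fun z => f (z, 0) with hh
  have hhm : Measurable h :=
    f.hasSliceDecay.measurable_fourierHat.comp (f := fun ξ : E => (ξ, (0 : ℝ))) (by fun_prop)
  obtain ⟨M, hM, hhM⟩ := f.hasSliceDecay.norm_fourierHat_le
  set U : (E → ℂ) → E × ℝ → ℂ := fun Q p =>
    fourierInt (fun ξ => k ξ * Q ξ * Complex.exp (-a ξ * p.2) * h ξ) p.1 with hU
  have hUm : ∀ Q, Continuous Q → Measurable (U Q) := fun Q hQ => by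
    have hac := ha.continuous
    refine measurable_fourierInt_param (x := Prod.fst) (F := fun (p : E × ℝ) ξ =>
      k ξ * Q ξ * Complex.exp (-a ξ * p.2) * h ξ) ?_ measurable_fst
    refine (((hkm.comp measurable_snd).mul (hQ.measurable.comp measurable_snd)).mul
      (Continuous.measurable ?_)).mul (hhm.comp measurable_snd)
    fun_prop
  have hUb : ∀ Q, IsFirstOrder s a Q →
      ∫⁻ p, (‖b‖ₑ * ‖U Q p‖ₑ) ^ q ∂((volume : Measure E).prod halfLine) ≤ ‖b‖ₑ ^ q * C * R := by
    intro Q hQ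
    simp_rw [ENNReal.mul_rpow_of_nonneg _ _ hq0.le]
    rw [lintegral_const_mul _ ((hUm Q (hQ.continuous ha.continuous)).enorm.pow_const q), mul_assoc]
    gcongr
    exact HQ Q hQ
  constructor
  · have e : ∀ p, ENNReal.ofReal s * ‖K p‖ₑ = ‖b‖ₑ * ‖U (fun _ => (s : ℂ)) p‖ₑ := by
      intro p
      have : U (fun _ => (s : ℂ)) p = s * fourierInt (fun ξ => k ξ * Complex.exp (-a ξ * p.2) *
          h ξ) p.1 := by
        simp only [hU, fourierInt, ← integral_const_mul]
        congr 1 with ξ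
        ring
      rw [this, hK, enorm_mul, enorm_mul, ← ofReal_norm (s : ℂ), Complex.norm_real,
        norm_of_nonneg hs.le]
      ring
    simp_rw [e]
    refine (hUb _ (Or.inr (Or.inl rfl))).trans ?_
    gcongr
    exact le_self_add
  · set B := stdOrthonormalBasis ℝ E with hB
    set Q : Option (Fin (Module.finrank ℝ E)) → E → ℂ :=
      fun i => i.elim a fun j ξ => Complex.I * (⟪ξ, B j⟫ : ℂ) with hQ
    have hQf : ∀ i, IsFirstOrder s a (Q i) := by
      rintro (_ | j)
      exacts [Or.inl rfl, Or.inr (Or.inr ⟨B j, (B.orthonormal.1 j).le, rfl⟩)]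
    have hpt : ∀ p : E × ℝ, 0 < p.2 → ‖fderiv ℝ K p‖ₑ ^ q ≤
        (n : ℝ≥0∞) ^ (q - 1) * ∑ i, (‖b‖ₑ * ‖U (Q i) p‖ₑ) ^ q := by
      intro p hp
      obtain ⟨L, hL, hLw⟩ := hasFDerivAt_fourierInt_mul_exp (a := a) (m := fun ξ => k ξ * h ξ)
        ha.continuous (hkm.mul hhm) hc₀ hA.le hs (by positivity : 0 ≤ c * M) hare hale
        (fun ξ hξ => by
          rw [norm_mul]
          have := hkb ξ hξ 0 (by omega)
          rw [norm_iteratedFDeriv_zero] at this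
          refine mul_le_mul (by simpa using this) (hhM ξ 0) (norm_nonneg _) hc.le) hp
      have hKd : fderiv ℝ K p = b • L := by
        refine HasFDerivAt.fderiv ?_
        refine (hL.const_mul b).congr_of_eventuallyEq (Filter.Eventually.of_forall fun x => ?_)
        rw [hK]
        congr 3 with ξ
        ring
      have h0 : ‖L (0, 1)‖ₑ = ‖U (Q none) p‖ₑ := by
        rw [hLw, ← enorm_neg]
        simp only [hU, fourierInt, ← integral_neg]
        congr 2 with ξ
        simp only [hQ, Option.elim, inner_zero_right, Complex.ofReal_zero, Complex.ofReal_one]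
        ring
      have h1 : ∀ j, ‖L (B j, 0)‖ₑ = ‖U (Q (some j)) p‖ₑ := fun j => by
        rw [hLw]
        simp only [hU, fourierInt]
        congr 2 with ξ
        simp only [hQ, Option.elim, Complex.ofReal_zero]
        ring
      have h2 : ‖fderiv ℝ K p‖ₑ ≤ ∑ i, ‖b‖ₑ * ‖U (Q i) p‖ₑ := by
        rw [hKd, Fintype.sum_option]
        refine (enorm_le_sum_orthonormalBasis B (b • L)).trans_eq ?_
        have h3 : ∀ w, ‖(b • L) w‖ₑ = ‖b‖ₑ * ‖L w‖ₑ := fun w => enorm_mul b (L w)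
        simp_rw [h3, h0, h1]
      refine (ENNReal.rpow_le_rpow h2 hq0.le).trans
        ((ENNReal.rpow_sum_le_const_mul_sum_rpow _ _ hq.le).trans_eq ?_)
      simp [hn]
    have hm : ∀ i, Measurable fun p => (‖b‖ₑ * ‖U (Q i) p‖ₑ) ^ q := fun i =>
      (((hUm _ ((hQf i).continuous ha.continuous)).enorm).const_mul _).pow_const q
    calc _ ≤ ∫⁻ p, (n : ℝ≥0∞) ^ (q - 1) * ∑ i, (‖b‖ₑ * ‖U (Q i) p‖ₑ) ^ q
          ∂((volume : Measure E).prod halfLine) := lintegral_mono_ae (ae_prod_halfLine.mono hpt)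
      _ = (n : ℝ≥0∞) ^ (q - 1) * ∑ i, ∫⁻ p, (‖b‖ₑ * ‖U (Q i) p‖ₑ) ^ q
          ∂((volume : Measure E).prod halfLine) := by
          rw [lintegral_const_mul _ (Finset.measurable_sum _ fun i _ => hm i),
            lintegral_finsetSum _ fun i _ => hm i]
      _ ≤ (n : ℝ≥0∞) ^ (q - 1) * ∑ _i : Option (Fin (Module.finrank ℝ E)), ‖b‖ₑ ^ q * C * R := by
          gcongr with i
          exact hUb _ (hQf i)
      _ = D * R := by
          rw [Finset.sum_const, Finset.card_univ, nsmul_eq_mul, Fintype.card_option,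
            Fintype.card_fin, hD]
          ring
      _ ≤ _ := by
          gcongr
          exact le_add_self

end PoissonGradient

section LqNorm

variable {α F : Type*} [MeasurableSpace α] [NormedAddCommGroup F] {μ : Measure α} {q : ℝ}

theorem LqNorm_eq_toReal (hq : 0 < q) {f : α → F} (hf : AEStronglyMeasurable f μ) :
    LqNorm μ q f = ((∫⁻ x, ‖f x‖ₑ ^ q ∂μ) ^ (1 / q)).toReal := by
  rw [LqNorm, ← ENNReal.toReal_rpow, integral_eq_lintegral_of_nonneg_ae
    (Filter.Eventually.of_forall fun x => by positivity)
    (hf.norm.aemeasurable.pow_const q).aestronglyMeasurable]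
  congr 3 with x
  rw [← ENNReal.ofReal_rpow_of_nonneg (norm_nonneg _) hq.le, ofReal_norm]

theorem LqNorm_le_toReal (hq : 0 < q) (f : α → F) :
    LqNorm μ q f ≤ ((∫⁻ x, ‖f x‖ₑ ^ q ∂μ) ^ (1 / q)).toReal := by
  rw [LqNorm, ← ENNReal.toReal_rpow]
  refine rpow_le_rpow (integral_nonneg fun x => by positivity) ?_ (by positivity)
  by_cases hi : Integrable (fun x => ‖f x‖ ^ q) μ
  · rw [integral_eq_lintegral_of_nonneg_ae
      (Filter.Eventually.of_forall fun x => by positivity) hi.1]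
    refine le_of_eq ?_
    congr 2 with x
    rw [← ENNReal.ofReal_rpow_of_nonneg (norm_nonneg _) hq.le, ofReal_norm]
  · rw [integral_undef hi]
    exact ENNReal.toReal_nonneg

theorem LqNorm_const_mul (hq : 0 < q) {s : ℝ} (hs : 0 ≤ s) (f : α → ℂ) :
    LqNorm μ q (fun x => (s : ℂ) * f x) = s * LqNorm μ q f := by
  simp_rw [LqNorm, norm_mul, Complex.norm_real, norm_of_nonneg hs,
    mul_rpow hs (norm_nonneg _), integral_const_mul]
  rw [mul_rpow (by positivity) (integral_nonneg fun x => by positivity), ← rpow_mul hs,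
    mul_one_div_cancel hq.ne', rpow_one]

end LqNorm

section Reflection

variable {E : Type*} [NormedAddCommGroup E] [InnerProductSpace ℝ E] [FiniteDimensional ℝ E]
  [MeasurableSpace E] [BorelSpace E]

theorem restrict_upperHalfSpace :
    (volume : Measure (E × ℝ)).restrict {p | 0 < p.2} = (volume : Measure E).prod halfLine := by
  have : {p : E × ℝ | 0 < p.2} = Set.univ ×ˢ Set.Ioi 0 := by
    ext p; simp
  rw [this, Measure.volume_eq_prod, ← Measure.prod_restrict, Measure.restrict_univ]

variable (E) in
/-- The reflection `(z, y) ↦ (z, -y)`. -/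
noncomputable def reflectLast : E × ℝ ≃ₗᵢ[ℝ] E × ℝ where
  toLinearEquiv := (LinearEquiv.refl ℝ E).prodCongr (LinearEquiv.neg ℝ)
  norm_map' p := by simp [Prod.norm_def]

theorem reflectLast_apply (p : E × ℝ) : reflectLast E p = (p.1, -p.2) := rfl

theorem measurePreserving_reflectLast :
    MeasurePreserving (reflectLast E) (volume : Measure (E × ℝ)) volume :=
  (MeasurePreserving.id (volume : Measure E)).prod (Measure.measurePreserving_neg volume)

theorem LqNorm_comp_reflectLast {F : Type*} [NormedAddCommGroup F] (q : ℝ) (g : E × ℝ → F) :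
    LqNorm (volume.restrict {p : E × ℝ | 0 < p.2}) q (fun p => g (reflectLast E p)) =
      LqNorm (volume.restrict {p : E × ℝ | 0 < -1 * p.2}) q g := by
  have h := measurePreserving_reflectLast.setIntegral_preimage_emb
    (reflectLast E).toHomeomorph.measurableEmbedding (fun p => ‖g p‖ ^ q)
    {p : E × ℝ | 0 < -1 * p.2}
  rw [LqNorm, LqNorm, ← h]
  congr 3
  ext p
  simp [reflectLast_apply]

/-- The composition of a Schwartz function with the reflection `(z, y) ↦ (z, -y)`. -/
noncomputable def SchwartzMap.reflectLast (f : SchwartzMap (E × ℝ) ℂ) : SchwartzMap (E × ℝ) ℂ :=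
  SchwartzMap.compCLMOfContinuousLinearEquiv ℝ
    (_root_.reflectLast E).toContinuousLinearEquiv f

theorem SchwartzMap.reflectLast_apply (f : SchwartzMap (E × ℝ) ℂ) (p : E × ℝ) :
    f.reflectLast p = f (_root_.reflectLast E p) := rfl

theorem SchwartzMap.norm_fderiv_reflectLast (f : SchwartzMap (E × ℝ) ℂ) (p : E × ℝ) :
    ‖fderiv ℝ (fun p' => f.reflectLast p') p‖ =
      ‖fderiv ℝ (fun p' => f p') (_root_.reflectLast E p)‖ := by
  have h : fderiv ℝ (fun p' => f.reflectLast p') p =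
      (fderiv ℝ (fun p' => f p') (_root_.reflectLast E p)).comp
        ((_root_.reflectLast E).toContinuousLinearEquiv : E × ℝ →L[ℝ] E × ℝ) :=
    ((f.hasFDerivAt_coe (_root_.reflectLast E p)).comp p
      (_root_.reflectLast E).toContinuousLinearEquiv.hasFDerivAt).fderiv
  rw [h]
  exact ContinuousLinearMap.opNorm_comp_linearIsometryEquiv _ _

theorem SchwartzMap.lintegral_rpow_enorm_ne_top {F : Type*} [NormedAddCommGroup F]
    [NormedSpace ℝ F] (f : SchwartzMap (E × ℝ) F) {q : ℝ} (hq : 0 < q) (S : Set (E × ℝ)) :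
    ∫⁻ p in S, ‖f p‖ₑ ^ q ≠ ∞ := by
  have : (volume : Measure (E × ℝ)).IsAddHaarMeasure :=
    inferInstanceAs ((volume : Measure E).prod (volume : Measure ℝ)).IsAddHaarMeasure
  have h := (f.memLp (ENNReal.ofReal q) (volume : Measure (E × ℝ))).eLpNorm_lt_top
  have h1 := lintegral_rpow_enorm_lt_top_of_eLpNorm_lt_top (by simpa using hq)
    ENNReal.ofReal_ne_top h
  rw [ENNReal.toReal_ofReal hq.le] at h1
  exact ((lintegral_mono' Measure.restrict_le_self le_rfl).trans_lt h1).ne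

/-- The weighted first-order norm of a Schwartz function on the upper half-space dominates its
`L^q` data. -/
theorem SchwartzMap.toReal_rpow_le (f : SchwartzMap (E × ℝ) ℂ) {q : ℝ} (hq : 1 < q) {s : ℝ}
    (hs : 0 < s) {C X : ℝ≥0∞} (hC : C ≠ ∞)
    (hX : X ≤ C * ∫⁻ p, ((ENNReal.ofReal s * ‖f p‖ₑ) ^ q + ‖fderiv ℝ (fun p' => f p') p‖ₑ ^ q)
      ∂((volume : Measure E).prod halfLine)) :
    (X ^ (1 / q)).toReal ≤ (C ^ (1 / q)).toReal *
      (s * LqNorm (volume.restrict {p : E × ℝ | 0 < p.2}) q (fun p => f p) +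
        LqNorm (volume.restrict {p : E × ℝ | 0 < p.2}) q
          (fun p => fderiv ℝ (fun p' => f p') p)) := by
  have hq0 : 0 < q := by linarith
  have hq1 : 0 ≤ 1 / q := by positivity
  have fd : Continuous fun p => fderiv ℝ (fun p' => f p') p :=
    (SchwartzMap.fderivCLM ℝ (E × ℝ) ℂ f).continuous
  have fc : Continuous fun p => f p := f.continuous
  rw [← LqNorm_const_mul hq0 hs.le, LqNorm_eq_toReal hq0 (by fun_prop),
    LqNorm_eq_toReal hq0 fd.aestronglyMeasurable]
  rw [← restrict_upperHalfSpace] at hX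
  have e : ∀ p : E × ℝ, ENNReal.ofReal s * ‖f p‖ₑ = ‖(s : ℂ) * f p‖ₑ := fun p => by
    rw [enorm_mul, ← ofReal_norm (s : ℂ), Complex.norm_real, norm_of_nonneg hs.le]
  simp_rw [e] at hX
  rw [lintegral_add_left (by fun_prop)] at hX
  have h1 := (SchwartzMap.fderivCLM ℝ (E × ℝ) ℂ f).lintegral_rpow_enorm_ne_top hq0
    {p : E × ℝ | 0 < p.2}
  have h2 := ((s : ℂ) • f).lintegral_rpow_enorm_ne_top hq0 {p : E × ℝ | 0 < p.2}
  change ∫⁻ p in {p : E × ℝ | 0 < p.2}, ‖fderiv ℝ (fun p' => f p') p‖ₑ ^ q ≠ ∞ at h1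
  change ∫⁻ p in {p : E × ℝ | 0 < p.2}, ‖(s : ℂ) * f p‖ₑ ^ q ≠ ∞ at h2
  have t1 := ENNReal.rpow_ne_top_of_nonneg hq1 h1
  have t2 := ENNReal.rpow_ne_top_of_nonneg hq1 h2
  have tC := ENNReal.rpow_ne_top_of_nonneg hq1 hC
  rw [← ENNReal.toReal_add t2 t1, ← ENNReal.toReal_mul]
  refine ENNReal.toReal_mono (ENNReal.mul_ne_top tC (ENNReal.add_ne_top.2 ⟨t2, t1⟩)) ?_
  refine (ENNReal.rpow_le_rpow hX hq1).trans ?_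
  rw [ENNReal.mul_rpow_of_nonneg _ _ hq1]
  gcongr
  exact ENNReal.rpow_add_le_add_rpow _ _ hq1 (by rw [div_le_one hq0]; exact hq.le)

theorem exists_LqNorm_poisson_le {q : ℝ} (hq : 1 < q) {σ ρ c : ℝ}
    (hσ : σ ∈ Set.Ioo 0 (π / 2)) (hρ : 0 < ρ) (hc : 0 < c) (hd : 1 ≤ Module.finrank ℝ E) (b : ℂ) :
    ∃ C : ℝ, 0 < C ∧ ∀ lam : ℂ, lam ≠ 0 → |lam.arg| < π - σ → ∀ s : ℝ, 0 < s →
      s ^ 2 = ‖lam‖ → ∀ k : E → ℂ, ContDiffOn ℝ (⊤ : ℕ∞) k {0}ᶜ →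
      (∀ ξ : E, ξ ≠ 0 → ∀ n ≤ Module.finrank ℝ E + 1,
        ‖iteratedFDeriv ℝ n k ξ‖ ≤ c * ((s + ‖ξ‖) ^ n)⁻¹) →
      ∀ f : SchwartzMap (E × ℝ) ℂ, ∀ K : E × ℝ → ℂ,
      (∀ p, K p = b * fourierInt (fun ξ => k ξ * Complex.exp (-sqrtSymbol ρ lam ξ * p.2) *
        fourierHat (fun z => f (z, 0)) ξ) p.1) → ∀ ς : ℝ, (ς = 1 ∨ ς = -1) →
      s * LqNorm (volume.restrict {p : E × ℝ | 0 < p.2}) q K +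
          LqNorm (volume.restrict {p : E × ℝ | 0 < p.2}) q (fun p => fderiv ℝ K p) ≤
        C * (s * LqNorm (volume.restrict {p : E × ℝ | 0 < ς * p.2}) q (fun p => f p) +
          LqNorm (volume.restrict {p : E × ℝ | 0 < ς * p.2}) q
            (fun p => fderiv ℝ (fun p' => f p') p)) := by
  have hq0 : 0 < q := by linarith
  obtain ⟨C, hC, H⟩ := exists_lintegral_poisson_gradient_le (E := E) hq hσ hρ hc hd b
  refine ⟨2 * (C ^ (1 / q)).toReal + 1, by positivity, ?_⟩
  intro lam hlam harg s hs hsl k hk hkb f K hK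
  have upper : ∀ g : SchwartzMap (E × ℝ) ℂ, (∀ z, g (z, 0) = f (z, 0)) →
      s * LqNorm (volume.restrict {p : E × ℝ | 0 < p.2}) q K +
          LqNorm (volume.restrict {p : E × ℝ | 0 < p.2}) q (fun p => fderiv ℝ K p) ≤
        (2 * (C ^ (1 / q)).toReal + 1) *
          (s * LqNorm (volume.restrict {p : E × ℝ | 0 < p.2}) q (fun p => g p) +
          LqNorm (volume.restrict {p : E × ℝ | 0 < p.2}) q
            (fun p => fderiv ℝ (fun p' => g p') p)) := by
    intro g hg
    have hKg := hK
    simp_rw [← hg] at hKg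
    obtain ⟨h1, h2⟩ := H lam hlam harg s hs hsl k hk hkb g K hKg
    have k1 := g.toReal_rpow_le hq hs hC h1
    have k2 := g.toReal_rpow_le hq hs hC h2
    have l1 := LqNorm_le_toReal (μ := volume.restrict {p : E × ℝ | 0 < p.2}) hq0
      fun p => (s : ℂ) * K p
    have l2 := LqNorm_le_toReal (μ := volume.restrict {p : E × ℝ | 0 < p.2}) hq0
      fun p => fderiv ℝ K p
    have e : ∀ p : E × ℝ, ‖(s : ℂ) * K p‖ₑ = ENNReal.ofReal s * ‖K p‖ₑ := fun p => by
      rw [enorm_mul, ← ofReal_norm (s : ℂ), Complex.norm_real, norm_of_nonneg hs.le]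
    rw [LqNorm_const_mul hq0 hs.le] at l1
    simp_rw [e] at l1
    rw [← restrict_upperHalfSpace] at k1 k2
    have hnn : 0 ≤ s * LqNorm (volume.restrict {p : E × ℝ | 0 < p.2}) q (fun p => g p) +
        LqNorm (volume.restrict {p : E × ℝ | 0 < p.2}) q
          (fun p => fderiv ℝ (fun p' => g p') p) := by
      unfold LqNorm
      positivity
    linarith
  rintro ς (rfl | rfl)
  · simpa only [one_mul] using upper f fun _ => rfl
  · refine (upper f.reflectLast fun z => ?_).trans_eq ?_
    · rw [f.reflectLast_apply, _root_.reflectLast_apply, neg_zero]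
    · have h1 := LqNorm_comp_reflectLast q fun p : E × ℝ => f p
      have h2 := LqNorm_comp_reflectLast q fun p : E × ℝ => fderiv ℝ (fun p' => f p') p
      rw [← h1, ← h2]
      congr 2
      simp_rw [LqNorm, f.norm_fderiv_reflectLast]

end Reflection

/-- Lemma 2.6(1) (operator `K₁(λ)`, estimates (2.3)–(2.4)): the operator built from the
symbol `k(ξ')` and the kernel `e^{-A(ξ')x_N}` applied to the boundary trace `f̂(ξ', 0)`
satisfies `|λ|^{1/2}‖Kf‖_{L^q(ℝ^N_+)} + ‖∇Kf‖_{L^q(ℝ^N_+)}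
  ≤ C(|λ|^{1/2}‖f‖_{L^q(ℝ^N_ς)} + ‖∇f‖_{L^q(ℝ^N_ς)})`, uniformly in `λ`, `k`, `f`. -/
theorem stmt_17 (N : ℕ) (hN : 2 ≤ N) (q : ℝ) (hq : 1 < q) (σ : ℝ)
    (hσ : σ ∈ Set.Ioo 0 (π / 2)) (ρp ρm : ℝ) (hρp : 0 < ρp) (hρm : 0 < ρm)
    (c : ℝ) (hc : 0 < c) :
    ∃ C : ℝ, 0 < C ∧
      ∀ lam : ℂ, lam ≠ 0 → |lam.arg| < π - σ →
      ∀ ρa : ℝ, (ρa = ρp ∨ ρa = ρm) →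
      ∀ k : EuclideanSpace ℝ (Fin (N - 1)) → ℂ,
        ContDiffOn ℝ (⊤ : ℕ∞) k {0}ᶜ →
        (∀ ξ : EuclideanSpace ℝ (Fin (N - 1)), ξ ≠ 0 → ∀ n : ℕ, n ≤ N + 1 →
          ‖iteratedFDeriv ℝ n k ξ‖ ≤
            c * (‖lam‖ ^ ((1 : ℝ) / 2) + ‖ξ‖) ^ (-(n : ℝ))) →
      ∀ f : SchwartzMap (EuclideanSpace ℝ (Fin (N - 1)) × ℝ) ℂ,
      ∀ K : EuclideanSpace ℝ (Fin (N - 1)) × ℝ → ℂ,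
        (∀ p : EuclideanSpace ℝ (Fin (N - 1)) × ℝ,
          K p = (((2 * π) ^ (N - 1) : ℝ) : ℂ)⁻¹ *
            ∫ ξ : EuclideanSpace ℝ (Fin (N - 1)),
              Complex.exp (Complex.I * (⟪p.1, ξ⟫ : ℂ)) * k ξ *
                Complex.exp (-(((ρa : ℂ) * lam + (‖ξ‖ : ℂ) ^ 2) ^ ((1 : ℂ) / 2)) * (p.2 : ℂ)) *
                (∫ z : EuclideanSpace ℝ (Fin (N - 1)),
                  Complex.exp (-Complex.I * (⟪z, ξ⟫ : ℂ)) * f (z, 0))) →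
      ∀ ς : ℝ, (ς = 1 ∨ ς = -1) →
        ‖lam‖ ^ ((1 : ℝ) / 2) *
            LqNorm (volume.restrict {p : EuclideanSpace ℝ (Fin (N - 1)) × ℝ | 0 < p.2}) q K +
          LqNorm (volume.restrict {p : EuclideanSpace ℝ (Fin (N - 1)) × ℝ | 0 < p.2}) q
            (fun p => fderiv ℝ K p) ≤
        C * (‖lam‖ ^ ((1 : ℝ) / 2) *
            LqNorm (volume.restrict {p : EuclideanSpace ℝ (Fin (N - 1)) × ℝ | 0 < ς * p.2}) q
              (fun p => f p) +
          LqNorm (volume.restrict {p : EuclideanSpace ℝ (Fin (N - 1)) × ℝ | 0 < ς * p.2}) q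
            (fun p => fderiv ℝ (fun p' => f p') p)) := by
  have hfr : Module.finrank ℝ (EuclideanSpace ℝ (Fin (N - 1))) = N - 1 := by simp
  have hd : 1 ≤ Module.finrank ℝ (EuclideanSpace ℝ (Fin (N - 1))) := by omega
  set b : ℂ := (((2 * π) ^ (N - 1) : ℝ) : ℂ)⁻¹ with hb
  obtain ⟨C₁, hC₁, H₁⟩ := exists_LqNorm_poisson_le hq hσ hρp hc hd b
  obtain ⟨C₂, hC₂, H₂⟩ := exists_LqNorm_poisson_le hq hσ hρm hc hd b
  refine ⟨C₁ + C₂, by positivity, ?_⟩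
  intro lam hlam harg ρa hρa k hk hkb f K hK ς hς
  set s : ℝ := ‖lam‖ ^ ((1 : ℝ) / 2) with hs
  have hs0 : 0 < s := rpow_pos_of_pos (norm_pos_iff.2 hlam) _
  have hs2 : s ^ 2 = ‖lam‖ := by
    rw [hs, ← rpow_natCast, ← rpow_mul (norm_nonneg _)]
    norm_num
  have hkb' : ∀ ξ : EuclideanSpace ℝ (Fin (N - 1)), ξ ≠ 0 →
      ∀ n ≤ Module.finrank ℝ (EuclideanSpace ℝ (Fin (N - 1))) + 1,
        ‖iteratedFDeriv ℝ n k ξ‖ ≤ c * ((s + ‖ξ‖) ^ n)⁻¹ := by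
    intro ξ hξ n hn
    refine (hkb ξ hξ n (by omega)).trans_eq ?_
    rw [rpow_neg (by positivity), rpow_natCast]
  have hK' : ∀ p, K p = b * fourierInt (fun ξ => k ξ *
      Complex.exp (-sqrtSymbol ρa lam ξ * p.2) * fourierHat (fun z => f (z, 0)) ξ) p.1 := by
    intro p
    rw [hK, fourierInt]
    simp only [sqrtSymbol, fourierHat, mul_assoc]
  have hnn : 0 ≤ s * LqNorm
      (volume.restrict {p : EuclideanSpace ℝ (Fin (N - 1)) × ℝ | 0 < ς * p.2}) q (fun p => f p) +
      LqNorm (volume.restrict {p : EuclideanSpace ℝ (Fin (N - 1)) × ℝ | 0 < ς * p.2}) q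
        (fun p => fderiv ℝ (fun p' => f p') p) := by
    unfold LqNorm
    positivity
  rcases hρa with rfl | rfl
  · refine (H₁ lam hlam harg s hs0 hs2 k hk hkb' f K hK' ς hς).trans ?_
    exact mul_le_mul_of_nonneg_right (by linarith) hnn
  · refine (H₂ lam hlam harg s hs0 hs2 k hk hkb' f K hK' ς hς).trans ?_
    exact mul_le_mul_of_nonneg_right (by linarith) hnn
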